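/- For every integer n > 2 there exist constants c = c(n) and e = e(n) such that the following holds. Let f ∈ ℤ[y_1,…,y_n] be a polynomial whose homogeneous part h(f) of highest degree is absolutely irreducible (i.e., irreducible in ℂ[y_1,…,y_n]) of degree d ≥ 5, and let X ⊆ 𝔸^n be the affine hypersurface f = 0. Then for every real H ≥ 2, the number of points of X(ℤ,H) is at most c·d^e·H^{n−2}. -/

import Mathlib

namespace DG
open MvPolynomial

lemma finrank_rtd (K : Type*) [Field K] (n : ℕ) :
    2 * Module.finrank K (restrictTotalDegree (Fin 2) K n) = (n+1)*(n+2) := by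
  have h := Module.finrank_eq_nat_card_basis (basisRestrictSupport K {s : Fin 2 →₀ ℕ | (s.sum fun _ e => e) ≤ n})
  unfold restrictTotalDegree
  rw [h]
  have e : {s : Fin 2 →₀ ℕ | (s.sum fun _ e => e) ≤ n} ≃
      ((Finset.range (n+1)).sigma (fun k => Finset.HasAntidiagonal.antidiagonal k)) :=
    { toFun := fun s => ⟨⟨s.1 0 + s.1 1, (s.1 0, s.1 1)⟩, by
        have := s.2
        simp [Finsupp.sum_fintype] at this ⊢; omega⟩
      invFun := fun t => ⟨Finsupp.equivFunOnFinite.symm ![t.1.2.1, t.1.2.2], by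
        have := t.2
        rw [Finset.mem_sigma, Finset.mem_range, Finset.HasAntidiagonal.mem_antidiagonal] at this
        simp [Finsupp.sum_fintype] at this ⊢; omega⟩
      left_inv := by
        intro s; ext i; fin_cases i <;> simp
      right_inv := by
        rintro ⟨⟨k, i, j⟩, h⟩
        simp at h ⊢
        obtain ⟨h1, h2⟩ := h
        subst h2; simp }
  rw [Nat.card_congr e, Nat.card_eq_fintype_card, Fintype.card_coe, Finset.card_sigma]
  simp only [Finset.Nat.card_antidiagonal]
  clear h e
  induction n with
  | zero => simp
  | succ n ih =>
    rw [Finset.sum_range_succ, mul_add, ih]; ring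

lemma exists_interp {K : Type*} [Field K] {m : ℕ} (Z : Finset (Fin m → K)) (z0 : Fin m → K) :
    ∃ L : MvPolynomial (Fin m) K, L.totalDegree ≤ Z.card ∧ eval z0 L ≠ 0 ∧
      ∀ z ∈ Z, z ≠ z0 → eval z L = 0 := by
  classical
  induction Z using Finset.induction_on with
  | empty => exact ⟨1, by simp, by simp, by simp⟩
  | insert a s ha ih =>
    obtain ⟨L, h1, h2, h3⟩ := ih
    by_cases h : a = z0
    · refine ⟨L, ?_, h2, ?_⟩
      · rw [Finset.card_insert_of_notMem ha]; omega
      · intro z hz hne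
        rcases Finset.mem_insert.1 hz with rfl | hz
        · exact absurd h hne
        · exact h3 z hz hne
    · obtain ⟨i, hi⟩ : ∃ i, a i ≠ z0 i := by
        by_contra hc; push Not at hc; exact h (funext hc)
      refine ⟨(X i - C (a i)) * L, ?_, ?_, ?_⟩
      · rw [Finset.card_insert_of_notMem ha]
        refine (totalDegree_mul _ _).trans ?_
        have : (X i - C (a i) : MvPolynomial (Fin m) K).totalDegree ≤ 1 := by
          refine (totalDegree_sub_C_le _ _).trans ?_
          simp
        omega
      · simp only [map_mul, map_sub, eval_X, eval_C]
        exact mul_ne_zero (sub_ne_zero.2 (Ne.symm hi)) h2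
      · intro z hz hne
        rcases Finset.mem_insert.1 hz with rfl | hz
        · simp
        · simp [h3 z hz hne]

theorem bezout {K : Type*} [Field K] (f g : MvPolynomial (Fin 2) K) (hf : Irreducible f)
    (hfg : ¬ f ∣ g) (Z : Finset (Fin 2 → K)) (hZ : ∀ z ∈ Z, eval z f = 0 ∧ eval z g = 0) :
    Z.card ≤ f.totalDegree * g.totalDegree := by
  classical
  have hg0 : g ≠ 0 := by rintro rfl; exact hfg (dvd_zero _)
  have hf0 : f ≠ 0 := hf.ne_zero
  set a := f.totalDegree with ha
  set b := g.totalDegree with hb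
  set n := Z.card + a + b with hn
  let V : ℕ → Submodule K (MvPolynomial (Fin 2) K) := fun k => restrictTotalDegree (Fin 2) K k
  have memV : ∀ k p, p ∈ V k ↔ p.totalDegree ≤ k := fun k p => mem_restrictTotalDegree _ _ _
  let E : MvPolynomial (Fin 2) K →ₗ[K] (Z → K) := LinearMap.pi fun z => (aeval z.1).toLinearMap
  have hEa : ∀ p z, E p z = eval z.1 p := by
    intro p z; exact congrFun (congrArg DFunLike.coe (coe_aeval_eq_eval z.1)) p
  have hsurj : Function.Surjective (E.domRestrict (V n)) := by
    intro c
    choose L h1 h2 h3 using fun z0 : Z => exists_interp Z z0.1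
    refine ⟨⟨∑ z : Z, C (c z / eval z.1 (L z)) * L z, ?_⟩, ?_⟩
    · rw [memV]
      refine totalDegree_finsetSum_le fun z _ => ?_
      refine (totalDegree_mul _ _).trans ?_
      have := h1 z
      simp; omega
    · funext w
      rw [LinearMap.domRestrict_apply, hEa]
      simp only [map_sum, map_mul, eval_C]
      rw [Finset.sum_eq_single w]
      · rw [div_mul_cancel₀ _ (h2 w)]
      · intro z _ hz
        rw [h3 z w.1 w.2 (fun h => hz (Subtype.ext h.symm)), mul_zero]
      · simp
  let φ : (V (n - a) × V (n - b)) →ₗ[K] MvPolynomial (Fin 2) K :=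
    ((LinearMap.mulLeft K f).comp (V (n-a)).subtype).coprod ((LinearMap.mulLeft K g).comp (V (n-b)).subtype)
  have hφ : ∀ p, φ p = f * p.1.1 + g * p.2.1 := by intro p; simp [φ]
  have hUV : LinearMap.range φ ≤ V n := by
    rintro _ ⟨p, rfl⟩
    rw [memV, hφ]
    refine (totalDegree_add _ _).trans (max_le ?_ ?_)
    · refine (totalDegree_mul _ _).trans ?_
      have := (memV _ _).1 p.1.2
      omega
    · refine (totalDegree_mul _ _).trans ?_
      have := (memV _ _).1 p.2.2
      omega
  have hker : Module.finrank K (LinearMap.ker φ) ≤ Module.finrank K (V (n - a - b)) := by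
    have hmul : ∀ q : V (n-a-b), (-(g * q.1)) ∈ V (n-a) ∧ f * q.1 ∈ V (n-b) := by
      intro q
      have hq := (memV _ _).1 q.2
      rw [memV, memV, totalDegree_neg]
      exact ⟨(totalDegree_mul _ _).trans (by omega), (totalDegree_mul _ _).trans (by omega)⟩
    let ψ : V (n-a-b) →ₗ[K] (V (n - a) × V (n - b)) :=
      { toFun := fun q => (⟨_, (hmul q).1⟩, ⟨_, (hmul q).2⟩)
        map_add' := by intro p q; ext1 <;> apply Subtype.ext <;> simp <;> ring
        map_smul' := by intro c q; ext1 <;> apply Subtype.ext <;> simp }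
    refine le_trans ?_ (LinearMap.finrank_range_le ψ)
    refine Submodule.finrank_mono ?_
    rintro ⟨p, q⟩ hpq
    rw [LinearMap.mem_ker, hφ] at hpq
    simp only at hpq
    have hdvd : f ∣ q.1 := by
      have : f ∣ g * q.1 := ⟨-p.1, by linear_combination hpq⟩
      exact (hf.prime.dvd_or_dvd this).resolve_left hfg
    obtain ⟨r, hr⟩ := hdvd
    have hpr : p.1 = -(g * r) := by
      apply mul_left_cancel₀ hf0
      rw [hr] at hpq; linear_combination hpq
    have hrV : r ∈ V (n-a-b) := by
      rw [memV]
      by_cases hr0 : r = 0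
      · simp [hr0]
      · have := (memV _ _).1 q.2
        rw [hr, totalDegree_mul_of_isDomain hf0 hr0] at this
        omega
    refine ⟨⟨r, hrV⟩, ?_⟩
    ext1 <;> apply Subtype.ext
    · exact hpr.symm
    · exact hr.symm
  have h1 := LinearMap.finrank_range_add_finrank_ker (E.domRestrict (V n))
  have h2 := LinearMap.finrank_range_add_finrank_ker φ
  rw [LinearMap.range_eq_top.2 hsurj, finrank_top, Module.finrank_fintype_fun_eq_card,
    Fintype.card_coe] at h1
  rw [Module.finrank_prod] at h2
  have h3 : Module.finrank K (LinearMap.range φ) ≤ Module.finrank K (LinearMap.ker (E.domRestrict (V n))) := by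
    rw [← (Submodule.comapSubtypeEquivOfLe hUV).finrank_eq]
    refine Submodule.finrank_mono ?_
    rintro ⟨x, hx⟩ ⟨p, hp⟩
    simp only [Submodule.subtype_apply] at hp
    subst hp
    rw [LinearMap.mem_ker]
    funext z
    rw [LinearMap.domRestrict_apply, hEa]
    change eval z.1 (φ p) = 0
    rw [hφ]
    simp [(hZ z.1 z.2).1, (hZ z.1 z.2).2]
  have e1 := finrank_rtd K n
  have e2 := finrank_rtd K (n-a)
  have e3 := finrank_rtd K (n-b)
  have e4 := finrank_rtd K (n-a-b)
  change 2 * Module.finrank K (V n) = _ at e1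
  change 2 * Module.finrank K (V (n-a)) = _ at e2
  change 2 * Module.finrank K (V (n-b)) = _ at e3
  change 2 * Module.finrank K (V (n-a-b)) = _ at e4
  generalize Module.finrank K (LinearMap.range φ) = y1 at *
  generalize Module.finrank K (LinearMap.ker φ) = y2 at *
  generalize Module.finrank K (LinearMap.ker (E.domRestrict (V n))) = y3 at *
  generalize Module.finrank K (V n) = x1 at *
  generalize Module.finrank K (V (n-a)) = x2 at *
  generalize Module.finrank K (V (n-b)) = x3 at *
  generalize Module.finrank K (V (n-a-b)) = x4 at *
  have k1 : n - a = Z.card + b := by omega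
  have k2 : n - b = Z.card + a := by omega
  have k3 : n - a - b = Z.card := by omega
  rw [k1] at e2; rw [k2] at e3; rw [k3] at e4
  rw [hn] at e1
  nlinarith
end DG

namespace DG
open MvPolynomial

/-- p-adic determinant lemma. -/
lemma det_dvd {ι I : Type*} [Fintype ι] [DecidableEq ι] [Fintype I] [DecidableEq I]
    (q : ℤ) (K : ℕ) (e : I → ℕ) (lam : ι → I → ℤ) (Cf : I → ι → ℤ) (Z V : Matrix ι ι ℤ)
    (hV : ∀ i j, V i j = (∑ r, q ^ (e r) * lam i r * Cf r j) + q ^ K * Z i j)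
    (m : ℕ) (hm : m + ∑ k ∈ Finset.range K, (Finset.univ.filter (fun r => e r < k + 1)).card
      ≤ K * Fintype.card ι) :
    q ^ m ∣ V.det := by
  classical
  let g : ι → Option I → (ι → ℤ) := fun i r =>
    match r with
    | some r => fun j => q ^ (e r) * lam i r * Cf r j
    | none => fun j => q ^ K * Z i j
  have hrow : V = fun i => ∑ r, g i r := by
    funext i j
    rw [hV, Finset.sum_apply, Fintype.sum_option, add_comm]
  have hdet : V.det = Matrix.detRowAlternating (R := ℤ) (n := ι) V := rfl
  rw [hdet, hrow]
  change q ^ m ∣ (Matrix.detRowAlternating (R := ℤ) (n := ι)).toMultilinearMap (fun i => ∑ r, g i r)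
  rw [MultilinearMap.map_sum]
  refine Finset.dvd_sum fun ρ _ => ?_
  let E : Option I → ℕ := fun r => match r with | some r => e r | none => K
  let g' : ι → Option I → (ι → ℤ) := fun i r =>
    match r with
    | some r => Cf r
    | none => Z i
  let l' : ι → Option I → ℤ := fun i r =>
    match r with
    | some r => lam i r
    | none => 1
  have hg : (fun i => g i (ρ i)) = fun i => (q ^ E (ρ i) * l' i (ρ i)) • g' i (ρ i) := by
    funext i j
    cases h : ρ i <;> simp [g, E, g', l']
  rw [hg, MultilinearMap.map_smul_univ, smul_eq_mul]
  by_cases hinj : ∃ i i', i ≠ i' ∧ ∃ r, ρ i = some r ∧ ρ i' = some r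
  · obtain ⟨i, i', hne, r, h1, h2⟩ := hinj
    have : (Matrix.detRowAlternating (R := ℤ) (n := ι)).toMultilinearMap (fun i => g' i (ρ i)) = 0 := by
      apply AlternatingMap.map_eq_zero_of_eq _ _ _ hne
      simp [g', h1, h2]
    rw [this, mul_zero]; exact dvd_zero _
  · push Not at hinj
    rw [Finset.prod_mul_distrib, Finset.prod_pow_eq_pow_sum, mul_assoc]
    refine Dvd.dvd.mul_right (pow_dvd_pow q ?_) _
    have h1 : ∀ i, ∑ k ∈ Finset.range K, (if k + 1 ≤ E (ρ i) then 1 else 0) ≤ E (ρ i) := by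
      intro i
      rw [← Finset.card_filter]
      calc _ ≤ (Finset.range (E (ρ i))).card := Finset.card_le_card (by
            intro k hk; simp at hk ⊢; omega)
        _ = _ := by simp
    have h2 : ∀ k ∈ Finset.range K, (Finset.univ.filter (fun i => E (ρ i) < k + 1)).card ≤
        (Finset.univ.filter (fun r => e r < k + 1)).card := by
      intro k hk
      have hk := Finset.mem_range.1 hk
      have : (Finset.univ.filter (fun i => E (ρ i) < k + 1)).card =
        ((Finset.univ.filter (fun i => E (ρ i) < k + 1)).image ρ).card := by
        rw [Finset.card_image_of_injOn]
        intro i hi i' hi' hh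
        by_contra hne
        simp at hi hi'
        cases h : ρ i with
        | none => rw [h] at hi; simp [E] at hi; omega
        | some r => exact hinj i i' hne r h (by rw [← hh, h])
      rw [this]
      rw [← Finset.card_map (s := Finset.univ.filter (fun r => e r < k + 1)) Function.Embedding.some]
      apply Finset.card_le_card
      intro r hr
      simp only [Finset.mem_image, Finset.mem_filter, Finset.mem_univ, true_and] at hr
      obtain ⟨i, hi, rfl⟩ := hr
      cases h : ρ i with
      | none => rw [h] at hi; simp [E] at hi; omega
      | some r => rw [h] at hi; simpa [E] using hi
    have h3 : ∑ i, ∑ k ∈ Finset.range K, (if k + 1 ≤ E (ρ i) then 1 else 0)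
        + ∑ k ∈ Finset.range K, (Finset.univ.filter (fun i => E (ρ i) < k + 1)).card
        = K * Fintype.card ι := by
      rw [Finset.sum_comm, ← Finset.sum_add_distrib]
      rw [← smul_eq_mul, ← Finset.card_range K, ← Finset.sum_const, Finset.card_range]
      refine Finset.sum_congr rfl fun k _ => ?_
      rw [Finset.card_filter, ← Finset.sum_add_distrib, ← Finset.card_univ, Finset.card_eq_sum_ones]
      refine Finset.sum_congr rfl fun i _ => ?_
      split_ifs <;> omega
    have h4 := Finset.sum_le_sum h2
    have h5 := Finset.sum_le_sum (fun i (_ : i ∈ Finset.univ) => h1 i)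
    omega

lemma derivative_finSuccEquiv {R : Type*} [CommRing R] {m : ℕ} (f : MvPolynomial (Fin (m+1)) R) :
    Polynomial.derivative (finSuccEquiv R m f) = finSuccEquiv R m (pderiv 0 f) := by
  induction f using MvPolynomial.induction_on with
  | C a => simp [finSuccEquiv_apply]
  | add p q hp hq => simp [hp, hq]
  | mul_X p i hp =>
    rw [map_mul, Polynomial.derivative_mul, hp, Derivation.leibniz, map_add]
    refine Fin.cases ?_ (fun j => ?_) i
    · simp [finSuccEquiv_X_zero]; ring
    · rw [finSuccEquiv_X_succ, pderiv_X_of_ne (Fin.succ_ne_zero j)]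
      simp [finSuccEquiv_X_succ]; ring

/-- quadratic Taylor formula in the variable `0`. -/
lemma taylor0 {m : ℕ} (f : MvPolynomial (Fin (m+1)) ℤ) (t : Fin m → ℤ) (z w : ℤ) :
    ∃ k : ℤ, eval (Fin.cons (z + w) t : Fin (m+1) → ℤ) f = eval (Fin.cons z t : Fin (m+1) → ℤ) f +
      eval (Fin.cons z t : Fin (m+1) → ℤ) (pderiv 0 f) * w + k * w ^ 2 := by
  obtain ⟨k, hk⟩ := Polynomial.binomExpansion (Polynomial.map (eval t) (finSuccEquiv ℤ m f)) z w
  refine ⟨k, ?_⟩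
  rw [eval_eq_eval_mv_eval', eval_eq_eval_mv_eval', eval_eq_eval_mv_eval', hk,
    Polynomial.derivative_map, derivative_finSuccEquiv]

lemma eval_congr_mod {σ : Type*} (f : MvPolynomial σ ℤ) (q : ℤ) (P P' : σ → ℤ)
    (h : ∀ i, q ∣ P i - P' i) : q ∣ eval P f - eval P' f := by
  induction f using MvPolynomial.induction_on with
  | C a => simp
  | add p r hp hr =>
    simp only [map_add]
    obtain ⟨a, ha⟩ := hp
    obtain ⟨b, hb⟩ := hr
    exact ⟨a + b, by linear_combination ha + hb⟩
  | mul_X p i hp =>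
    simp only [map_mul, eval_X]
    obtain ⟨a, ha⟩ := hp
    obtain ⟨b, hb⟩ := h i
    exact ⟨a * P i + b * eval P' p, by linear_combination P i * ha + eval P' p * hb⟩

lemma exists_psi {m : ℕ} (f : MvPolynomial (Fin (m+1)) ℤ) (q : ℤ) (P0 : Fin (m+1) → ℤ)
    (hu : IsCoprime (eval P0 (pderiv 0 f)) q) (K : ℕ) :
    ∃ Ψ : MvPolynomial (Fin m) ℤ, ∀ P : Fin (m+1) → ℤ, (∀ i, q ∣ P i - P0 i) →
      q ^ K ∣ eval P f → q ^ K ∣ P 0 - eval (fun i => P i.succ - P0 i.succ) Ψ := by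
  obtain ⟨b, b', hb⟩ := hu
  have key : ∀ n, n + 1 ≤ K → ∃ Ψ : MvPolynomial (Fin m) ℤ, ∀ P : Fin (m+1) → ℤ, (∀ i, q ∣ P i - P0 i) →
      q ^ K ∣ eval P f → q ^ (n+1) ∣ P 0 - eval (fun i => P i.succ - P0 i.succ) Ψ := by
    intro n
    induction n with
    | zero =>
      intro _
      exact ⟨C (P0 0), fun P h _ => by simpa using h 0⟩
    | succ n ih =>
      intro hn
      obtain ⟨Ψ, hΨ⟩ := ih (by omega)
      refine ⟨Ψ - C b * aeval (Fin.cons Ψ (fun i => X i + C (P0 i.succ)) : Fin (m+1) → MvPolynomial (Fin m) ℤ) f, ?_⟩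
      intro P hP hf
      obtain ⟨c, hc⟩ := hΨ P hP hf
      set t : Fin m → ℤ := fun i => P i.succ - P0 i.succ with ht
      set ψ := eval t Ψ with hψ
      have hev : eval t (aeval (Fin.cons Ψ (fun i => X i + C (P0 i.succ)) : Fin (m+1) → MvPolynomial (Fin m) ℤ) f)
          = eval (Fin.cons ψ (fun i => P i.succ) : Fin (m+1) → ℤ) f := by
        have : (eval t).comp ((aeval (Fin.cons Ψ (fun i => X i + C (P0 i.succ)) : Fin (m+1) → MvPolynomial (Fin m) ℤ)).toRingHom)
          = eval (Fin.cons ψ (fun i => P i.succ) : Fin (m+1) → ℤ) := by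
          apply MvPolynomial.ringHom_ext
          · intro r; simp
          · intro i
            refine Fin.cases ?_ (fun j => ?_) i
            · simp [hψ]
            · simp [ht]
        exact congrFun (congrArg DFunLike.coe this) f
      have hPc : P = (Fin.cons (P 0) (fun i => P i.succ) : Fin (m+1) → ℤ) := by
        funext i; refine Fin.cases ?_ (fun j => ?_) i <;> simp
      obtain ⟨k, hk⟩ := taylor0 f (fun i => P i.succ) (P 0) (-(q ^ (n+1) * c))
      rw [← hPc] at hk
      have hz : P 0 + -(q ^ (n+1) * c) = ψ := by rw [← hc]; ring
      rw [hz] at hk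
      obtain ⟨a, ha⟩ := eval_congr_mod (pderiv 0 f) q P P0 hP
      obtain ⟨g, hg⟩ := (pow_dvd_pow q hn).trans hf
      simp only [map_sub, map_mul, eval_C, hev, ← hψ]
      rw [hk, hg]
      have e1 : P 0 = ψ + q^(n+1)*c := by rw [← hc]; ring
      have e2 : eval P (pderiv 0 f) = eval P0 (pderiv 0 f) + q * a := by rw [← ha]; ring
      rw [e1, e2]
      refine ⟨b * g + c * b' - b * a * c + b * k * q ^ n * c ^ 2, ?_⟩
      have : q ^ (n+1+1) = q * q^(n+1) := by ring
      have e3 : q ^ (n+1) = q * q ^ n := by ring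
      rw [this]
      linear_combination (-(q ^ (n+1) * c)) * hb + b * k * c^2 * q^(n+1) * e3
  rcases K with _ | K
  · exact ⟨0, fun P _ _ => by simp⟩
  · exact key K le_rfl

/-- the set of exponents of degree `< K`. -/
lemma finite_exps (m K : ℕ) : {s : Fin m →₀ ℕ | s.degree < K}.Finite := by
  refine ((Set.Finite.pi' fun _ : Fin m => Set.finite_lt_nat K).preimage
    (DFunLike.coe_injective (F := Fin m →₀ ℕ)).injOn).subset ?_
  intro s hs i
  exact lt_of_le_of_lt (Finsupp.le_degree i s) hs

/-- Main divisibility statement for points in one nonsingular class. -/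
theorem class_det_dvd {m : ℕ} {ι : Type*} [Fintype ι] [DecidableEq ι]
    (f : MvPolynomial (Fin (m+1)) ℤ) (q : ℤ) (P0 : Fin (m+1) → ℤ)
    (hu : IsCoprime (eval P0 (pderiv 0 f)) q) (K : ℕ) (P : ι → Fin (m+1) → ℤ)
    (hP : ∀ i k, q ∣ P i k - P0 k) (hf : ∀ i, q ^ K ∣ eval (P i) f)
    (F : ι → MvPolynomial (Fin (m+1)) ℤ) (v : ℕ)
    (hv : v + ∑ k ∈ Finset.range K, {s : Fin m →₀ ℕ | s.degree < k + 1}.ncard ≤ K * Fintype.card ι) :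
    q ^ v ∣ (Matrix.of fun i j => eval (P i) (F j)).det := by
  classical
  obtain ⟨Ψ, hΨ⟩ := exists_psi f q P0 hu K
  let G : ι → MvPolynomial (Fin m) ℤ := fun j =>
    aeval (Fin.cons Ψ (fun i => X i + C (P0 i.succ)) : Fin (m+1) → MvPolynomial (Fin m) ℤ) (F j)
  choose lam hlam using hP
  have hG : ∀ i j, q ^ K ∣ eval (P i) (F j) - eval (fun k : Fin m => q * lam i k.succ) (G j) := by
    intro i j
    have h1 := hΨ (P i) (fun k => ⟨_, hlam i k⟩) (hf i)
    have hev : eval (fun k : Fin m => q * lam i k.succ) (G j)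
          = eval (Fin.cons (eval (fun k : Fin m => P i k.succ - P0 k.succ) Ψ) (fun k => P i k.succ) : Fin (m+1) → ℤ) (F j) := by
      have : (eval (fun k : Fin m => q * lam i k.succ)).comp ((aeval (Fin.cons Ψ (fun i => X i + C (P0 i.succ)) : Fin (m+1) → MvPolynomial (Fin m) ℤ)).toRingHom)
          = eval (Fin.cons (eval (fun k : Fin m => P i k.succ - P0 k.succ) Ψ) (fun k => P i k.succ) : Fin (m+1) → ℤ) := by
        apply MvPolynomial.ringHom_ext
        · intro r; simp
        · intro k
          refine Fin.cases ?_ (fun l => ?_) k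
          · simp [hlam]
          · simp [← hlam]
      exact congrFun (congrArg DFunLike.coe this) (F j)
    rw [hev]
    refine eval_congr_mod _ _ _ _ fun k => ?_
    refine Fin.cases ?_ (fun l => ?_) k
    · simpa using h1
    · simp
  choose Z hZ using hG
  have hfin := finite_exps m K
  let I := {s : Fin m →₀ ℕ // s ∈ hfin.toFinset}
  -- expand each G j
  have hexp : ∀ i j, ∃ c : ℤ, eval (fun k : Fin m => q * lam i k.succ) (G j) =
      (∑ r : I, q ^ r.1.degree * (∏ k, lam i k.succ ^ (r.1 k)) * coeff r.1 (G j)) + q ^ K * c := by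
    intro i j
    have hterm : ∀ s : Fin m →₀ ℕ, ∏ k, (q * lam i k.succ) ^ s k = q ^ s.degree * ∏ k, lam i k.succ ^ (s k) := by
      intro s
      simp_rw [mul_pow]
      rw [Finset.prod_mul_distrib, Finset.prod_pow_eq_pow_sum, Finsupp.degree_eq_sum]
    rw [eval_eq']
    simp_rw [hterm]
    rw [← Finset.sum_filter_add_sum_filter_not _ (fun s => s.degree < K)]
    have h1 : ∑ s ∈ (G j).support with s.degree < K, coeff s (G j) * (q ^ s.degree * ∏ k, lam i k.succ ^ (s k))
        = ∑ r : I, q ^ r.1.degree * (∏ k, lam i k.succ ^ (r.1 k)) * coeff r.1 (G j) := by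
      rw [Finset.sum_coe_sort hfin.toFinset (fun r => q ^ r.degree * (∏ k, lam i k.succ ^ (r k)) * coeff r (G j))]
      refine Finset.sum_subset_zero_on_sdiff ?_ ?_ ?_
      · intro s hs; simp at hs ⊢; exact hs.2
      · intro s hs; simp at hs ⊢; right; by_contra hc; exact absurd hs.1 (not_lt.2 (hs.2 hc))
      · intro s hs; ring
    have h2 : q ^ K ∣ ∑ s ∈ (G j).support with ¬ s.degree < K, coeff s (G j) * (q ^ s.degree * ∏ k, lam i k.succ ^ (s k)) := by
      refine Finset.dvd_sum fun s hs => ?_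
      simp at hs
      exact ((pow_dvd_pow q hs.2).mul_right _).mul_left _
    obtain ⟨c, hc⟩ := h2
    exact ⟨c, by rw [h1, hc]⟩
  choose c hc using hexp
  refine det_dvd q K (fun r : I => r.1.degree) (fun i r => ∏ k, lam i k.succ ^ (r.1 k))
    (fun r j => coeff r.1 (G j)) (fun i j => c i j + Z i j) _ ?_ v ?_
  · intro i j
    rw [Matrix.of_apply, mul_add, ← add_assoc, ← hc i j, ← hZ i j]; ring
  · refine le_trans ?_ hv
    gcongr with k hk
    rw [← Set.ncard_coe_finset]
    have hk := Finset.mem_range.1 hk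
    rw [← Set.ncard_image_of_injective _ Subtype.val_injective]
    apply Set.ncard_le_ncard
    · rintro _ ⟨r, hr, rfl⟩
      exact (Finset.mem_filter.1 (Finset.mem_coe.1 hr)).2
    · exact finite_exps m (k+1)
end DG

namespace DG
open MvPolynomial

lemma totalDegree_det_le {σ R ι : Type*} [CommRing R] [Fintype ι] [DecidableEq ι]
    (A : Matrix ι ι (MvPolynomial σ R)) (e : ℕ) (h : ∀ i j, (A i j).totalDegree ≤ e) :
    A.det.totalDegree ≤ Fintype.card ι * e := by
  rw [Matrix.det_apply]
  refine totalDegree_finsetSum_le fun s _ => ?_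
  refine (totalDegree_smul_le _ _).trans ?_
  refine (totalDegree_finsetProd _ _).trans ?_
  refine (Finset.sum_le_card_nsmul _ _ e fun i _ => h _ _).trans ?_
  simp

/-- `f` has total degree `d` and a nonzero `X 0 ^ d` coefficient. -/
def ZL {K : Type*} [CommSemiring K] {k : ℕ} (f : MvPolynomial (Fin (k+1)) K) (d : ℕ) : Prop :=
  f.totalDegree = d ∧ coeff (Finsupp.single 0 d) f ≠ 0

lemma totalDegree_coeff_fse {K : Type*} [CommSemiring K] {k : ℕ} (f : MvPolynomial (Fin (k+1)) K) (i : ℕ) :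
    ((finSuccEquiv K k f).coeff i).totalDegree ≤ f.totalDegree := by
  by_cases h : (finSuccEquiv K k f).coeff i = 0
  · simp [h]
  · have := totalDegree_coeff_finSuccEquiv_add_le f i h
    omega

lemma natDegree_fse_le {K : Type*} [CommSemiring K] {k : ℕ} (f : MvPolynomial (Fin (k+1)) K) :
    (finSuccEquiv K k f).natDegree ≤ f.totalDegree := by
  rw [Polynomial.natDegree_le_iff_coeff_eq_zero]
  intro i hi
  by_contra h
  have := totalDegree_coeff_finSuccEquiv_add_le f i h
  omega

lemma ZL.coeff {K : Type*} [CommSemiring K] {k : ℕ} {f : MvPolynomial (Fin (k+1)) K} {d : ℕ}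
    (h : ZL f d) : (finSuccEquiv K k f).coeff d = C (coeff (Finsupp.single 0 d) f) := by
  have h1 : MvPolynomial.coeff 0 ((finSuccEquiv K k f).coeff d) = MvPolynomial.coeff (Finsupp.single 0 d) f := by
    rw [finSuccEquiv_coeff_coeff]
    congr 1
    ext i; refine Fin.cases ?_ (fun j => ?_) i <;> simp
  have h2 : (finSuccEquiv K k f).coeff d ≠ 0 := by
    intro h0; rw [h0] at h1; exact h.2 (by simpa using h1.symm)
  have h3 := totalDegree_coeff_finSuccEquiv_add_le f d h2
  rw [h.1] at h3
  rw [← h1]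
  exact totalDegree_eq_zero_iff_eq_C.1 (by omega)

lemma ZL.natDegree {K : Type*} [CommSemiring K] {k : ℕ} {f : MvPolynomial (Fin (k+1)) K} {d : ℕ}
    (h : ZL f d) : (finSuccEquiv K k f).natDegree = d := by
  apply le_antisymm ((natDegree_fse_le f).trans h.1.le)
  apply Polynomial.le_natDegree_of_ne_zero
  rw [h.coeff]
  simpa using h.2

lemma ZL.leadingCoeff {K : Type*} [CommSemiring K] {k : ℕ} {f : MvPolynomial (Fin (k+1)) K} {d : ℕ}
    (h : ZL f d) : (finSuccEquiv K k f).leadingCoeff = C (MvPolynomial.coeff (Finsupp.single 0 d) f) := by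
  rw [Polynomial.leadingCoeff, h.natDegree, h.coeff]

lemma ZL.primitive {K : Type*} [Field K] {k : ℕ} {f : MvPolynomial (Fin (k+1)) K} {d : ℕ}
    (h : ZL f d) : (finSuccEquiv K k f).IsPrimitive := by
  intro r hr
  have := (Polynomial.C_dvd_iff_dvd_coeff r _).1 hr d
  rw [h.coeff] at this
  exact isUnit_of_dvd_unit this ((isUnit_iff_ne_zero.2 h.2).map C)

/-- over the fraction field, coprimality -/
lemma res_ne_zero {A : Type*} [CommRing A] [IsDomain A] [NormalizedGCDMonoid A]
    (F G : Polynomial A) (hF : Irreducible F) (hp : F.IsPrimitive) (h : ¬ F ∣ G) :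
    Polynomial.resultant F G ≠ 0 := by
  have inj : Function.Injective (algebraMap A (FractionRing A)) := IsFractionRing.injective _ _
  have h1 : Irreducible (F.map (algebraMap A (FractionRing A))) :=
    (hp.irreducible_iff_irreducible_map_fraction_map).1 hF
  have h2 : ¬ (F.map (algebraMap A (FractionRing A))) ∣ G.map (algebraMap A (FractionRing A)) := by
    intro h3
    exact h ((Polynomial.IsPrimitive.dvd_iff_fraction_map_dvd_fraction_map (FractionRing A) hp).2 h3)
  have h3 : IsCoprime (F.map (algebraMap A (FractionRing A))) (G.map (algebraMap A (FractionRing A))) :=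
    (h1.coprime_iff_not_dvd).2 h2
  have h4 := Polynomial.resultant_ne_zero _ _ h3
  rw [Polynomial.natDegree_map_eq_of_injective inj, Polynomial.natDegree_map_eq_of_injective inj,
    Polynomial.resultant_map_map] at h4
  intro h5; rw [h5] at h4; simp at h4

lemma totalDegree_resultant_le {σ R : Type*} [CommRing R] (F G : Polynomial (MvPolynomial σ R)) (m n e : ℕ)
    (hF : ∀ i, (F.coeff i).totalDegree ≤ e) (hG : ∀ i, (G.coeff i).totalDegree ≤ e) :
    (Polynomial.resultant F G m n).totalDegree ≤ (m + n) * e := by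
  rw [Polynomial.resultant]
  refine (totalDegree_det_le _ e ?_).trans (by rw [Fintype.card_fin])
  intro i j
  rw [Polynomial.sylvester, Matrix.of_apply]
  refine Fin.addCases (fun j => ?_) (fun j => ?_) j
  · rw [Fin.addCases_left]
    split_ifs
    · exact hG _
    · simp
  · rw [Fin.addCases_right]
    split_ifs
    · exact hF _
    · simp

theorem elim {K : Type*} [Field K] {k : ℕ} (f g : MvPolynomial (Fin (k+1)) K) (d : ℕ) (hd : d ≠ 0)
    (hz : ZL f d) (hf : Irreducible f) (hfg : ¬ f ∣ g) :
    ∃ R : MvPolynomial (Fin k) K, R ≠ 0 ∧ R.totalDegree ≤ (d + g.totalDegree)^2 ∧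
      ∀ z : Fin (k+1) → K, eval z f = 0 → eval z g = 0 → eval (Fin.tail z) R = 0 := by
  classical
  let _ : NormalizedGCDMonoid (MvPolynomial (Fin k) K) :=
    Classical.choice (inferInstance : Nonempty (NormalizedGCDMonoid (MvPolynomial (Fin k) K)))
  set F := finSuccEquiv K k f
  set G := finSuccEquiv K k g
  have hF : Irreducible F := (MulEquiv.irreducible_iff (finSuccEquiv K k)).2 hf
  have hFG : ¬ F ∣ G := by
    intro h; exact hfg ((map_dvd_iff (finSuccEquiv K k)).1 h)
  have hR := res_ne_zero F G hF hz.primitive hFG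
  refine ⟨Polynomial.resultant F G, hR, ?_, ?_⟩
  · refine (totalDegree_resultant_le F G _ _ (d + g.totalDegree) ?_ ?_).trans ?_
    · intro i
      exact (totalDegree_coeff_fse f _).trans (by rw [hz.1]; omega)
    · intro i
      exact (totalDegree_coeff_fse g _).trans (by omega)
    · rw [sq]
      gcongr
      · exact hz.natDegree.le
      · exact natDegree_fse_le g
  · intro z h1 h2
    obtain ⟨p, q, -, -, h⟩ := Polynomial.exists_mul_add_mul_eq_C_resultant F G le_rfl le_rfl
      (Or.inl (by rw [hz.natDegree]; exact hd))
    have h3 := congrArg (fun P => Polynomial.eval (z 0) (Polynomial.map (eval (Fin.tail z)) P)) h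
    have e1 : Polynomial.eval (z 0) (Polynomial.map (eval (Fin.tail z)) F) = 0 := by
      rw [← eval_eq_eval_mv_eval', Fin.cons_self_tail, h1]
    have e2 : Polynomial.eval (z 0) (Polynomial.map (eval (Fin.tail z)) G) = 0 := by
      rw [← eval_eq_eval_mv_eval', Fin.cons_self_tail, h2]
    simp only [Polynomial.map_add, Polynomial.map_mul, Polynomial.eval_add, Polynomial.eval_mul, e1, e2,
      Polynomial.map_C, Polynomial.eval_C] at h3
    simpa using h3.symm


/-- cast integer points -/
def qz {k : ℕ} (z : Fin k → ℤ) : Fin k → ℚ := fun i => (z i : ℚ)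

def inBox {k : ℕ} (B : ℕ) (z : Fin k → ℤ) : Prop := ∀ i, |z i| ≤ (B : ℤ)

lemma qz_injective {k : ℕ} : Function.Injective (qz : (Fin k → ℤ) → Fin k → ℚ) := by
  intro a b h; ext i; have := congrFun h i; simpa [qz] using this

lemma qz_tail {k : ℕ} (z : Fin (k+1) → ℤ) : Fin.tail (qz z) = qz (Fin.tail z) := rfl

lemma sz_count {k : ℕ} (R : MvPolynomial (Fin (k+1)) ℚ) (hR : R ≠ 0) (B : ℕ)
    (Z : Finset (Fin (k+1) → ℤ)) (hB : ∀ z ∈ Z, inBox B z) (hZ : ∀ z ∈ Z, eval (qz z) R = 0) :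
    Z.card ≤ R.totalDegree * (2*B+1)^k := by
  classical
  have h := schwartz_zippel_totalDegree hR ((Finset.Icc (-(B:ℤ)) B).map ⟨fun x : ℤ => (x:ℚ), Int.cast_injective⟩)
  have hc : (Finset.Icc (-(B:ℤ)) B).card = 2*B+1 := by simp; omega
  rw [Finset.card_map, hc, div_le_div_iff₀ (by positivity) (by positivity)] at h
  have h1 : Z.card ≤ (Finset.filter (fun f => eval f R = 0)
      (Fintype.piFinset fun _ : Fin (k+1) => (Finset.Icc (-(B:ℤ)) B).map ⟨fun x : ℤ => (x:ℚ), Int.cast_injective⟩)).card := by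
    refine Finset.card_le_card_of_injOn qz ?_ qz_injective.injOn
    intro z hz
    simp only [Finset.coe_filter, Set.mem_ofPred_eq, Fintype.mem_piFinset]
    refine ⟨fun i => ?_, hZ z hz⟩
    rw [Finset.mem_map]
    exact ⟨z i, Finset.mem_Icc.2 (abs_le.1 (hB z hz i)), rfl⟩
  have h2 : (Finset.filter (fun f => eval f R = 0)
      (Fintype.piFinset fun _ : Fin (k+1) => (Finset.Icc (-(B:ℤ)) B).map ⟨fun x : ℤ => (x:ℚ), Int.cast_injective⟩)).card * (2*B+1)
      ≤ R.totalDegree * (2*B+1)^(k+1) := by exact_mod_cast h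
  rw [pow_succ, ← mul_assoc] at h2
  exact h1.trans (Nat.le_of_mul_le_mul_right h2 (by omega))

lemma zfiber {k : ℕ} (f : MvPolynomial (Fin (k+1)) ℚ) (d : ℕ) (hz : ZL f d) (t : Fin k → ℤ)
    (Z : Finset (Fin (k+1) → ℤ)) (ht : ∀ z ∈ Z, Fin.tail z = t) (hZ : ∀ z ∈ Z, eval (qz z) f = 0) :
    Z.card ≤ d := by
  classical
  set P := Polynomial.map (eval (qz t)) (finSuccEquiv ℚ k f) with hP
  have hc : P.coeff d = MvPolynomial.coeff (Finsupp.single 0 d) f := by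
    rw [hP, Polynomial.coeff_map, hz.coeff]; simp
  have hP0 : P ≠ 0 := by
    intro h; rw [h] at hc; exact hz.2 (by simpa using hc.symm)
  have hd : P.natDegree ≤ d := (Polynomial.natDegree_map_le).trans hz.natDegree.le
  refine le_trans ?_ ((Polynomial.card_roots' P).trans hd)
  refine le_trans ?_ (Multiset.toFinset_card_le _)
  refine Finset.card_le_card_of_injOn (fun z => (z 0 : ℚ)) ?_ ?_
  · intro z h
    simp only [Finset.mem_coe, Multiset.mem_toFinset]
    rw [Polynomial.mem_roots hP0, Polynomial.IsRoot, hP, ← ht z h, ← qz_tail]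
    have := eval_eq_eval_mv_eval' (Fin.tail (qz z)) (qz z 0) f
    rw [Fin.cons_self_tail, hZ z h] at this
    exact this.symm
  · intro a ha b hb h
    simp at h
    rw [← Fin.cons_self_tail a, ← Fin.cons_self_tail b, ht a ha, ht b hb, h]

lemma card_le_fiber {α β : Type*} [DecidableEq α] [DecidableEq β] (Z : Finset α) (φ : α → β) (T : Finset β) (n : ℕ)
    (hT : ∀ z ∈ Z, φ z ∈ T) (h : ∀ t ∈ T, (Z.filter fun z => φ z = t).card ≤ n) : Z.card ≤ n * T.card :=
  Finset.card_le_mul_card_image_of_maps_to hT n h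

theorem elim_count {k : ℕ} (f g : MvPolynomial (Fin (k+2)) ℚ) (d : ℕ) (hd : d ≠ 0)
    (hz : ZL f d) (hf : Irreducible f) (hfg : ¬ f ∣ g) (B : ℕ) (Z : Finset (Fin (k+2) → ℤ))
    (hB : ∀ z ∈ Z, inBox B z) (hZ : ∀ z ∈ Z, eval (qz z) f = 0 ∧ eval (qz z) g = 0) :
    Z.card ≤ d * ((d + g.totalDegree)^2 * (2*B+1)^k) := by
  classical
  obtain ⟨R, hR, hdeg, h⟩ := elim f g d hd hz hf hfg
  refine (card_le_fiber Z (Fin.tail : (Fin (k+2) → ℤ) → Fin (k+1) → ℤ) (Z.image Fin.tail) d (fun z hz => Finset.mem_image_of_mem _ hz) ?_).trans ?_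
  · intro t _
    refine zfiber f d hz t _ (fun z h => (Finset.mem_filter.1 h).2) (fun z h => (hZ z (Finset.mem_filter.1 h).1).1)
  · gcongr
    have h3 : ∀ t ∈ Z.image (Fin.tail : (Fin (k+2) → ℤ) → Fin (k+1) → ℤ), inBox B t := by
      intro t ht
      obtain ⟨z, hz, rfl⟩ := Finset.mem_image.1 ht
      exact fun i => hB z hz i.succ
    have h4 : ∀ t ∈ Z.image (Fin.tail : (Fin (k+2) → ℤ) → Fin (k+1) → ℤ), eval (qz t) R = 0 := by
      intro t ht
      obtain ⟨z, hz, rfl⟩ := Finset.mem_image.1 ht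
      rw [← qz_tail]
      exact h (qz z) (hZ z hz).1 (hZ z hz).2
    exact (sz_count R hR B _ h3 h4).trans (Nat.mul_le_mul_right _ hdeg)

/-- trivial count -/
theorem triv_count {k : ℕ} (f : MvPolynomial (Fin (k+1)) ℚ) (d : ℕ)
    (hz : ZL f d) (B : ℕ) (Z : Finset (Fin (k+1) → ℤ))
    (hB : ∀ z ∈ Z, inBox B z) (hZ : ∀ z ∈ Z, eval (qz z) f = 0) :
    Z.card ≤ d * (2*B+1)^k := by
  have := sz_count f (by rintro rfl; exact hz.2 (by simp)) B Z hB hZ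
  rwa [hz.1] at this
end DG

namespace DG
open MvPolynomial

section
attribute [local instance] Matrix.seminormedAddCommGroup

lemma siegel_rows {ι A : Type*} [Fintype A] (S : Finset ι) (a : ι → A → ℤ) (M : ℕ) (hM : 1 ≤ M)
    (ha : ∀ i ∈ S, ∀ j, |a i j| ≤ (M : ℤ)) (c : A → ℚ) (hc : c ≠ 0)
    (h : ∀ i ∈ S, ∑ j, c j * (a i j : ℚ) = 0) :
    ∃ t : A → ℤ, t ≠ 0 ∧ (∀ i ∈ S, ∑ j, t j * a i j = 0) ∧
      ∀ j, |t j| ≤ (((Fintype.card A * M)^(Fintype.card A) : ℕ) : ℤ) := by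
  classical
  have hA : 0 < Fintype.card A := by
    rw [Fintype.card_pos_iff]
    obtain ⟨j, -⟩ := Function.ne_iff.1 hc
    exact ⟨j⟩
  let v : ι → A → ℚ := fun i j => (a i j : ℚ)
  obtain ⟨b, hb, hspan, hind⟩ := exists_linearIndependent ℚ (v '' (S : Set ι))
  have hfin : b.Finite := (S.finite_toSet.image v).subset hb
  have _ : Fintype b := hfin.fintype
  let φ : (A → ℚ) →ₗ[ℚ] ℚ := ∑ j, c j • LinearMap.proj j
  have hφ : ∀ w, φ w = ∑ j, c j * w j := by
    intro w; simp [φ, LinearMap.sum_apply]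
  have hker : Submodule.span ℚ b ≠ ⊤ := by
    intro htop
    have h1 : (⊤ : Submodule ℚ (A → ℚ)) ≤ LinearMap.ker φ := by
      rw [← htop, hspan, Submodule.span_le]
      rintro _ ⟨i, hi, rfl⟩
      simp only [SetLike.mem_coe, LinearMap.mem_ker, hφ]
      exact h i hi
    apply hc
    ext j
    have := h1 (Submodule.mem_top (x := Pi.single j 1))
    rw [LinearMap.mem_ker, hφ] at this
    simpa [Pi.single_apply] using this
  have hcard : Fintype.card b < Fintype.card A := by
    have h1 := Submodule.finrank_lt hker
    rw [finrank_span_set_eq_card hind, Module.finrank_fintype_fun_eq_card, Set.toFinset_card] at h1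
    exact h1
  have hrow : ∀ w : b, ∃ i ∈ S, v i = w.1 := fun w => by
    obtain ⟨i, hi, h⟩ := hb w.2
    exact ⟨i, hi, h⟩
  choose r hrS hr using hrow
  have hn1 : (1:ℝ) ≤ (Fintype.card A * M : ℕ) := by exact_mod_cast Nat.mul_pos hA hM
  have key : ∃ t : A → ℤ, t ≠ 0 ∧ (∀ w : b, ∑ j, t j * a (r w) j = 0) ∧
      ∀ j, |t j| ≤ (((Fintype.card A * M)^(Fintype.card A) : ℕ) : ℤ) := by
    by_cases hb0 : Fintype.card b = 0
    · obtain ⟨j, -⟩ := Function.ne_iff.1 hc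
      refine ⟨fun _ => 1, fun h => by simpa using congrFun h j, fun w => ?_, fun j => ?_⟩
      · exact ((Fintype.card_eq_zero_iff.1 hb0).false w).elim
      · simp only [abs_one]
        exact_mod_cast Nat.one_le_pow _ _ (Nat.mul_pos hA hM)
    · let Mx : Matrix b A ℤ := Matrix.of fun w j => a (r w) j
      obtain ⟨t, ht0, ht, hn⟩ := Int.Matrix.exists_ne_zero_int_vec_norm_le Mx hcard (Nat.pos_of_ne_zero hb0)
      refine ⟨t, ht0, fun w => ?_, fun j => ?_⟩
      · have := congrFun ht w
        simp only [Matrix.mulVec, dotProduct, Mx, Matrix.of_apply, Pi.zero_apply] at this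
        rw [← this]; exact Finset.sum_congr rfl fun j _ => mul_comm _ _
      · have h1 : ‖t j‖ ≤ ((Fintype.card A * M : ℕ) : ℝ) ^ (Fintype.card A) := by
          refine (norm_le_pi_norm t j).trans (hn.trans ?_)
          have hMx : max 1 ‖Mx‖ ≤ (M:ℝ) := by
            refine max_le (by exact_mod_cast hM) ?_
            rw [Matrix.norm_le_iff (by positivity)]
            intro w j
            rw [Int.norm_eq_abs]
            exact_mod_cast ha _ (hrS w) j
          have hlt : (Fintype.card b : ℝ) + 1 ≤ Fintype.card A := by exact_mod_cast hcard
          calc _ ≤ ((Fintype.card A * M : ℕ) : ℝ) ^ ((Fintype.card b : ℝ) / (Fintype.card A - Fintype.card b)) := by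
                apply Real.rpow_le_rpow (by positivity)
                · push_cast; gcongr
                · apply div_nonneg (by positivity); linarith
            _ ≤ ((Fintype.card A * M : ℕ) : ℝ) ^ (Fintype.card A : ℝ) := by
                apply Real.rpow_le_rpow_of_exponent_le hn1
                have : (Fintype.card b : ℝ) / (Fintype.card A - Fintype.card b) ≤ Fintype.card b :=
                  div_le_self (by positivity) (by linarith)
                linarith
            _ = _ := Real.rpow_natCast _ _
        rw [Int.norm_eq_abs] at h1
        exact_mod_cast h1
  obtain ⟨t, ht0, ht, hn⟩ := key
  refine ⟨t, ht0, fun i hi => ?_, hn⟩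
  let ψ : (A → ℚ) →ₗ[ℚ] ℚ := ∑ j, (t j : ℚ) • LinearMap.proj j
  have hψ : ∀ w, ψ w = ∑ j, (t j : ℚ) * w j := by
    intro w; simp [ψ, LinearMap.sum_apply]
  have h1 : Submodule.span ℚ (v '' (S : Set ι)) ≤ LinearMap.ker ψ := by
    rw [← hspan, Submodule.span_le]
    intro w hw
    simp only [SetLike.mem_coe, LinearMap.mem_ker, hψ]
    have := ht ⟨w, hw⟩
    have h3 := hr ⟨w, hw⟩
    simp only at h3
    rw [← h3]
    simp only [v]
    exact_mod_cast this
  have h2 := h1 (Submodule.subset_span ⟨i, hi, rfl⟩)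
  rw [LinearMap.mem_ker, hψ] at h2
  simp only [v] at h2
  exact_mod_cast h2
end

/-- Heath-Brown's trick: replace `f` by an integral polynomial of small height. -/
theorem hb {k : ℕ} (S : Finset (Fin k → ℤ)) (A : Finset (Fin k →₀ ℕ)) (M : ℕ) (hM : 1 ≤ M)
    (hS : ∀ z ∈ S, ∀ s ∈ A, |∏ i, z i ^ s i| ≤ (M : ℤ))
    (f : MvPolynomial (Fin k) ℚ) (hf : f ≠ 0) (hA : f.support ⊆ A) (h : ∀ z ∈ S, eval (qz z) f = 0) :
    ∃ g : MvPolynomial (Fin k) ℤ, g ≠ 0 ∧ g.support ⊆ A ∧ (∀ z ∈ S, eval z g = 0) ∧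
      ∀ s, |coeff s g| ≤ (((A.card * M)^A.card : ℕ) : ℤ) := by
  classical
  obtain ⟨t, ht0, ht, hn⟩ := siegel_rows (A := A) S (fun z s => ∏ i, z i ^ s.1 i) M hM
    (fun z hz s => hS z hz s.1 s.2) (fun s => coeff s.1 f) (by
      intro h0
      apply hf
      ext s
      by_cases hs : s ∈ A
      · exact congrFun h0 ⟨s, hs⟩
      · exact notMem_support_iff.1 fun h' => hs (hA h'))
    (fun z hz => by
      have := h z hz
      rw [eval_eq', Finset.sum_subset hA] at this
      · rw [← this, ← Finset.sum_coe_sort A]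
        simp [qz]
      · intro s _ hs
        simp at hs; simp [hs])
  let g : MvPolynomial (Fin k) ℤ := ∑ s : A, monomial s.1 (t s)
  have hg : ∀ s, coeff s g = if hs : s ∈ A then t ⟨s, hs⟩ else 0 := by
    intro s
    simp only [g, coeff_sum, coeff_monomial]
    split_ifs with hs
    · rw [Finset.sum_eq_single ⟨s, hs⟩] <;> simp
      rintro a b hab rfl; simp at hab
    · refine Finset.sum_eq_zero fun a _ => ?_
      rw [if_neg]
      rintro rfl; exact hs a.2
  refine ⟨g, ?_, ?_, ?_, ?_⟩
  · intro h0
    apply ht0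
    ext s
    have := hg s.1
    rw [h0] at this
    simpa using this.symm
  · intro s hs
    by_contra hs'
    rw [mem_support_iff, hg, dif_neg hs'] at hs
    exact hs rfl
  · intro z hz
    rw [← ht z hz]
    simp [g, eval_monomial, Finsupp.prod_fintype]
  · intro s
    rw [hg]
    split_ifs with hs
    · simpa using hn ⟨s, hs⟩
    · simp only [abs_zero]; positivity

lemma card_deg_le (k D : ℕ) : ∃ A : Finset (Fin k →₀ ℕ), A.card ≤ (D+1)^k ∧
    ∀ s, s ∈ A ↔ s.degree ≤ D := by
  classical
  have hfin : {s : Fin k →₀ ℕ | s.degree ≤ D}.Finite := by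
    apply Set.Finite.subset (Finset.finite_toSet (Finset.image (fun t : Fin k → ℕ => Finsupp.equivFunOnFinite.symm t)
      (Fintype.piFinset fun _ => Finset.range (D+1))))
    intro s hs
    simp only [Finset.coe_image, Set.mem_image]
    refine ⟨s, ?_, by ext; simp⟩
    simp only [Finset.mem_coe, Fintype.mem_piFinset, Finset.mem_range]
    intro i
    have := Finsupp.le_degree i s
    have h2 : s.degree ≤ D := hs
    omega
  refine ⟨hfin.toFinset, ?_, by simp⟩
  calc _ ≤ (Fintype.piFinset fun _ : Fin k => Finset.range (D+1)).card := by
        refine Finset.card_le_card_of_injOn (fun s => (s : Fin k → ℕ)) ?_ ?_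
        · intro s hs
          simp only [Finset.mem_coe, Fintype.mem_piFinset, Finset.mem_range]
          intro i
          have := Finsupp.le_degree i s
          have h2 : s.degree ≤ D := by simpa using hs
          omega
        · intro a _ b _ h; exact DFunLike.coe_injective h
    _ = _ := by simp

lemma monomial_le {k : ℕ} (z : Fin k → ℤ) (B D : ℕ) (hB : 1 ≤ B) (hz : inBox B z) (s : Fin k →₀ ℕ) (hs : s.degree ≤ D) :
    |∏ i, z i ^ s i| ≤ ((B^D : ℕ) : ℤ) := by
  rw [Finset.abs_prod]
  calc _ ≤ ∏ i, (B:ℤ)^(s i) := by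
        refine Finset.prod_le_prod (fun _ _ => abs_nonneg _) fun i _ => ?_
        rw [abs_pow]; exact pow_le_pow_left₀ (abs_nonneg _) (hz i) _
    _ = (B:ℤ)^(s.degree) := by rw [Finset.prod_pow_eq_pow_sum, Finsupp.degree_eq_sum]
    _ ≤ (B:ℤ)^D := pow_le_pow_right₀ (by exact_mod_cast hB) hs
    _ = _ := by push_cast; rfl

lemma totalDegree_le_iff_degree {k : ℕ} {R : Type*} [CommSemiring R] (f : MvPolynomial (Fin k) R) (D : ℕ) :
    f.totalDegree ≤ D ↔ ∀ s ∈ f.support, s.degree ≤ D := by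
  rw [totalDegree, Finset.sup_le_iff]
  rfl

lemma eval_abs_le {k : ℕ} (f : MvPolynomial (Fin k) ℤ) (z : Fin k → ℤ) (B D c : ℕ) (hB : 1 ≤ B) (hz : inBox B z)
    (hD : f.totalDegree ≤ D) (hc : ∀ s, |coeff s f| ≤ (c:ℤ)) : |eval z f| ≤ (((D+1)^k * c * B^D : ℕ) : ℤ) := by
  obtain ⟨A, hA, hmem⟩ := card_deg_le k D
  have hsub : f.support ⊆ A := fun s hs => (hmem s).2 ((totalDegree_le_iff_degree f D).1 hD s hs)
  rw [eval_eq']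
  refine (Finset.abs_sum_le_sum_abs _ _).trans ?_
  calc _ ≤ ∑ s ∈ f.support, ((c * B^D : ℕ) : ℤ) := by
        refine Finset.sum_le_sum fun s hs => ?_
        rw [abs_mul]; push_cast
        have := monomial_le z B D hB hz s ((hmem s).1 (hsub hs))
        push_cast at this
        exact mul_le_mul (hc s) this (abs_nonneg _) (by positivity)
    _ ≤ _ := by
        rw [Finset.sum_const, nsmul_eq_mul]
        push_cast
        have : (f.support.card : ℤ) ≤ (D+1)^k := by exact_mod_cast (Finset.card_le_card hsub).trans hA
        rw [mul_assoc ((D+1:ℤ)^k)]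
        gcongr

theorem hb_deg {k : ℕ} (S : Finset (Fin k → ℤ)) (B D : ℕ) (hB : 1 ≤ B) (hS : ∀ z ∈ S, inBox B z)
    (f : MvPolynomial (Fin k) ℚ) (hf : f ≠ 0) (hD : f.totalDegree ≤ D) (h : ∀ z ∈ S, eval (qz z) f = 0) :
    ∃ g : MvPolynomial (Fin k) ℤ, g ≠ 0 ∧ g.totalDegree ≤ D ∧ (∀ z ∈ S, eval z g = 0) ∧
      ∀ s, |coeff s g| ≤ ((((D+1)^k * B^D)^((D+1)^k) : ℕ) : ℤ) := by
  obtain ⟨A, hA, hmem⟩ := card_deg_le k D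
  have hsub : f.support ⊆ A := fun s hs => (hmem s).2 ((totalDegree_le_iff_degree f D).1 hD s hs)
  obtain ⟨g, h1, h2, h3, h4⟩ := hb S A (B^D) (Nat.one_le_pow _ _ hB)
    (fun z hz s hs => monomial_le z B D hB (hS z hz) s ((hmem s).1 hs)) f hf hsub h
  refine ⟨g, h1, (totalDegree_le_iff_degree g D).2 fun s hs => (hmem s).1 (h2 hs), h3, fun s => (h4 s).trans ?_⟩
  exact_mod_cast (Nat.pow_le_pow_left (Nat.mul_le_mul_right _ hA) _).trans
    (Nat.pow_le_pow_right (Nat.mul_pos (by positivity) (Nat.one_le_pow _ _ hB)) hA)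
end DG

namespace DG

theorem primes_exist : ∃ Y1 : ℕ, ∀ Y : ℕ, Y1 ≤ Y → ∀ k : ℕ, k^2 ≤ Y →
    ∃ P : Finset ℕ, P.card = k ∧ ∀ p ∈ P, p.Prime ∧ Y < p ∧ p ≤ 8 * Y := by
  have h := (isLittleO_log_rpow_atTop (r := 1/2) (by norm_num)).bound (c := 1/40) (by norm_num)
  obtain ⟨X, hX⟩ := Filter.eventually_atTop.1 h
  have hlog : ∀ x : ℝ, max X 1 ≤ x → Real.log x ≤ √x / 40 := by
    intro x hx
    have h1 := hX x (le_of_max_le_left hx)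
    have h0 : 1 ≤ x := le_of_max_le_right hx
    rw [Real.norm_of_nonneg (Real.log_nonneg h0), Real.norm_of_nonneg (by positivity), ← Real.sqrt_eq_rpow] at h1
    linarith
  refine ⟨⌈max X 1⌉₊, fun Y hY k hk => ?_⟩
  have hY1 : max X 1 ≤ (Y : ℝ) := Nat.ceil_le.1 hY
  have hY2 : (1:ℝ) ≤ Y := le_of_max_le_right hY1
  have hn := Chebyshev.theta_ge (8 * Y)
  have hu := Chebyshev.theta_le_log4_mul_x (x := (Y:ℝ)) (by positivity)
  have l4 : Real.log 4 = 2 * Real.log 2 := by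
    rw [show (4:ℝ) = 2^2 by norm_num, Real.log_pow]; norm_num
  have l2 := Real.log_two_gt_d9
  push_cast at hn
  have e1 := hlog (8 * Y) (by linarith)
  have e2 := hlog (8 * Y + 1) (by linarith)
  have s1 : √(8*(Y:ℝ)+1) ≤ 8 * Y + 1 := by
    rw [Real.sqrt_le_left (by positivity)]; nlinarith
  have s2 : √(8*(Y:ℝ)) * √(8*(Y:ℝ)) = 8 * Y := Real.mul_self_sqrt (by positivity)
  have hd : (Y:ℝ) ≤ Chebyshev.theta (8 * Y) - Chebyshev.theta Y := by
    have : 2 * √(8*(Y:ℝ)) * Real.log (8*Y) ≤ 2 * √(8*(Y:ℝ)) * (√(8*(Y:ℝ))/40) := by gcongr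
    rw [l4] at hu
    nlinarith
  set T := (Finset.Ioc Y (8*Y)).filter Nat.Prime with hT
  have hsum : Chebyshev.theta (8 * Y) - Chebyshev.theta Y = ∑ p ∈ T, Real.log p := by
    have h8 : Chebyshev.theta (8 * Y) = ∑ p ∈ (Finset.Icc 0 (8*Y)).filter Nat.Prime, Real.log p := by
      have := Chebyshev.theta_eq_sum_Icc ((8 * Y : ℕ) : ℝ)
      rw [Nat.floor_natCast] at this
      exact_mod_cast this
    have h1 : Chebyshev.theta Y = ∑ p ∈ (Finset.Icc 0 Y).filter Nat.Prime, Real.log p := by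
      have := Chebyshev.theta_eq_sum_Icc (Y : ℝ)
      rwa [Nat.floor_natCast] at this
    rw [h8, h1, sub_eq_iff_eq_add, ← Finset.sum_union]
    · congr 1
      ext p
      simp only [hT, Finset.mem_union, Finset.mem_filter, Finset.mem_Icc, Finset.mem_Ioc]
      by_cases hp : p.Prime <;> simp [hp]; omega
    · rw [Finset.disjoint_left]; intro p
      simp only [hT, Finset.mem_filter, Finset.mem_Icc, Finset.mem_Ioc]
      omega
  have hle : ∑ p ∈ T, Real.log p ≤ T.card * Real.log (8 * Y) := by
    rw [← nsmul_eq_mul]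
    refine Finset.sum_le_card_nsmul _ _ _ fun p hp => ?_
    simp only [hT, Finset.mem_filter, Finset.mem_Ioc] at hp
    apply Real.log_le_log
    · exact_mod_cast hp.2.pos
    · exact_mod_cast hp.1.2
  have hk' : k ≤ T.card := by
    by_contra hc
    push Not at hc
    have h1 : (T.card : ℝ) ≤ k := by exact_mod_cast hc.le
    have h2 : (k:ℝ)^2 ≤ Y := by exact_mod_cast hk
    have h3 : (Y:ℝ) ≤ k * (√(8*(Y:ℝ))/40) := by
      calc (Y:ℝ) ≤ T.card * Real.log (8 * Y) := by linarith
        _ ≤ k * (√(8*(Y:ℝ))/40) := by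
          have := Real.log_nonneg (show (1:ℝ) ≤ 8 * Y by linarith)
          gcongr
    have h4 : (Y:ℝ)^2 ≤ (k * (√(8*(Y:ℝ))/40))^2 := by gcongr
    have h5 : (k * (√(8*(Y:ℝ))/40))^2 = k^2 * (8 * Y) / 1600 := by
      rw [mul_pow, div_pow, Real.sq_sqrt (by positivity)]; ring
    nlinarith
  obtain ⟨P, hP, hc⟩ := Finset.exists_subset_card_eq hk'
  refine ⟨P, hc, fun p hp => ?_⟩
  have := hP hp
  simp only [hT, Finset.mem_filter, Finset.mem_Ioc] at this
  exact ⟨this.2, this.1.1, this.1.2⟩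
end DG

namespace DG
open MvPolynomial

lemma exists_of_det_zero {ι J : Type*} [Fintype J] [DecidableEq J] (Z : Finset ι) (a : ι → J → ℚ)
    (h : ∀ P : J → ι, (∀ i, P i ∈ Z) → (Matrix.of fun i j => a (P i) j).det = 0) :
    ∃ c : J → ℚ, c ≠ 0 ∧ ∀ i ∈ Z, ∑ j, c j * a i j = 0 := by
  classical
  by_cases htop : Submodule.span ℚ (a '' (Z : Set ι)) = ⊤
  · exfalso
    obtain ⟨b, hb, hspan, hind⟩ := exists_linearIndependent ℚ (a '' (Z : Set ι))
    have hfin : b.Finite := (Z.finite_toSet.image a).subset hb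
    have _ : Fintype b := hfin.fintype
    have hcard : Fintype.card J = Fintype.card b := by
      have h1 := finrank_span_set_eq_card hind
      rw [hspan, htop, finrank_top, Module.finrank_fintype_fun_eq_card, Set.toFinset_card] at h1
      exact h1
    obtain e := Fintype.equivOfCardEq hcard
    have hrow : ∀ w : b, ∃ i ∈ Z, a i = w.1 := fun w => by
      obtain ⟨i, hi, h⟩ := hb w.2
      exact ⟨i, hi, h⟩
    choose r hrS hr using hrow
    have h1 := h (fun j => r (e j)) (fun j => hrS _)
    have h2 : LinearIndependent ℚ (fun j => a (r (e j))) := by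
      have : (fun j => a (r (e j))) = (Subtype.val : b → _) ∘ e := by
        ext1 j; exact hr (e j)
      rw [this]
      exact hind.comp _ e.injective
    have h3 := (Matrix.linearIndependent_rows_iff_isUnit (A := Matrix.of fun i j => a (r (e i)) j)).1 h2
    rw [Matrix.isUnit_iff_isUnit_det, h1] at h3
    simp at h3
  · obtain ⟨φ, hφ0, hφ⟩ := Submodule.exists_le_ker_of_lt_top _ (lt_top_iff_ne_top.2 htop)
    refine ⟨fun j => φ (Pi.single j 1), ?_, ?_⟩
    · intro h0
      apply hφ0
      apply LinearMap.pi_ext'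
      intro j; ext; simpa using congrFun h0 j
    · intro i hi
      have h1 : φ (a i) = 0 := hφ (Submodule.subset_span ⟨i, hi, rfl⟩)
      rw [LinearMap.pi_apply_eq_sum_univ φ (a i)] at h1
      rw [← h1]
      refine Finset.sum_congr rfl fun j _ => ?_
      rw [smul_eq_mul, mul_comm]
      congr 1
      show φ _ = φ _
      congr 1
      funext k; simp [Pi.single_apply, eq_comm]

lemma det_abs_le {J : Type*} [Fintype J] [DecidableEq J] (A : Matrix J J ℤ) (b : J → ℕ)
    (h : ∀ i j, |A i j| ≤ (b j : ℤ)) : |A.det| ≤ (((Fintype.card J).factorial * ∏ j, b j : ℕ) : ℤ) := by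
  rw [Matrix.det_apply]
  refine (Finset.abs_sum_le_sum_abs _ _).trans ?_
  calc _ ≤ ∑ σ : Equiv.Perm J, ((∏ j, b j : ℕ) : ℤ) := by
        refine Finset.sum_le_sum fun σ _ => ?_
        have : |Equiv.Perm.sign σ • ∏ i, A (σ i) i| = |∏ i, A (σ i) i| := by
          rcases Int.units_eq_one_or (Equiv.Perm.sign σ) with h | h <;> simp [h]
        rw [this, Finset.abs_prod]
        push_cast
        exact Finset.prod_le_prod (fun _ _ => abs_nonneg _) fun i _ => h _ _
    _ = _ := by
        rw [Finset.sum_const, Finset.card_univ, Fintype.card_perm, nsmul_eq_mul]; push_cast; rfl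

/-- polynomial with prescribed coefficients on `J` -/
lemma poly_of_coeffs {k : ℕ} (J : Finset (Fin k →₀ ℕ)) (c : J → ℚ) (hc : c ≠ 0) :
    ∃ g : MvPolynomial (Fin k) ℚ, g ≠ 0 ∧ g.support ⊆ J ∧
      ∀ z, eval z g = ∑ s : J, c s * ∏ i, z i ^ s.1 i := by
  classical
  let g : MvPolynomial (Fin k) ℚ := ∑ s : J, monomial s.1 (c s)
  have hg : ∀ s, coeff s g = if hs : s ∈ J then c ⟨s, hs⟩ else 0 := by
    intro s
    simp only [g, coeff_sum, coeff_monomial]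
    split_ifs with hs
    · rw [Finset.sum_eq_single ⟨s, hs⟩] <;> simp
      rintro a b hab rfl; simp at hab
    · refine Finset.sum_eq_zero fun a _ => ?_
      rw [if_neg]
      rintro rfl; exact hs a.2
  refine ⟨g, ?_, ?_, ?_⟩
  · intro h0
    apply hc
    ext s
    have := hg s.1
    rw [h0] at this
    simpa using this.symm
  · intro s hs
    by_contra hs'
    rw [mem_support_iff, hg, dif_neg hs'] at hs
    exact hs rfl
  · intro z
    simp [g, eval_monomial, Finsupp.prod_fintype]

theorem aux_poly {m : ℕ} (f : MvPolynomial (Fin (m+1)) ℤ) (q B : ℕ) (hB1 : 1 ≤ B) (P0 : Fin (m+1) → ℤ)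
    (hu : IsCoprime (eval P0 (pderiv 0 f)) (q:ℤ)) (K : ℕ) (Z : Finset (Fin (m+1) → ℤ))
    (hB : ∀ z ∈ Z, inBox B z) (hP : ∀ z ∈ Z, ∀ k, (q:ℤ) ∣ z k - P0 k) (hf : ∀ z ∈ Z, eval z f = 0)
    (J : Finset (Fin (m+1) →₀ ℕ)) (v : ℕ)
    (hv : v + ∑ k ∈ Finset.range K, {s : Fin m →₀ ℕ | s.degree < k+1}.ncard ≤ K * J.card)
    (hsize : J.card.factorial * B^(∑ s ∈ J, s.degree) < q^v) :
    ∃ g : MvPolynomial (Fin (m+1)) ℚ, g ≠ 0 ∧ g.support ⊆ J ∧ ∀ z ∈ Z, eval (qz z) g = 0 := by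
  classical
  obtain ⟨c, hc0, hc⟩ := exists_of_det_zero (J := J) Z (fun z s => ∏ i, (qz z i) ^ s.1 i) (by
    intro P hPZ
    have h1 := class_det_dvd f q P0 hu K P (fun i k => hP _ (hPZ i) k)
      (fun i => by rw [hf _ (hPZ i)]; exact dvd_zero _) (fun s : J => monomial s.1 (1:ℤ)) v (by simpa using hv)
    have e1 : (Matrix.of fun i j => eval (P i) (monomial (j : J).1 (1:ℤ))) =
        Matrix.of fun i (j : J) => ∏ k, P i k ^ j.1 k := by
      ext i j; simp [eval_monomial, Finsupp.prod_fintype]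
    rw [e1] at h1
    have h2 := det_abs_le (Matrix.of fun i (j : J) => ∏ k, P i k ^ j.1 k) (fun j => B^(j.1.degree))
      (fun i j => monomial_le (P i) B _ hB1 (hB _ (hPZ i)) j.1 le_rfl)
    have h3 : ∏ j : J, B^(j.1.degree) = B^(∑ s ∈ J, s.degree) := by
      rw [Finset.prod_pow_eq_pow_sum, Finset.sum_coe_sort J (fun s => s.degree)]
    rw [h3, Fintype.card_coe] at h2
    have h4 : (Matrix.of fun i (j : J) => ∏ k, P i k ^ j.1 k).det = 0 := by
      by_contra hne
      have := Int.le_of_dvd (abs_pos.2 hne) ((dvd_abs _ _).2 h1)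
      have h5 : ((q^v : ℕ) : ℤ) ≤ ((J.card.factorial * B^(∑ s ∈ J, s.degree) : ℕ) : ℤ) := by
        push_cast at h2 ⊢; exact this.trans h2
      have h6 : q^v ≤ J.card.factorial * B^(∑ s ∈ J, s.degree) := by exact_mod_cast h5
      omega
    have h5 := congrArg (Int.castRingHom ℚ) h4
    rw [RingHom.map_det, map_zero] at h5
    rw [← h5]
    congr 1
    ext i j; simp [qz])
  obtain ⟨g, h1, h2, h3⟩ := poly_of_coeffs J c hc0
  exact ⟨g, h1, h2, fun z hz => by rw [h3]; exact hc z hz⟩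

lemma ncard_exps1 (k : ℕ) : {s : Fin 1 →₀ ℕ | s.degree < k+1}.ncard = k+1 := by
  have : {s : Fin 1 →₀ ℕ | s.degree < k+1} = (fun i => Finsupp.single 0 i) '' (Finset.range (k+1) : Set ℕ) := by
    ext s
    simp only [Set.mem_ofPred_eq, Finset.coe_range, Set.mem_image, Set.mem_Iio]
    constructor
    · intro h
      refine ⟨s 0, ?_, ?_⟩
      · rw [Finsupp.degree_eq_sum] at h; simpa using h
      · ext; simp
    · rintro ⟨i, hi, rfl⟩; simpa using hi
  rw [this, Set.ncard_image_of_injective _ (Finsupp.single_injective 0), Set.ncard_coe_finset]; simp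

lemma ncard_exps2 (k : ℕ) : 2 * {s : Fin 2 →₀ ℕ | s.degree < k+1}.ncard = (k+1)*(k+2) := by
  have := finrank_rtd ℚ k
  unfold restrictTotalDegree at this
  rw [Module.finrank_eq_nat_card_basis (basisRestrictSupport ℚ {s : Fin 2 →₀ ℕ | (s.sum fun _ e => e) ≤ k})] at this
  rw [← this]
  congr 1
  rw [← Nat.card_coe_set_eq]
  congr 2
  ext s; simp only [Set.mem_ofPred_eq, Nat.lt_succ_iff]; rfl
end DG

namespace DG
open MvPolynomial

/-- base change from ℤ to ℚ -/
noncomputable def toQ {k : ℕ} (f : MvPolynomial (Fin k) ℤ) : MvPolynomial (Fin k) ℚ :=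
  map (Int.castRingHom ℚ) f

lemma eval_toQ {k : ℕ} (f : MvPolynomial (Fin k) ℤ) (z : Fin k → ℤ) : eval (qz z) (toQ f) = (eval z f : ℚ) := by
  rw [toQ, eval_map]
  simp [eval₂_eq', eval_eq', qz]

lemma toQ_injective {k : ℕ} : Function.Injective (toQ : MvPolynomial (Fin k) ℤ → _) :=
  map_injective _ Int.cast_injective

lemma totalDegree_toQ {k : ℕ} (f : MvPolynomial (Fin k) ℤ) : (toQ f).totalDegree = f.totalDegree := by
  unfold toQ totalDegree
  rw [support_map_of_injective _ (by exact Int.cast_injective)]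

/-- `g` has small degree in the variable `0`, so it is not a multiple of `f`. -/
lemma not_dvd_of_deg {K : Type*} [Field K] {k : ℕ} (f g : MvPolynomial (Fin (k+1)) K) (d : ℕ) (hz : ZL f d)
    (hg : g ≠ 0) (h : ∀ s ∈ g.support, s 0 < d) : ¬ f ∣ g := by
  intro hfg
  have h1 : finSuccEquiv K k f ∣ finSuccEquiv K k g := map_dvd _ hfg
  have h0 : finSuccEquiv K k g ≠ 0 := by simpa using hg
  have h2 := Polynomial.natDegree_le_of_dvd h1 h0
  rw [hz.natDegree] at h2
  rw [natDegree_finSuccEquiv] at h2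
  have hd : 0 < d := by
    obtain ⟨s, hs⟩ := support_nonempty.2 hg
    have := h s hs; omega
  have h3 : degreeOf 0 g < d := by
    rw [degreeOf_lt_iff hd]; exact h
  omega

lemma factorial_le_pow_self' (s Y : ℕ) (h : s ≤ Y) : s.factorial ≤ Y^s :=
  (Nat.factorial_le_pow s).trans (Nat.pow_le_pow_left h s)

theorem curve_class (M : MvPolynomial (Fin 2) ℤ) (δ : ℕ) (hδ : 2 ≤ δ) (hz : ZL (toQ M) δ) (hirr : Irreducible (toQ M))
    (Y q : ℕ) (hY : 48 ≤ Y) (hq : Y^21 ≤ q) (P0 : Fin 2 → ℤ) (hu : IsCoprime (eval P0 (pderiv 0 M)) (q:ℤ))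
    (Z : Finset (Fin 2 → ℤ)) (hB : ∀ z ∈ Z, inBox (Y^41) z) (hP : ∀ z ∈ Z, ∀ k, (q:ℤ) ∣ z k - P0 k)
    (hf : ∀ z ∈ Z, eval z M = 0) : Z.card ≤ δ * 24 := by
  classical
  let φ : ℕ × ℕ ↪ (Fin 2 →₀ ℕ) := ⟨fun t => Finsupp.equivFunOnFinite.symm ![t.1, t.2], by
    rintro ⟨a, b⟩ ⟨a', b'⟩ h
    have h0 := DFunLike.congr_fun h 0
    have h1 := DFunLike.congr_fun h 1
    simp at h0 h1; simp [h0, h1]⟩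
  have hφ0 : ∀ t, φ t 0 = t.1 := fun t => rfl
  have hφd : ∀ t, (φ t).degree = t.1 + t.2 := fun t => by
    rw [Finsupp.degree_eq_sum, Fin.sum_univ_two]; rfl
  let J := (Finset.range 2 ×ˢ Finset.range 24).map φ
  have hJ : J.card = 48 := by simp [J]
  have hJs : ∑ s ∈ J, s.degree = 576 := by
    simp only [J, Finset.sum_map, hφd]
    rfl
  obtain ⟨g, hg0, hgJ, hg⟩ := aux_poly M q (Y^41) (Nat.one_le_pow _ _ (by omega)) P0 hu 48 Z hB hP hf J 1128
    (by
      simp only [ncard_exps1, hJ]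
      decide)
    (by
      rw [hJ, hJs]
      calc _ ≤ Y^48 * (Y^41)^576 := Nat.mul_le_mul_right _ (factorial_le_pow_self' 48 Y hY)
        _ = Y^23664 := by rw [← pow_mul, ← pow_add]
        _ < Y^(21*1128) := Nat.pow_lt_pow_right (by omega) (by norm_num)
        _ = (Y^21)^1128 := by rw [pow_mul]
        _ ≤ q^1128 := Nat.pow_le_pow_left hq _)
  have hgdeg : g.totalDegree ≤ 24 := by
    rw [totalDegree_le_iff_degree]
    intro s hs
    obtain ⟨t, ht, rfl⟩ := Finset.mem_map.1 (hgJ hs)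
    simp at ht
    rw [hφd]; omega
  have hnd : ¬ toQ M ∣ g := by
    refine not_dvd_of_deg _ g δ hz hg0 fun s hs => ?_
    obtain ⟨t, ht, rfl⟩ := Finset.mem_map.1 (hgJ hs)
    simp at ht
    rw [hφ0]; omega
  have := bezout (toQ M) g hirr hnd (Z.map ⟨qz, qz_injective⟩) (by
    intro z hz
    obtain ⟨w, hw, rfl⟩ := Finset.mem_map.1 hz
    refine ⟨?_, hg w hw⟩
    show eval (qz w) _ = 0
    rw [eval_toQ, hf w hw]; simp)
  rw [Finset.card_map, hz.1] at this
  exact this.trans (by gcongr)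

lemma sum_range_tri (r : ℕ) : 6 * ∑ k ∈ Finset.range r, {s : Fin 2 →₀ ℕ | s.degree < k+1}.ncard = r*(r+1)*(r+2) := by
  induction r with
  | zero => simp
  | succ r ih =>
    rw [Finset.sum_range_succ, mul_add, ih]
    have := ncard_exps2 r
    nlinarith

/-- pairs with a + b ≤ E -/
def tri (E : ℕ) : Finset (ℕ × ℕ) := (Finset.range (E+1)).biUnion fun k => Finset.HasAntidiagonal.antidiagonal k

lemma tri_sum (E : ℕ) (F : ℕ → ℕ) : ∑ t ∈ tri E, F (t.1 + t.2) = ∑ k ∈ Finset.range (E+1), (k+1) * F k := by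
  unfold tri
  rw [Finset.sum_biUnion]
  · refine Finset.sum_congr rfl fun k _ => ?_
    rw [Finset.sum_congr rfl (g := fun _ => F k)]
    · simp
    · intro t ht; rw [Finset.HasAntidiagonal.mem_antidiagonal.1 ht]
  · intro a _ b _ hab
    simp only [Function.onFun]
    rw [Finset.disjoint_left]
    intro t h1 h2
    rw [Finset.HasAntidiagonal.mem_antidiagonal] at h1 h2
    omega

lemma mem_tri (E : ℕ) (t : ℕ × ℕ) : t ∈ tri E ↔ t.1 + t.2 ≤ E := by
  simp [tri, Nat.lt_succ_iff]

lemma tri_card (E : ℕ) : 2 * (tri E).card = (E+1)*(E+2) := by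
  have := tri_sum E (fun _ => 1)
  rw [← Finset.card_eq_sum_ones] at this
  rw [this]
  clear this
  induction E with
  | zero => simp
  | succ E ih => rw [Finset.sum_range_succ, mul_add, ih]; ring

lemma tri_wt (E : ℕ) : 3 * ∑ t ∈ tri E, (t.1 + t.2) = E*(E+1)*(E+2) := by
  have := tri_sum E (fun k => k)
  rw [this]
  clear this
  induction E with
  | zero => simp
  | succ E ih => rw [Finset.sum_range_succ, mul_add, ih]; ring

theorem surface_class (f : MvPolynomial (Fin 3) ℤ) (d : ℕ) (hd : 5 ≤ d) (hz : ZL (toQ f) d)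
    (hirr : Irreducible (toQ f))
    (Y q : ℕ) (hY : d * (4*(100*d)+1) * (2*(100*d)+1) ≤ Y) (hq : Y^18 ≤ q) (P0 : Fin 3 → ℤ)
    (hu : IsCoprime (eval P0 (pderiv 0 f)) (q:ℤ))
    (Z : Finset (Fin 3 → ℤ)) (hB : ∀ z ∈ Z, inBox (Y^40) z) (hP : ∀ z ∈ Z, ∀ k, (q:ℤ) ∣ z k - P0 k)
    (hf : ∀ z ∈ Z, eval z f = 0) :
    ∃ R : MvPolynomial (Fin 2) ℚ, R ≠ 0 ∧ R.totalDegree ≤ (402*d)^2 ∧ ∀ z ∈ Z, eval (qz (Fin.tail z)) R = 0 := by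
  classical
  let φ : ℕ × ℕ × ℕ ↪ (Fin 3 →₀ ℕ) := ⟨fun t => Finsupp.equivFunOnFinite.symm ![t.1, t.2.1, t.2.2], by
    rintro ⟨a, b, c⟩ ⟨a', b', c'⟩ h
    have h0 := DFunLike.congr_fun h 0
    have h1 := DFunLike.congr_fun h 1
    have h2 := DFunLike.congr_fun h 2
    simp at h0 h1 h2; simp [h0, h1, h2]⟩
  have hφ0 : ∀ t, φ t 0 = t.1 := fun t => rfl
  have hφd : ∀ t, (φ t).degree = t.1 + (t.2.1 + t.2.2) := fun t => by
    rw [Finsupp.degree_eq_sum, Fin.sum_univ_three, add_assoc]; rfl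
  obtain ⟨m, hm⟩ : ∃ m, m = 100*d := ⟨_, rfl⟩
  rw [← hm] at hY
  let J := (Finset.range d ×ˢ tri (4*m)).map φ
  have hJ : J.card = d * (4*m+1) * (2*m+1) := by
    simp only [J, Finset.card_map, Finset.card_product, Finset.card_range]
    have := tri_card (4*m)
    have h2 : (tri (4*m)).card = (4*m+1)*(2*m+1) := by nlinarith
    rw [h2]; ring
  have hJs : 6 * ∑ s ∈ J, s.degree = 3 * (d*(d-1)) * ((4*m+1)*(2*m+1)) + 2 * d * (4*m*(4*m+1)*(4*m+2)) := by
    simp only [J, Finset.sum_map, hφd]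
    rw [Finset.sum_product]
    simp only [Finset.sum_add_distrib, Finset.sum_const, smul_eq_mul, Finset.card_range]
    rw [← Finset.mul_sum]
    have h1 := Finset.sum_range_id_mul_two d
    have h2 := tri_wt (4*m)
    rw [Finset.sum_add_distrib] at h2
    have h3 : (tri (4*m)).card = (4*m+1)*(2*m+1) := by have := tri_card (4*m); nlinarith
    rw [h3, ← h2, ← h1]; ring
  obtain ⟨T, hT⟩ : ∃ T, T = ∑ s ∈ J, s.degree := ⟨_, rfl⟩
  have hsum := sum_range_tri (9*m)
  obtain ⟨U, hU⟩ : ∃ U, U = ∑ k ∈ Finset.range (9*m), {s : Fin 2 →₀ ℕ | s.degree < k+1}.ncard := ⟨_, rfl⟩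
  rw [← hU] at hsum
  rw [← hT] at hJs
  have key : 18 * U + 40 * T + J.card < 18 * (9*m * J.card) := by
    obtain ⟨t, rfl⟩ : ∃ t, d = t + 5 := ⟨d - 5, by omega⟩
    rw [hJ]
    simp only [show t + 5 - 1 = t + 4 by omega] at hJs
    subst hm
    ring_nf at hJs hsum ⊢
    nlinarith
  obtain ⟨v, hv⟩ : ∃ v, v + U = 9*m * J.card := ⟨9*m*J.card - U, by omega⟩
  obtain ⟨g, hg0, hgJ, hg⟩ := aux_poly f q (Y^40) (Nat.one_le_pow _ _ (by
      refine le_trans ?_ hY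
      exact Nat.mul_pos (Nat.mul_pos (by omega) (by omega)) (by omega))) P0 hu (9*m) Z hB hP hf J v
    (by rw [← hU]; exact hv.le)
    (by
      rw [← hT]
      have h1 : J.card ≤ Y := by rw [hJ]; exact hY
      have hY1 : 1 < Y := by
        refine lt_of_lt_of_le ?_ hY
        nlinarith [Nat.mul_pos (Nat.succ_pos (4*m)) (Nat.succ_pos (2*m))]
      calc _ ≤ Y^J.card * (Y^40)^T := Nat.mul_le_mul_right _ (factorial_le_pow_self' _ Y h1)
        _ = Y^(J.card + 40*T) := by rw [← pow_mul, ← pow_add]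
        _ < Y^(18*v) := Nat.pow_lt_pow_right hY1 (by omega)
        _ = (Y^18)^v := by rw [pow_mul]
        _ ≤ q^v := Nat.pow_le_pow_left hq _)
  have hgdeg : g.totalDegree ≤ 401 * d := by
    rw [totalDegree_le_iff_degree]
    intro s hs
    obtain ⟨t, ht, rfl⟩ := Finset.mem_map.1 (hgJ hs)
    rw [Finset.mem_product, mem_tri, Finset.mem_range] at ht
    rw [hφd]; omega
  have hnd : ¬ toQ f ∣ g := by
    refine not_dvd_of_deg _ g d hz hg0 fun s hs => ?_
    obtain ⟨t, ht, rfl⟩ := Finset.mem_map.1 (hgJ hs)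
    rw [Finset.mem_product, Finset.mem_range] at ht
    exact ht.1
  obtain ⟨R, h1, h2, h3⟩ := elim (toQ f) g d (by omega) hz hirr hnd
  refine ⟨R, h1, h2.trans (Nat.pow_le_pow_left (by omega) _), fun z hz => ?_⟩
  rw [← qz_tail]
  exact h3 _ (by rw [eval_toQ, hf z hz]; simp) (hg z hz)
end DG

namespace DG
open MvPolynomial

/-- residue class representative -/
def cl {k : ℕ} (q : ℕ) (z : Fin k → ℤ) : Fin k → ℤ := fun i => z i % (q:ℤ)

lemma cl_eq_iff {k : ℕ} (q : ℕ) (z w : Fin k → ℤ) : cl q z = cl q w ↔ ∀ i, (q:ℤ) ∣ z i - w i := by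
  constructor
  · intro h i
    have h1 : z i % (q:ℤ) = w i % (q:ℤ) := congrFun h i
    exact Int.ModEq.dvd (show w i ≡ z i [ZMOD q] from h1.symm)
  · intro h; ext i
    exact (Int.ModEq.symm ((Int.modEq_iff_dvd).2 (h i)))

lemma cl_dvd {k : ℕ} (q : ℕ) (z : Fin k → ℤ) (i : Fin k) : (q:ℤ) ∣ cl q z i - z i := by
  unfold cl
  exact (Int.modEq_iff_dvd.1 (Int.mod_modEq (z i) q).symm)

lemma eval_zmod {k : ℕ} (p : ℕ) (f : MvPolynomial (Fin k) ℤ) (z : Fin k → ℤ) :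
    eval (fun i => (z i : ZMod p)) (map (Int.castRingHom (ZMod p)) f) = ((eval z f : ℤ) : ZMod p) := by
  rw [eval_map]
  simp [eval₂_eq', eval_eq']

theorem resid_count {k : ℕ} (f : MvPolynomial (Fin (k+1)) ℤ) (d p : ℕ) (hd : f.totalDegree ≤ d) (hp : p.Prime)
    (Z : Finset (Fin (k+1) → ℤ)) (hZ : ∀ z ∈ Z, (p:ℤ) ∣ eval z f ∧ ¬ (p:ℤ) ∣ eval z (pderiv 0 f)) :
    (Z.image (cl p)).card ≤ d * p^k := by
  classical
  have _ : Fact p.Prime := ⟨hp⟩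
  have hp0 : (0:ℤ) < p := by exact_mod_cast hp.pos
  let T : Finset (Fin k → ℤ) := Fintype.piFinset fun _ => Finset.Ico 0 (p:ℤ)
  have hT : T.card = p^k := by simp [T]
  rw [← hT]
  refine card_le_fiber _ (fun z : Fin (k+1) → ℤ => (Fin.tail z : Fin k → ℤ)) T d ?_ ?_
  · intro r hr
    obtain ⟨z, -, rfl⟩ := Finset.mem_image.1 hr
    simp only [T, Fintype.mem_piFinset, Finset.mem_Ico]
    intro i
    exact ⟨Int.emod_nonneg _ hp0.ne', Int.emod_lt_of_pos _ hp0⟩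
  · intro t _
    set fp := map (Int.castRingHom (ZMod p)) f with hfp
    let tp : Fin k → ZMod p := fun i => (t i : ZMod p)
    let P := Polynomial.map (eval tp) (finSuccEquiv (ZMod p) k fp)
    by_cases hemp : ((Z.image (cl p)).filter fun z : Fin (k+1) → ℤ => (Fin.tail z : Fin k → ℤ) = t) = ∅
    · rw [hemp]; simp
    have main : ∀ r ∈ (Z.image (cl p)).filter (fun z : Fin (k+1) → ℤ => (Fin.tail z : Fin k → ℤ) = t),
        P.eval (r 0 : ZMod p) = 0 ∧ P.derivative.eval (r 0 : ZMod p) ≠ 0 := by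
      intro r hr
      obtain ⟨hr1, hr2⟩ := Finset.mem_filter.1 hr
      obtain ⟨z, hz, rfl⟩ := Finset.mem_image.1 hr1
      have e0 : (fun i => ((cl p z i : ℤ) : ZMod p)) = Fin.cons ((cl p z 0 : ℤ) : ZMod p) tp := by
        ext i
        refine Fin.cases ?_ (fun j => ?_) i
        · rfl
        · simp only [Fin.cons_succ, tp, ← hr2]; rfl
      have e1 : ∀ g : MvPolynomial (Fin (k+1)) ℤ, Polynomial.eval ((cl p z 0 : ℤ) : ZMod p)
          (Polynomial.map (eval tp) (finSuccEquiv (ZMod p) k (map (Int.castRingHom (ZMod p)) g))) = ((eval z g : ℤ) : ZMod p) := by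
        intro g
        rw [← eval_eq_eval_mv_eval', ← e0, eval_zmod]
        have := eval_congr_mod g p (cl p z) z (fun i => cl_dvd p z i)
        rw [← sub_eq_zero, ← Int.cast_sub]
        exact (ZMod.intCast_zmod_eq_zero_iff_dvd _ _).2 this
      refine ⟨?_, ?_⟩
      · rw [e1 f]; exact (ZMod.intCast_zmod_eq_zero_iff_dvd _ _).2 (hZ z hz).1
      · have : P.derivative = Polynomial.map (eval tp) (finSuccEquiv (ZMod p) k (map (Int.castRingHom (ZMod p)) (pderiv 0 f))) := by
          simp only [P]
          rw [Polynomial.derivative_map, derivative_finSuccEquiv, hfp, pderiv_map]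
        rw [this, e1]
        intro h0
        exact (hZ z hz).2 ((ZMod.intCast_zmod_eq_zero_iff_dvd _ _).1 h0)
    obtain ⟨r0, hr0⟩ := Finset.nonempty_iff_ne_empty.2 hemp
    have hP0 : P ≠ 0 := by
      intro h; apply (main r0 hr0).2; rw [h]; simp
    have hPd : P.natDegree ≤ d := by
      refine (Polynomial.natDegree_map_le).trans ((natDegree_fse_le fp).trans (le_trans ?_ hd))
      unfold totalDegree
      exact Finset.sup_mono (support_map_subset _ _)
    refine le_trans ?_ ((Polynomial.card_roots' P).trans hPd)
    refine le_trans ?_ (Multiset.toFinset_card_le _)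
    refine Finset.card_le_card_of_injOn (fun r => (r 0 : ZMod p)) ?_ ?_
    · intro r hr
      simp only [Finset.mem_coe, Multiset.mem_toFinset]
      rw [Polynomial.mem_roots hP0]
      exact (main r hr).1
    · intro a ha b hb hab
      obtain ⟨ha1, ha2⟩ := Finset.mem_filter.1 ha
      obtain ⟨hb1, hb2⟩ := Finset.mem_filter.1 hb
      obtain ⟨z, hz, rfl⟩ := Finset.mem_image.1 ha1
      obtain ⟨w, hw, rfl⟩ := Finset.mem_image.1 hb1
      have h0 : cl p z 0 = cl p w 0 := by
        have h1 : ((cl p z 0 : ℤ) : ZMod p) = ((cl p w 0 : ℤ) : ZMod p) := hab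
        rw [ZMod.intCast_eq_intCast_iff] at h1
        have h2 : cl p z 0 % p = cl p w 0 % p := h1
        simpa [cl] using h2
      rw [← Fin.cons_self_tail (cl p z), ← Fin.cons_self_tail (cl p w), h0]
      congr 1
      exact ha2.trans hb2.symm

/-- product of a set of primes -/
def qq (τ : Finset ℕ) : ℕ := ∏ p ∈ τ, p

lemma qq_coprime (σ τ : Finset ℕ) (h : ∀ p ∈ σ ∪ τ, p.Prime) (hd : Disjoint σ τ) : Nat.Coprime (qq σ) (qq τ) := by
  unfold qq
  apply Nat.Coprime.prod_left
  intro p hp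
  apply Nat.Coprime.prod_right
  intro r hr
  rw [Nat.coprime_primes (h p (Finset.mem_union_left _ hp)) (h r (Finset.mem_union_right _ hr))]
  rintro rfl
  exact Finset.disjoint_left.1 hd hp hr

lemma qq_ge (τ : Finset ℕ) (Y : ℕ) (h : ∀ p ∈ τ, Y ≤ p) : Y^τ.card ≤ qq τ := by
  unfold qq; exact Finset.pow_card_le_prod _ _ _ h

theorem class_count {k : ℕ} (f : MvPolynomial (Fin (k+1)) ℤ) (d Y : ℕ) (hd : f.totalDegree ≤ d) 
    (Z : Finset (Fin (k+1) → ℤ)) (τ : Finset ℕ) (hτ : ∀ p ∈ τ, p.Prime ∧ p ≤ 8*Y)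
    (hZ : ∀ z ∈ Z, ∀ p ∈ τ, (p:ℤ) ∣ eval z f ∧ ¬ (p:ℤ) ∣ eval z (pderiv 0 f)) :
    (Z.image (cl (qq τ))).card ≤ (d * (8*Y)^k)^τ.card := by
  classical
  induction τ using Finset.induction_on with
  | empty =>
    simp only [Finset.card_empty, pow_zero]
    rw [Finset.card_le_one]
    intro a ha b hb
    obtain ⟨z, hz, rfl⟩ := Finset.mem_image.1 ha
    obtain ⟨w, hw, rfl⟩ := Finset.mem_image.1 hb
    rw [cl_eq_iff]; simp [qq]
  | insert p τ hp ih =>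
    have ih := ih (fun r hr => hτ r (Finset.mem_insert_of_mem hr)) (fun z hz r hr => hZ z hz r (Finset.mem_insert_of_mem hr))
    have h1 := resid_count f d p hd (hτ p (Finset.mem_insert_self _ _)).1 Z (fun z hz => hZ z hz p (Finset.mem_insert_self _ _))
    have hq : qq (insert p τ) = p * qq τ := by unfold qq; rw [Finset.prod_insert hp]
    have hcop : Nat.Coprime p (qq τ) := by
      have := qq_coprime {p} τ (by intro r hr; exact (hτ r (by simpa using hr)).1) (by simpa using hp)
      simpa [qq] using this
    have h2 : (Z.image (cl (qq (insert p τ)))).card ≤ ((Z.image (cl p)) ×ˢ (Z.image (cl (qq τ)))).card := by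
      refine Finset.card_le_card_of_injOn (fun r => (cl p r, cl (qq τ) r)) ?_ ?_
      · intro r hr
        obtain ⟨z, hz, rfl⟩ := Finset.mem_image.1 (Finset.mem_coe.1 hr)
        simp only [Finset.mem_coe, Finset.mem_product, Finset.mem_image]
        refine ⟨⟨z, hz, ?_⟩, ⟨z, hz, ?_⟩⟩
        · rw [cl_eq_iff]; intro i
          have := cl_dvd (qq (insert p τ)) z i
          rw [hq] at this ⊢
          rw [← dvd_neg, neg_sub]
          exact (Dvd.intro _ (by push_cast; rfl)).trans this
        · rw [cl_eq_iff]; intro i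
          have := cl_dvd (qq (insert p τ)) z i
          rw [hq] at this ⊢
          rw [← dvd_neg, neg_sub]
          exact (Dvd.intro_left _ (by push_cast; rfl)).trans this
      · intro r hr s hs hrs
        obtain ⟨z, hz, rfl⟩ := Finset.mem_image.1 (Finset.mem_coe.1 hr)
        obtain ⟨w, hw, rfl⟩ := Finset.mem_image.1 (Finset.mem_coe.1 hs)
        simp only [Prod.mk.injEq, cl_eq_iff] at hrs
        have h3 : cl (qq (insert p τ)) (cl (qq (insert p τ)) z) = cl (qq (insert p τ)) (cl (qq (insert p τ)) w) := by
          rw [cl_eq_iff]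
          intro i
          rw [hq]; push_cast
          rw [hq] at hrs
          exact (Nat.isCoprime_iff_coprime.2 hcop).mul_dvd (hrs.1 i) (hrs.2 i)
        ext i
        have := congrFun h3 i
        simpa [cl] using this
    rw [Finset.card_product] at h2
    rw [Finset.card_insert_of_notMem hp, pow_succ, mul_comm]
    refine h2.trans (Nat.mul_le_mul (h1.trans ?_) ih)
    gcongr
    exact (hτ p (Finset.mem_insert_self _ _)).2

lemma coprime_qq (τ : Finset ℕ) (h : ∀ p ∈ τ, p.Prime) (a : ℤ) (ha : ∀ p ∈ τ, ¬ (p:ℤ) ∣ a) :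
    IsCoprime a (qq τ : ℤ) := by
  unfold qq
  push_cast
  apply IsCoprime.prod_right
  intro p hp
  rw [isCoprime_comm]
  exact (Prime.coprime_iff_not_dvd (Nat.prime_iff_prime_int.1 (h p hp))).2 (ha p hp)

/-- few primes divide a nonzero integer -/
lemma bad_card (P : Finset ℕ) (Y e : ℕ) (hY : 2 ≤ Y) (hP : ∀ p ∈ P, p.Prime ∧ Y < p) (a : ℤ) (ha : a ≠ 0)
    (hle : |a| ≤ ((Y^e : ℕ) : ℤ)) : (P.filter fun p : ℕ => (p:ℤ) ∣ a).card ≤ e := by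
  classical
  set T := P.filter fun p : ℕ => (p:ℤ) ∣ a with hT
  have h1 : qq T ∣ a.natAbs := by
    unfold qq
    apply Finset.prod_primes_dvd
    · intro p hp; exact (hP p (Finset.mem_filter.1 hp).1).1.prime
    · intro p hp; exact Int.natCast_dvd.1 (Finset.mem_filter.1 hp).2
  have h2 := Nat.le_of_dvd (Int.natAbs_pos.2 ha) h1
  have h3 := qq_ge T Y (fun p hp => (hP p (Finset.mem_filter.1 hp).1).2.le)
  have h4 : a.natAbs ≤ Y^e := by zify; exact_mod_cast hle
  exact (Nat.pow_le_pow_iff_right (by omega)).1 (h3.trans (h2.trans h4))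
end DG

namespace DG
open MvPolynomial

lemma pderiv_toQ {k : ℕ} (f : MvPolynomial (Fin k) ℤ) (i : Fin k) : toQ (pderiv i f) = pderiv i (toQ f) := by
  unfold toQ
  rw [pderiv_map]

lemma toQ_ne_zero {k : ℕ} {f : MvPolynomial (Fin k) ℤ} (h : f ≠ 0) : toQ f ≠ 0 := by
  intro h0; apply h; apply toQ_injective; rw [h0]; unfold toQ; simp

lemma totalDegree_pderiv_le {K : Type*} [CommRing K] {k : ℕ} (f : MvPolynomial (Fin k) K) (i : Fin k) :
    (pderiv i f).totalDegree ≤ f.totalDegree - 1 := by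
  rw [totalDegree_le_iff_degree]
  intro s hs
  rw [mem_support_iff, coeff_pderiv] at hs
  have h1 : coeff (s + Finsupp.single i 1) f ≠ 0 := by
    intro h0; apply hs; rw [h0]; simp
  have := (totalDegree_le_iff_degree f f.totalDegree).1 le_rfl _ (mem_support_iff.2 h1)
  simp only [map_add, Finsupp.degree_single] at this
  omega

lemma not_dvd_pderiv {K : Type*} [Field K] [CharZero K] {k : ℕ} (f : MvPolynomial (Fin (k+1)) K) (d : ℕ) (hd : 1 ≤ d) (hz : ZL f d) :
    pderiv 0 f ≠ 0 ∧ ¬ f ∣ pderiv 0 f := by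
  have h0 : pderiv 0 f ≠ 0 := by
    intro h
    have h2 := congrArg (coeff (Finsupp.single 0 (d-1))) h
    rw [coeff_pderiv, ← Finsupp.single_add, Nat.sub_add_cancel hd] at h2
    simp only [coeff_zero, mul_eq_zero] at h2
    rcases h2 with h2 | h2
    · exact hz.2 h2
    · simp at h2; norm_cast at h2
  refine ⟨h0, not_dvd_of_deg f _ d hz h0 fun s hs => ?_⟩
  have h1 := (totalDegree_le_iff_degree _ _).1 (totalDegree_pderiv_le f 0) s hs
  have : s 0 ≤ s.degree := Finsupp.le_degree 0 s
  have := hz.1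
  omega

lemma ZL.smul {K : Type*} [Field K] {k : ℕ} {f : MvPolynomial (Fin (k+1)) K} {d : ℕ} (hz : ZL f d) (c : K) (hc : c ≠ 0) :
    ZL (C c * f) d := by
  constructor
  · rw [← hz.1]
    have h0 : f ≠ 0 := by rintro rfl; exact hz.2 (by simp)
    rw [totalDegree_mul_of_isDomain (by simpa using hc) h0]; simp
  · rw [coeff_C_mul]; exact mul_ne_zero hc hz.2

lemma irr_smul {K : Type*} [Field K] {σ : Type*} {f : MvPolynomial σ K} (h : Irreducible f) (c : K) (hc : c ≠ 0) :
    Irreducible (C c * f) := by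
  have hu : IsUnit (C c : MvPolynomial σ K) := (isUnit_iff_ne_zero.2 hc).map C
  exact (irreducible_isUnit_mul hu).2 h

/-- exponent bound for bad primes; `k` = number of variables -/
def bet (k E d : ℕ) : ℕ := (k + 1 + E * d) + (k + E * d) * (d+1)^k

theorem hb_or {k : ℕ} (f : MvPolynomial (Fin (k+1)) ℚ) (d : ℕ) (hd : 1 ≤ d) (hz : ZL f d) (hirr : Irreducible f)
    (Y E : ℕ) (hY : d + 1 ≤ Y) (S : Finset (Fin (k+1) → ℤ)) (hB : ∀ z ∈ S, inBox (Y^E) z)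
    (hS : ∀ z ∈ S, eval (qz z) f = 0) (P : Finset ℕ) (hP : ∀ p ∈ P, p.Prime ∧ Y < p) :
    (∃ g : MvPolynomial (Fin (k+1)) ℚ, g.totalDegree ≤ d ∧ ¬ f ∣ g ∧ ∀ z ∈ S, eval (qz z) g = 0) ∨
    ∃ f' : MvPolynomial (Fin (k+1)) ℤ, (∃ c : ℚ, c ≠ 0 ∧ toQ f' = C c * f) ∧
      ∀ z, inBox (Y^E) z → eval z (pderiv 0 f') ≠ 0 →
        (P.filter fun p : ℕ => (p:ℤ) ∣ eval z (pderiv 0 f')).card ≤ bet (k+1) E d := by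
  have hY1 : 1 ≤ Y := by omega
  have hB1 : 1 ≤ Y^E := Nat.one_le_pow _ _ hY1
  obtain ⟨g, hg0, hgd, hgS, hgc⟩ := hb_deg S (Y^E) d hB1 hB f hirr.ne_zero hz.1.le hS
  by_cases hdv : f ∣ toQ g
  · right
    refine ⟨g, ?_, ?_⟩
    · obtain ⟨w, hw⟩ := hdv
      have h0 := toQ_ne_zero hg0
      have hw0 : w ≠ 0 := by rintro rfl; apply h0; rw [hw]; simp
      have ht : w.totalDegree = 0 := by
        have := totalDegree_toQ g
        rw [hw, totalDegree_mul_of_isDomain hirr.ne_zero hw0, hz.1] at this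
        omega
      rw [totalDegree_eq_zero_iff_eq_C] at ht
      refine ⟨coeff 0 w, ?_, ?_⟩
      · intro h; apply hw0; rw [ht, h]; simp
      · rw [hw, ← ht, mul_comm]
    · intro z hzb hne
      refine bad_card P Y _ (by omega) hP _ hne ?_
      set c := ((d+1)^(k+1) * (Y^E)^d)^((d+1)^(k+1)) with hc
      have h1 := eval_abs_le (pderiv 0 g) z (Y^E) d (c * Y) hB1 hzb
        ((totalDegree_pderiv_le g 0).trans (by omega)) (by
          intro s
          rw [coeff_pderiv]
          by_cases h0 : coeff (s + Finsupp.single 0 1) g = 0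
          · rw [h0]; simp only [zero_mul, abs_zero]; positivity
          have h2 := (totalDegree_le_iff_degree g d).1 hgd _ (mem_support_iff.2 h0)
          simp only [map_add, Finsupp.degree_single] at h2
          have h3 : s 0 ≤ s.degree := Finsupp.le_degree 0 s
          rw [abs_mul]; push_cast
          have h4 := hgc (s + Finsupp.single 0 1)
          have h5 : |((s 0 : ℤ) + 1)| ≤ (Y:ℤ) := by rw [abs_of_nonneg (by positivity)]; omega
          exact mul_le_mul h4 h5 (abs_nonneg _) (by positivity))
      refine h1.trans ?_
      have h6 : (d+1)^(k+1) ≤ Y^(k+1) := Nat.pow_le_pow_left hY _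
      have h7 : (d+1)^(k+1) * (Y^E)^d ≤ Y^(k+1+E*d) := by
        rw [pow_add Y, ← pow_mul]; exact Nat.mul_le_mul_right _ h6
      have h8 : c ≤ Y^((k+1+E*d)*(d+1)^(k+1)) := by
        rw [pow_mul, hc]; exact Nat.pow_le_pow_left h7 _
      have : (d+1)^(k+1) * (c*Y) * (Y^E)^d ≤ Y^(bet (k+1) E d) := by
        calc _ = ((d+1)^(k+1) * (Y^E)^d) * Y * c := by ring
          _ ≤ Y^(k+1+E*d) * Y * Y^((k+1+E*d)*(d+1)^(k+1)) := by gcongr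
          _ = _ := by unfold bet; rw [← pow_succ, ← pow_add]; congr 1; ring
      exact_mod_cast this
  · left
    exact ⟨toQ g, by rw [totalDegree_toQ]; exact hgd, hdv, fun z hzS => by rw [eval_toQ, hgS z hzS]; simp⟩

end DG

namespace DG
open MvPolynomial

/-- outside `n` points, classes are well controlled -/
def Good {m : ℕ} (S : Finset (Fin m → ℤ)) (P : Finset ℕ) (n β c : ℕ) : Prop :=
  ∃ N ⊆ S, N.card ≤ n ∧ ∃ Bad : (Fin m → ℤ) → Finset ℕ, (∀ w ∈ S, w ∉ N → (Bad w).card ≤ β) ∧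
    ∀ τ σ : Finset ℕ, τ ⊆ σ → σ ⊆ P → τ.card = 18 → σ.card = 21 → ∀ Z ⊆ S, (∀ w ∈ Z, w ∉ N ∧ Disjoint σ (Bad w)) →
      (∀ w ∈ Z, ∀ w' ∈ Z, ∀ i, (qq τ : ℤ) ∣ w i - w' i) → Z.card ≤ c

lemma Good.mono {m : ℕ} {S : Finset (Fin m → ℤ)} {P : Finset ℕ} {n β c n' β' c' : ℕ} (h : Good S P n β c)
    (hn : n ≤ n') (hβ : β ≤ β') (hc : c ≤ c') : Good S P n' β' c' := by
  obtain ⟨N, hN, hNc, Bad, hb, hz⟩ := h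
  exact ⟨N, hN, hNc.trans hn, Bad, fun w hw hwN => (hb w hw hwN).trans hβ,
    fun τ σ h1 h2 h3 h4 Z h5 h6 h7 => (hz τ σ h1 h2 h3 h4 Z h5 h6 h7).trans hc⟩

lemma Good.small {m : ℕ} (S : Finset (Fin m → ℤ)) (P : Finset ℕ) (n β c : ℕ) (h : S.card ≤ n) : Good S P n β c := by
  refine ⟨S, subset_rfl, h, fun _ => ∅, fun w hw hwN => absurd hw hwN, fun τ σ h1 h2 h3 h4 Z h5 h6 h7 => ?_⟩
  have : Z = ∅ := Finset.eq_empty_of_forall_notMem fun w hw => (h6 w hw).1 (h5 hw)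
  simp [this]

lemma Good.of_map {m m' : ℕ} {S : Finset (Fin m → ℤ)} {S' : Finset (Fin m' → ℤ)} {P : Finset ℕ} {n β c : ℕ}
    (h : Good S' P n β c) (φ : (Fin m → ℤ) → Fin m' → ℤ) (hφ : ∀ w ∈ S, φ w ∈ S') (D : ℕ)
    (hD : ∀ t, (S.filter fun w => φ w = t).card ≤ D)
    (hcong : ∀ (q : ℤ) w w', (∀ i, q ∣ w i - w' i) → ∀ i, q ∣ φ w i - φ w' i) : Good S P (D*n) β (D*c) := by
  classical
  obtain ⟨N, hN, hNc, Bad, hb, hz⟩ := h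
  have key : ∀ Z ⊆ S, Z.card ≤ D * (Z.image φ).card := by
    intro Z hZ
    refine card_le_fiber Z φ _ D (fun z hz => Finset.mem_image_of_mem _ hz) fun t _ => ?_
    exact (Finset.card_le_card (Finset.filter_subset_filter _ hZ)).trans (hD t)
  refine ⟨S.filter fun w => φ w ∈ N, Finset.filter_subset _ _, ?_, fun w => Bad (φ w), ?_, ?_⟩
  · refine (key _ (Finset.filter_subset _ _)).trans (Nat.mul_le_mul_left _ ((Finset.card_le_card ?_).trans hNc))
    intro t ht
    obtain ⟨w, hw, rfl⟩ := Finset.mem_image.1 ht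
    exact (Finset.mem_filter.1 hw).2
  · intro w hw hwN
    exact hb _ (hφ w hw) fun h => hwN (Finset.mem_filter.2 ⟨hw, h⟩)
  · intro τ σ h1 h2 h3 h4 Z h5 h6 h7
    refine (key Z h5).trans (Nat.mul_le_mul_left _ (hz τ σ h1 h2 h3 h4 _ ?_ ?_ ?_))
    · intro t ht
      obtain ⟨w, hw, rfl⟩ := Finset.mem_image.1 ht
      exact hφ w (h5 hw)
    · intro t ht
      obtain ⟨w, hw, rfl⟩ := Finset.mem_image.1 ht
      exact ⟨fun h => (h6 w hw).1 (Finset.mem_filter.2 ⟨h5 hw, h⟩), (h6 w hw).2⟩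
    · intro t ht t' ht'
      obtain ⟨w, hw, rfl⟩ := Finset.mem_image.1 ht
      obtain ⟨w', hw', rfl⟩ := Finset.mem_image.1 ht'
      exact hcong _ _ _ (h7 w hw w' hw')

lemma Good.union {m : ℕ} {ι : Type*} (J : Finset ι) (S : Finset (Fin m → ℤ)) (T : ι → Finset (Fin m → ℤ))
    (P : Finset ℕ) (n β c : ℕ) (h : ∀ j ∈ J, Good (T j) P n β c) (hS : ∀ w ∈ S, ∃ j ∈ J, w ∈ T j) :
    Good S P (J.card * n) β (J.card * c) := by
  classical
  have h' : ∀ j : ι, ∃ N : Finset (Fin m → ℤ), ∃ Bad : (Fin m → ℤ) → Finset ℕ, j ∈ J → (N ⊆ T j ∧ N.card ≤ n ∧ 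
      (∀ w ∈ T j, w ∉ N → (Bad w).card ≤ β) ∧
    ∀ τ σ : Finset ℕ, τ ⊆ σ → σ ⊆ P → τ.card = 18 → σ.card = 21 → ∀ Z ⊆ T j, (∀ w ∈ Z, w ∉ N ∧ Disjoint σ (Bad w)) →
      (∀ w ∈ Z, ∀ w' ∈ Z, ∀ i, (qq τ : ℤ) ∣ w i - w' i) → Z.card ≤ c) := by
    intro j
    by_cases hj : j ∈ J
    · obtain ⟨N, h1, h2, Bad, h3, h4⟩ := h j hj
      exact ⟨N, Bad, fun _ => ⟨h1, h2, h3, h4⟩⟩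
    · exact ⟨∅, fun _ => ∅, fun h => absurd h hj⟩
  choose N Bad hNB using h'
  have hj' : ∀ w : Fin m → ℤ, ∃ j : Option ι, w ∈ S → ∃ i, j = some i ∧ i ∈ J ∧ w ∈ T i := by
    intro w
    by_cases hw : w ∈ S
    · obtain ⟨j, hj, hw'⟩ := hS w hw
      exact ⟨some j, fun _ => ⟨j, rfl, hj, hw'⟩⟩
    · exact ⟨none, fun h => absurd h hw⟩
  choose jj hjj using hj'
  refine ⟨S ∩ J.biUnion N, Finset.inter_subset_left, ?_, fun w => (jj w).elim ∅ fun j => Bad j w, ?_, ?_⟩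
  · refine (Finset.card_le_card Finset.inter_subset_right).trans (Finset.card_biUnion_le_card_mul _ _ _ fun j hj => (hNB j hj).2.1)
  · intro w hw hwN
    obtain ⟨j, e, hj, hwj⟩ := hjj w hw
    simp only [e, Option.elim]
    refine (hNB j hj).2.2.1 w hwj fun h => hwN ?_
    exact Finset.mem_inter.2 ⟨hw, Finset.mem_biUnion.2 ⟨j, hj, h⟩⟩
  · intro τ σ h1 h2 h3 h4 Z h5 h6 h7
    have hsub : Z ⊆ J.biUnion fun j => Z.filter fun w => jj w = some j := by
      intro w hw
      obtain ⟨j, e, hj, hwj⟩ := hjj w (h5 hw)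
      exact Finset.mem_biUnion.2 ⟨j, hj, Finset.mem_filter.2 ⟨hw, e⟩⟩
    refine (Finset.card_le_card hsub).trans (Finset.card_biUnion_le_card_mul _ _ _ fun j hj => ?_)
    refine (hNB j hj).2.2.2 τ σ h1 h2 h3 h4 _ ?_ ?_ ?_
    · intro w hw
      obtain ⟨hw, e⟩ := Finset.mem_filter.1 hw
      obtain ⟨j', e', hj', hwj'⟩ := hjj w (h5 hw)
      rw [e] at e'; cases e'; exact hwj'
    · intro w hw
      obtain ⟨hw, e⟩ := Finset.mem_filter.1 hw
      obtain ⟨ha, hb⟩ := h6 w hw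
      refine ⟨fun h => ha (Finset.mem_inter.2 ⟨h5 hw, Finset.mem_biUnion.2 ⟨j, hj, h⟩⟩), ?_⟩
      simpa only [e, Option.elim] using hb
    · intro w hw w' hw'
      exact h7 w (Finset.mem_filter.1 hw).1 w' (Finset.mem_filter.1 hw').1

theorem PC (M : MvPolynomial (Fin 2) ℚ) (δ : ℕ) (hδ : 2 ≤ δ) (hz : ZL M δ) (hirr : Irreducible M)
    (Y : ℕ) (hY : 48 ≤ Y) (hY2 : δ + 1 ≤ Y) (S : Finset (Fin 2 → ℤ)) (hB : ∀ z ∈ S, inBox (Y^41) z)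
    (hS : ∀ z ∈ S, eval (qz z) M = 0) (P : Finset ℕ) (hP : ∀ p ∈ P, p.Prime ∧ Y < p ∧ p ≤ 8*Y) :
    Good S P (δ^2) (bet 2 41 δ) ((δ*24) * (δ*(8*Y))^3) := by
  classical
  have bz : ∀ (g : MvPolynomial (Fin 2) ℚ), g.totalDegree ≤ δ → ¬ M ∣ g → ∀ T ⊆ S, (∀ z ∈ T, eval (qz z) g = 0) → T.card ≤ δ^2 := by
    intro g hg hn T hT h0
    have := bezout M g hirr hn (T.image qz) (by
      intro z hz
      obtain ⟨w, hw, rfl⟩ := Finset.mem_image.1 hz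
      exact ⟨hS w (hT hw), h0 w hw⟩)
    rw [Finset.card_image_of_injective _ qz_injective, hz.1] at this
    calc _ ≤ δ * g.totalDegree := this
      _ ≤ δ * δ := Nat.mul_le_mul_left _ hg
      _ = _ := by ring
  rcases hb_or M δ (by omega) hz hirr Y 41 hY2 S hB hS P (fun p hp => ⟨(hP p hp).1, (hP p hp).2.1⟩) with ⟨g, hg1, hg2, hg3⟩ | ⟨M', ⟨c, hc, hM'⟩, hbad⟩
  · exact Good.small _ _ _ _ _ (bz g hg1 hg2 S subset_rfl hg3)
  have hz' : ZL (toQ M') δ := by rw [hM']; exact hz.smul c hc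
  have hirr' : Irreducible (toQ M') := by rw [hM']; exact irr_smul hirr c hc
  have hS' : ∀ z ∈ S, eval z M' = 0 := by
    intro z hz
    have : ((eval z M' : ℤ) : ℚ) = 0 := by rw [← eval_toQ, hM', map_mul, hS z hz, mul_zero]
    exact_mod_cast this
  refine ⟨S.filter fun w => eval w (pderiv 0 M') = 0, Finset.filter_subset _ _, ?_,
    fun w => P.filter fun p : ℕ => (p:ℤ) ∣ eval w (pderiv 0 M'), ?_, ?_⟩
  · have h1 := not_dvd_pderiv M δ (by omega) hz
    refine bz (pderiv 0 M) ((totalDegree_pderiv_le M 0).trans (by rw [hz.1]; omega)) h1.2 _ (Finset.filter_subset _ _) ?_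
    intro z hzm
    have h2 := (Finset.mem_filter.1 hzm).2
    have h3 : eval (qz z) (toQ (pderiv 0 M')) = 0 := by rw [eval_toQ, h2]; simp
    rw [pderiv_toQ, hM', pderiv_C_mul, map_mul, eval_C] at h3
    exact (mul_eq_zero.1 h3).resolve_left hc
  · intro w hw hwN
    exact hbad w (hB w hw) fun h => hwN (Finset.mem_filter.2 ⟨hw, h⟩)
  · intro τ σ hτσ hσP hτ hσ Z hZ hZ2 hcong
    have hbadZ : ∀ w ∈ Z, ∀ p ∈ σ, ¬ (p:ℤ) ∣ eval w (pderiv 0 M') := by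
      intro w hw p hp hd
      exact Finset.disjoint_left.1 (hZ2 w hw).2 hp (Finset.mem_filter.2 ⟨hσP hp, hd⟩)
    set ρ := σ \ τ with hρ
    have hρc : ρ.card = 3 := by rw [hρ, Finset.card_sdiff_of_subset hτσ, hσ, hτ]
    have hcl := class_count (k := 1) M' δ Y (by rw [← totalDegree_toQ, hz'.1]) Z ρ
      (fun p hp => by
        have := hP p (hσP (Finset.sdiff_subset hp)); exact ⟨this.1, this.2.2⟩)
      (fun z hzZ p hp => ⟨by rw [hS' z (hZ hzZ)]; exact dvd_zero _, hbadZ z hzZ p (Finset.sdiff_subset hp)⟩)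
    rw [hρc, pow_one] at hcl
    refine (card_le_fiber Z (cl (qq ρ)) _ (δ*24) (fun z hz => Finset.mem_image_of_mem _ hz) ?_).trans (Nat.mul_le_mul_left _ hcl)
    intro t ht
    obtain ⟨w0, hw0, rfl⟩ := Finset.mem_image.1 ht
    have hcop : IsCoprime (qq τ : ℤ) (qq ρ : ℤ) := by
      rw [Nat.isCoprime_iff_coprime]
      apply qq_coprime
      · intro p hp
        rcases Finset.mem_union.1 hp with h | h
        · exact (hP p (hσP (hτσ h))).1
        · exact (hP p (hσP (Finset.sdiff_subset h))).1
      · exact Finset.disjoint_sdiff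
    have hmul : (qq σ : ℤ) = qq τ * qq ρ := by
      unfold qq
      rw [← Finset.prod_sdiff hτσ]; push_cast; rw [mul_comm]
    refine curve_class M' δ hδ hz' hirr' Y (qq σ) hY ?_ w0 ?_ _ ?_ ?_ ?_
    · rw [← hσ]; exact qq_ge σ Y fun p hp => (hP p (hσP hp)).2.1.le
    · exact coprime_qq σ (fun p hp => (hP p (hσP hp)).1) _ (hbadZ w0 hw0)
    · intro z hz; exact hB z (hZ (Finset.mem_filter.1 hz).1)
    · intro z hz i
      obtain ⟨hz1, hz2⟩ := Finset.mem_filter.1 hz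
      rw [hmul]
      exact hcop.mul_dvd (hcong z hz1 w0 hw0 i) ((cl_eq_iff _ _ _).1 hz2 i)
    · intro z hz; exact hS' z (hZ (Finset.mem_filter.1 hz).1)

end DG

namespace DG
open MvPolynomial

lemma totalDegree_aeval_le {K : Type*} [CommRing K] {σ τ : Type*} (f : MvPolynomial σ K) (g : σ → MvPolynomial τ K)
    (hg : ∀ i, (g i).totalDegree ≤ 1) : (aeval g f).totalDegree ≤ f.totalDegree := by
  rw [aeval_def, eval₂_eq]
  refine totalDegree_finsetSum_le fun s hs => ?_
  refine (totalDegree_mul _ _).trans ?_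
  rw [show (algebraMap K (MvPolynomial τ K)) (coeff s f) = C (coeff s f) from rfl, totalDegree_C, zero_add]
  refine (totalDegree_finsetProd _ _).trans ?_
  calc _ ≤ ∑ i ∈ s.support, s i := Finset.sum_le_sum fun i _ => by
        refine (totalDegree_pow _ _).trans ?_
        nlinarith [hg i]
    _ ≤ _ := le_totalDegree hs

lemma coeff_aff {K : Type*} [Field K] {k : ℕ} (f : MvPolynomial (Fin k) K) (d : ℕ) (hd : f.totalDegree ≤ d) (a b : Fin k → K) :
    (aeval (fun i => Polynomial.C (a i) * Polynomial.X + Polynomial.C (b i)) f).coeff d = eval a (homogeneousComponent d f) := by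
  have hdeg : ∀ i, (Polynomial.C (a i) * Polynomial.X + Polynomial.C (b i)).natDegree ≤ 1 := fun i =>
    Polynomial.natDegree_linear_le
  have key : ∀ (s : Fin k →₀ ℕ) (t : Finset (Fin k)), 
      (∏ i ∈ t, (Polynomial.C (a i) * Polynomial.X + Polynomial.C (b i))^(s i)).natDegree ≤ ∑ i ∈ t, s i ∧
      (∏ i ∈ t, (Polynomial.C (a i) * Polynomial.X + Polynomial.C (b i))^(s i)).coeff (∑ i ∈ t, s i) = ∏ i ∈ t, a i ^ s i := by
    intro s t
    induction t using Finset.induction_on with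
    | empty => simp
    | insert i t hi ih =>
      rw [Finset.prod_insert hi, Finset.sum_insert hi, Finset.prod_insert hi]
      have h1 : ((Polynomial.C (a i) * Polynomial.X + Polynomial.C (b i))^(s i)).natDegree ≤ s i := by
        refine Polynomial.natDegree_pow_le.trans ?_
        nlinarith [hdeg i]
      refine ⟨Polynomial.natDegree_mul_le_of_le h1 ih.1, ?_⟩
      rw [Polynomial.coeff_mul_add_eq_of_natDegree_le h1 ih.1, ih.2]
      congr 1
      have := Polynomial.coeff_pow_of_natDegree_le (m := s i) (hdeg i)
      rw [mul_one] at this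
      rw [this]; simp
  rw [aeval_def, eval₂_eq', homogeneousComponent_apply, Polynomial.finsetSum_coeff, map_sum, Finset.sum_filter]
  refine Finset.sum_congr rfl fun s hs => ?_
  have hsd := (totalDegree_le_iff_degree f d).1 hd s hs
  have hsum : s.degree = ∑ i, s i := Finsupp.degree_eq_sum s
  obtain ⟨k1, k2⟩ := key s Finset.univ
  rw [← hsum] at k1 k2
  rw [show algebraMap K (Polynomial K) (coeff s f) = Polynomial.C (coeff s f) from rfl, Polynomial.coeff_C_mul]
  split_ifs with h
  · rw [← h, k2, eval_monomial, Finsupp.prod_fintype _ _ (by simp)]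
  · rw [Polynomial.coeff_eq_zero_of_natDegree_lt (by omega), mul_zero]

lemma coeff_single_eq {K : Type*} [Field K] {k : ℕ} (f : MvPolynomial (Fin (k+1)) K) (d : ℕ) :
    coeff (Finsupp.single 0 d) f = eval (Pi.single 0 1) (homogeneousComponent d f) := by
  classical
  rw [homogeneousComponent_apply, map_sum]
  have : ∀ s : Fin (k+1) →₀ ℕ, s.degree = d → eval (Pi.single 0 1) (monomial s (coeff s f)) = if s = Finsupp.single 0 d then coeff s f else 0 := by
    intro s hs
    rw [eval_monomial, Finsupp.prod_fintype _ _ (by simp), Fin.prod_univ_succ]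
    simp only [Pi.single_eq_same, one_pow, one_mul]
    split_ifs with h
    · rw [h]; simp
    · rw [Finset.prod_eq_zero_iff.2, mul_zero]
      by_contra! hcon
      apply h
      ext i
      have hz : ∀ j : Fin k, s j.succ = 0 := by
        intro j
        have := hcon j (Finset.mem_univ _)
        by_contra h0
        apply this
        simp [h0]
      refine Fin.cases ?_ (fun j => ?_) i
      · rw [Finsupp.degree_eq_sum, Fin.sum_univ_succ] at hs
        simp only [hz, Finset.sum_const_zero, add_zero] at hs
        simp [hs]
      · simp [hz]
  rw [Finset.sum_congr rfl (fun s hs => this s (Finset.mem_filter.1 hs).2), Finset.sum_ite_eq']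
  split_ifs with h
  · rfl
  · simp only [Finset.mem_filter, mem_support_iff, Finsupp.degree_single, and_true, not_not] at h
    exact h

lemma ZL.of_le {K : Type*} [Field K] {k : ℕ} {f : MvPolynomial (Fin (k+1)) K} {d : ℕ} (hd : f.totalDegree ≤ d)
    (h : eval (Pi.single 0 1) (homogeneousComponent d f) ≠ 0) : ZL f d := by
  rw [← coeff_single_eq] at h
  refine ⟨le_antisymm hd ?_, h⟩
  have := le_totalDegree (mem_support_iff.2 h)
  simpa using this

lemma ZL.eval_ne {K : Type*} [Field K] {k : ℕ} {f : MvPolynomial (Fin (k+1)) K} {d : ℕ} (h : ZL f d) :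
    eval (Pi.single 0 1) (homogeneousComponent d f) ≠ 0 := by
  rw [← coeff_single_eq]; exact h.2

/-- top form under an affine substitution -/
lemma top_aeval {K : Type*} [Field K] {k m : ℕ} (f : MvPolynomial (Fin k) K) (d : ℕ) (hd : f.totalDegree ≤ d)
    (g : Fin k → MvPolynomial (Fin m) K) (hg : ∀ i, (g i).totalDegree ≤ 1) (v : Fin m → K) :
    eval v (homogeneousComponent d (aeval g f)) = eval (fun i => eval v (homogeneousComponent 1 (g i))) (homogeneousComponent d f) := by
  rw [← coeff_aff (aeval g f) d ((totalDegree_aeval_le f g hg).trans hd) v 0,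
    ← coeff_aff f d hd _ (fun i => eval 0 (g i))]
  congr 1
  rw [← AlgHom.comp_apply]
  congr 1
  apply MvPolynomial.algHom_ext
  intro i
  rw [AlgHom.comp_apply, aeval_X, aeval_X]
  set G := aeval (fun i => Polynomial.C (v i) * Polynomial.X + Polynomial.C ((0 : Fin m → K) i)) (g i) with hG
  have hGd : G.natDegree ≤ 1 := by
    rw [hG, aeval_def, eval₂_eq]
    refine Polynomial.natDegree_sum_le_of_forall_le _ _ fun s hs => ?_
    refine (Polynomial.natDegree_C_mul_le _ _).trans ((Polynomial.natDegree_prod_le _ _).trans ?_)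
    calc _ ≤ ∑ i ∈ s.support, s i := Finset.sum_le_sum fun i _ => by
          refine Polynomial.natDegree_pow_le.trans ?_
          have : (Polynomial.C (v i) * Polynomial.X + Polynomial.C ((0 : Fin m → K) i)).natDegree ≤ 1 := Polynomial.natDegree_linear_le
          nlinarith
      _ ≤ 1 := (totalDegree_le_iff_degree _ _).1 (hg i) s hs
  rw [Polynomial.eq_X_add_C_of_natDegree_le_one hGd]
  congr 3
  · exact coeff_aff (g i) 1 (hg i) v 0
  · rw [Polynomial.coeff_zero_eq_eval_zero, hG, ← Polynomial.coe_evalRingHom, ← AlgHom.coe_toRingHom, ← RingHom.comp_apply]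
    rw [show eval (0 : Fin m → K) (g i) = (eval (0 : Fin m → K)) (g i) from rfl]
    congr 1
    apply MvPolynomial.ringHom_ext <;> intros <;> simp

/-- degree one polynomials are affine -/
lemma affine_eval {K : Type*} [Field K] {k : ℕ} (f : MvPolynomial (Fin k) K) (hd : f.totalDegree ≤ 1) (a b : Fin k → K) (t : K)
    (ha : eval a f = 0) (hb : eval b f = 0) : eval (fun i => a i + t * (b i - a i)) f = 0 := by
  set G := aeval (fun i => Polynomial.C (b i - a i) * Polynomial.X + Polynomial.C (a i)) f with hG
  have hev : ∀ t, G.eval t = eval (fun i => a i + t * (b i - a i)) f := by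
    intro t
    rw [hG, ← Polynomial.coe_evalRingHom, ← AlgHom.coe_toRingHom, ← RingHom.comp_apply]
    congr 1
    apply MvPolynomial.ringHom_ext
    · intro; simp
    · intro i; simp; ring
  have hGd : G.natDegree ≤ 1 := by
    rw [hG, aeval_def, eval₂_eq]
    refine Polynomial.natDegree_sum_le_of_forall_le _ _ fun s hs => ?_
    refine (Polynomial.natDegree_C_mul_le _ _).trans ((Polynomial.natDegree_prod_le _ _).trans ?_)
    calc _ ≤ ∑ i ∈ s.support, s i := Finset.sum_le_sum fun i _ => by
          refine Polynomial.natDegree_pow_le.trans ?_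
          have : (Polynomial.C (b i - a i) * Polynomial.X + Polynomial.C (a i)).natDegree ≤ 1 := Polynomial.natDegree_linear_le
          nlinarith
      _ ≤ 1 := (totalDegree_le_iff_degree _ _).1 hd s hs
  have e := Polynomial.eq_X_add_C_of_natDegree_le_one hGd
  have h0 := hev 0
  have h1 := hev 1
  simp only [zero_mul, add_zero, one_mul, add_sub_cancel] at h0 h1
  rw [ha] at h0; rw [hb] at h1
  rw [e] at h0 h1
  simp only [Polynomial.eval_add, Polynomial.eval_mul, Polynomial.eval_C, Polynomial.eval_X, mul_zero, zero_add, mul_one] at h0 h1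
  rw [← hev, e, h0]
  rw [h0, add_zero] at h1
  rw [h1]; simp

lemma td_pos_of_irr {K : Type*} [Field K] {σ : Type*} {f : MvPolynomial σ K} (h : Irreducible f) : 1 ≤ f.totalDegree := by
  by_contra hcon
  have h0 : f.totalDegree = 0 := by omega
  rw [totalDegree_eq_zero_iff_eq_C] at h0
  apply h.not_isUnit
  rw [h0]
  refine (isUnit_iff_ne_zero.2 ?_).map C
  intro h1; apply h.ne_zero; rw [h0, h1]; simp

lemma exists_factors {K : Type*} [Field K] {k : ℕ} (g : MvPolynomial (Fin k) K) (hg : g ≠ 0) :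
    ∃ J : Finset (MvPolynomial (Fin k) K), J.card ≤ g.totalDegree ∧ (∀ q ∈ J, Irreducible q ∧ q ∣ g) ∧
      ∀ x, eval x g = 0 → ∃ q ∈ J, eval x q = 0 := by
  classical
  induction g using WfDvdMonoid.induction_on_irreducible with
  | zero => exact absurd rfl hg
  | unit u hu => 
    refine ⟨∅, by simp, by simp, fun x hx => absurd hx (hu.map (eval x)).ne_zero⟩
  | mul a p ha hp ih =>
    obtain ⟨J, h1, h2, h3⟩ := ih ha
    refine ⟨insert p J, ?_, ?_, ?_⟩
    · have := td_pos_of_irr hp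
      rw [totalDegree_mul_of_isDomain hp.ne_zero ha]
      have := Finset.card_insert_le p J
      omega
    · intro q hq
      rcases Finset.mem_insert.1 hq with rfl | hq
      · exact ⟨hp, dvd_mul_right _ _⟩
      · exact ⟨(h2 q hq).1, (h2 q hq).2.trans (dvd_mul_left _ _)⟩
    · intro x hx
      rw [map_mul, mul_eq_zero] at hx
      rcases hx with hx | hx
      · exact ⟨p, Finset.mem_insert_self _ _, hx⟩
      · obtain ⟨q, hq, hx⟩ := h3 x hx
        exact ⟨q, Finset.mem_insert_of_mem hq, hx⟩

lemma ZL.of_dvd {K : Type*} [Field K] {k : ℕ} {f g : MvPolynomial (Fin (k+1)) K} {d : ℕ} (h : ZL f d) (hg : g ∣ f) :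
    ZL g g.totalDegree := by
  obtain ⟨w, rfl⟩ := hg
  have hne : g * w ≠ 0 := by intro h0; apply h.2; rw [h0]; simp
  have hg0 := left_ne_zero_of_mul hne
  have hw0 := right_ne_zero_of_mul hne
  refine ⟨rfl, ?_⟩
  have h1 := h.natDegree
  rw [map_mul, Polynomial.natDegree_mul (by simpa using hg0) (by simpa using hw0)] at h1
  have h2 := h.1
  rw [totalDegree_mul_of_isDomain hg0 hw0] at h2
  have h3 := natDegree_fse_le g
  have h4 := natDegree_fse_le w
  have h5 : (finSuccEquiv K k g).natDegree = g.totalDegree := by omega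
  have h6 : (finSuccEquiv K k g).coeff g.totalDegree ≠ 0 := by
    rw [← h5]; exact Polynomial.leadingCoeff_ne_zero.2 (by simpa using hg0)
  have h7 := totalDegree_coeff_finSuccEquiv_add_le g g.totalDegree h6
  have h8 : ((finSuccEquiv K k g).coeff g.totalDegree).totalDegree = 0 := by omega
  rw [totalDegree_eq_zero_iff_eq_C] at h8
  intro h0
  apply h6
  rw [h8, finSuccEquiv_coeff_coeff]
  rw [show Finsupp.cons g.totalDegree (0 : Fin k →₀ ℕ) = Finsupp.single 0 g.totalDegree by
    ext i; refine Fin.cases ?_ (fun j => ?_) i <;> simp, h0]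
  simp

end DG

namespace DG
open MvPolynomial

lemma eval_hom_smul {K : Type*} [Field K] {k : ℕ} {h : MvPolynomial (Fin k) K} {d : ℕ} (hh : h.IsHomogeneous d) (r : K) (a : Fin k → K) :
    eval (fun i => r * a i) h = r^d * eval a h := by
  rw [eval_eq', eval_eq', Finset.mul_sum]
  refine Finset.sum_congr rfl fun s hs => ?_
  have h1 : ∑ i, s i = d := by
    rw [← Finsupp.degree_eq_sum]
    have := hh (mem_support_iff.1 hs)
    rw [← this, Finsupp.degree_eq_weight_one]; rfl
  simp only [mul_pow]
  rw [Finset.prod_mul_distrib, Finset.prod_pow_eq_pow_sum, h1]; ring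

lemma exists_small {K : Type*} [Field K] [CharZero K] {k : ℕ} (p : MvPolynomial (Fin k) K) (hp : p ≠ 0) (D : ℕ) (hD : p.totalDegree ≤ D) :
    ∃ w : Fin k → ℕ, (∀ i, w i ≤ D) ∧ eval (fun i => (w i : K)) p ≠ 0 := by
  classical
  by_contra! hcon
  apply hp
  refine eq_zero_of_eval_zero_at_prod_finset p (fun _ => (Finset.range (D+1)).image (Nat.cast : ℕ → K)) ?_ ?_
  · intro i
    rw [Finset.card_image_of_injective _ Nat.cast_injective, Finset.card_range]
    have := degreeOf_le_totalDegree p i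
    omega
  · intro x hx
    have : ∀ i, ∃ n : ℕ, n ≤ D ∧ (n:K) = x i := by
      intro i
      obtain ⟨n, hn, e⟩ := Finset.mem_image.1 (hx i)
      exact ⟨n, by simpa [Nat.lt_succ_iff] using hn, e⟩
    choose w hw e using this
    rw [← hcon w hw]
    congr 2
    ext i; exact (e i).symm

lemma exists_small_hom {K : Type*} [Field K] [CharZero K] {k : ℕ} (h : MvPolynomial (Fin k) K) (h0 : h ≠ 0) (d D : ℕ)
    (hh : h.IsHomogeneous d) (hD : d ≤ D) (hD1 : 1 ≤ D) (i0 : Fin k) :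
    ∃ w : Fin k → ℕ, w i0 = 1 ∧ (∀ i, w i ≤ D) ∧ eval (fun i => (w i : K)) h ≠ 0 := by
  classical
  let g : Fin k → MvPolynomial (Fin k) K := fun i => if i = i0 then 1 else X i
  have hev : ∀ a : Fin k → K, eval a (aeval g h) = eval (fun i => if i = i0 then 1 else a i) h := by
    intro a
    rw [← AlgHom.coe_toRingHom, ← RingHom.comp_apply]
    congr 1
    apply MvPolynomial.ringHom_ext
    · intro; simp
    · intro i; simp only [g, RingHom.comp_apply, AlgHom.coe_toRingHom, aeval_X, eval_X]
      split_ifs <;> simp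
  have hp : aeval g h ≠ 0 := by
    have h1 : (X i0 * h : MvPolynomial (Fin k) K) ≠ 0 := mul_ne_zero (X_ne_zero _) h0
    obtain ⟨w, -, hw⟩ := exists_small _ h1 _ le_rfl
    rw [map_mul, eval_X] at hw
    have hw1 := left_ne_zero_of_mul hw
    have hw2 := right_ne_zero_of_mul hw
    intro hcon
    have := hev (fun i => (w i0 : K)⁻¹ * w i)
    rw [hcon, map_zero] at this
    apply hw2
    have h2 : (fun i => if i = i0 then 1 else (w i0 : K)⁻¹ * w i) = fun i => (w i0 : K)⁻¹ * w i := by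
      ext i; split_ifs with e
      · rw [e, inv_mul_cancel₀ hw1]
      · rfl
    rw [h2, eval_hom_smul hh] at this
    exact (mul_eq_zero.1 this.symm).resolve_left (pow_ne_zero _ (inv_ne_zero hw1))
  have hd : (aeval g h).totalDegree ≤ D := by
    refine (totalDegree_aeval_le _ _ ?_).trans ((hh.totalDegree_le).trans hD)
    intro i; simp only [g]; split_ifs <;> simp
  obtain ⟨w, hw1, hw2⟩ := exists_small _ hp D hd
  refine ⟨fun i => if i = i0 then 1 else w i, by simp, ?_, ?_⟩
  · intro i; dsimp only; split_ifs
    · exact hD1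
    · exact hw1 i
  · rw [hev] at hw2
    have e : (fun i => (((if i = i0 then 1 else w i : ℕ)) : K)) = fun i => if i = i0 then 1 else (w i : K) := by
      ext i; split_ifs <;> simp
    rw [e]; exact hw2

lemma hom1_X {K : Type*} [Field K] {k : ℕ} (i : Fin k) : homogeneousComponent 1 (X i : MvPolynomial (Fin k) K) = X i :=
  homogeneousComponent_of_mem ((mem_homogeneousSubmodule _ _).2 (isHomogeneous_X _ _)) |>.trans (by simp)

lemma hom1_CX {K : Type*} [Field K] {k : ℕ} (c : K) (i : Fin k) : homogeneousComponent 1 (C c * X i : MvPolynomial (Fin k) K) = C c * X i := by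
  rw [homogeneousComponent_C_mul, hom1_X]

lemma hom1_C {K : Type*} [Field K] {k : ℕ} (c : K) : homogeneousComponent 1 (C c : MvPolynomial (Fin k) K) = 0 :=
  homogeneousComponent_eq_zero _ _ (by simp)

end DG

namespace DG
open MvPolynomial

/-- `w` lies on a line of small direction contained in `f = 0` -/
def onLine (f : MvPolynomial (Fin 3) ℤ) (B : ℕ) (w : Fin 3 → ℤ) : Prop :=
  ∃ v : Fin 3 → ℤ, v ≠ 0 ∧ (∀ a : ℤ, (∀ i, a ∣ v i) → IsUnit a) ∧ inBox (2*B) v ∧ ∀ t : ℤ, eval (fun i => w i + t * v i) f = 0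

lemma qz_tail' (w : Fin 3 → ℤ) : (Fin.tail (qz w) : Fin 2 → ℚ) = qz (Fin.tail w : Fin 2 → ℤ) := rfl

lemma onLine_of_two (f : MvPolynomial (Fin 3) ℤ) (B : ℕ) (w1 w2 : Fin 3 → ℤ) (hne : w1 ≠ w2) (h1 : inBox B w1) (h2 : inBox B w2)
    (h : ∀ t : ℚ, eval (fun i => qz w1 i + t * (qz w2 i - qz w1 i)) (toQ f) = 0) : onLine f B w1 := by
  obtain ⟨g, hg, hgcd⟩ := Finset.extract_gcd (s := (Finset.univ : Finset (Fin 3))) (fun i => w2 i - w1 i) ⟨0, Finset.mem_univ _⟩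
  set c := Finset.univ.gcd (fun i => w2 i - w1 i) with hc
  have hg' : ∀ i, w2 i - w1 i = c * g i := fun i => hg i (Finset.mem_univ _)
  have hc0 : c ≠ 0 := by
    intro h0
    apply hne
    ext i
    have := hg' i; rw [h0, zero_mul] at this; omega
  refine ⟨g, ?_, ?_, ?_, ?_⟩
  · rintro rfl
    apply hne
    ext i
    have := hg' i; simp at this; omega
  · intro a ha
    rw [isUnit_iff_dvd_one, ← hgcd]
    exact Finset.dvd_gcd fun i _ => ha i
  · intro i
    have a1 := h1 i
    have a2 := h2 i
    have a3 : |g i| ≤ |w2 i - w1 i| := by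
      rw [hg' i, abs_mul]
      have : 1 ≤ |c| := Int.one_le_abs hc0
      nlinarith [abs_nonneg (g i)]
    have a4 : |w2 i - w1 i| ≤ |w2 i| + |w1 i| := abs_sub _ _
    push_cast
    linarith
  · intro t
    have h3 := h ((t:ℚ)/c)
    have e : (fun i => qz w1 i + (t:ℚ)/c * (qz w2 i - qz w1 i)) = qz (fun i => w1 i + t * g i) := by
      ext i
      have := hg' i
      have hq : (w2 i : ℚ) - w1 i = c * g i := by exact_mod_cast this
      have hcq : (c:ℚ) ≠ 0 := by exact_mod_cast hc0
      simp only [qz]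
      rw [hq]; push_cast
      field_simp
    rw [e, eval_toQ] at h3
    exact_mod_cast h3

/-- shear `Q(x,y)` to `Q(u+λv, v)` -/
noncomputable def shear (l : ℚ) : MvPolynomial (Fin 2) ℚ ≃ₐ[ℚ] MvPolynomial (Fin 2) ℚ :=
  AlgEquiv.ofAlgHom (aeval ![X 1 + C l * X 0, X 0]) (aeval ![X 1, X 0 - C l * X 1])
    (by
      apply MvPolynomial.algHom_ext
      intro i
      fin_cases i <;> simp [algebraMap_eq])
    (by
      apply MvPolynomial.algHom_ext
      intro i
      fin_cases i <;> simp [algebraMap_eq])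

lemma td_lin {k : ℕ} (a b c : ℚ) (i j : Fin k) : (C a * X i + C b * X j + C c : MvPolynomial (Fin k) ℚ).totalDegree ≤ 1 := by
  refine (totalDegree_add _ _).trans (max_le ((totalDegree_add _ _).trans (max_le ?_ ?_)) (by simp))
  · refine (totalDegree_mul _ _).trans ?_; simp
  · refine (totalDegree_mul _ _).trans ?_; simp

lemma deg_one_eq (f : MvPolynomial (Fin 2) ℚ) (h : f.totalDegree ≤ 1) :
    f = C (coeff (Finsupp.single 0 1) f) * X 0 + C (coeff (Finsupp.single 1 1) f) * X 1 + C (coeff 0 f) := by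
  ext s
  simp only [coeff_add, coeff_C_mul, coeff_X, coeff_C]
  have h10 : (Finsupp.single 1 1 : Fin 2 →₀ ℕ) ≠ Finsupp.single 0 1 := by
    intro e; have := DFunLike.congr_fun e 0; simp at this
  by_cases h0 : s = 0
  · subst h0; simp
  by_cases h1 : s = Finsupp.single 0 1
  · subst h1; simp [h10, Ne.symm h0]
  by_cases h2 : s = Finsupp.single 1 1
  · subst h2; simp [h10.symm, Ne.symm h0]
  rw [if_neg (Ne.symm h1), if_neg (Ne.symm h2), if_neg (Ne.symm h0)]
  simp only [mul_zero, add_zero]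
  by_contra hs
  have hd := (totalDegree_le_iff_degree f 1).1 h s (mem_support_iff.2 hs)
  rw [Finsupp.degree_eq_sum, Fin.sum_univ_two] at hd
  rcases Nat.eq_zero_or_pos (s 0) with a | a <;> rcases Nat.eq_zero_or_pos (s 1) with b | b
  · apply h0; ext i; fin_cases i <;> simp [a, b]
  · apply h2; ext i; fin_cases i
    · simp [a]
    · simp; omega
  · apply h1; ext i; fin_cases i
    · simp; omega
    · simp [b]
  · omega

lemma top_ne_zero {K : Type*} [Field K] {k : ℕ} {Q : MvPolynomial (Fin k) K} (h : Q ≠ 0) :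
    homogeneousComponent Q.totalDegree Q ≠ 0 := by
  intro h0
  obtain ⟨s, hs, hsd⟩ := Finset.exists_mem_eq_sup Q.support (support_nonempty.2 h) (fun s => s.sum fun _ e => e)
  have := congrArg (coeff s) h0
  rw [coeff_homogeneousComponent, if_pos (by rw [totalDegree, hsd]; rfl)] at this
  exact (mem_support_iff.1 hs) (by simpa using this)

lemma exists_shear (Q : MvPolynomial (Fin 2) ℚ) (hQ : Irreducible Q) :
    ∃ l : ℕ, l ≤ Q.totalDegree ∧ ZL (shear l Q) Q.totalDegree ∧ Irreducible (shear l Q) ∧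
      ∀ w : Fin 2 → ℚ, eval ![w 1, w 0 - l * w 1] (shear l Q) = eval w Q := by
  have hpos := td_pos_of_irr hQ
  set δ := Q.totalDegree with hδ
  have hT0 : homogeneousComponent δ Q ≠ 0 := top_ne_zero hQ.ne_zero
  obtain ⟨w, hw1, hwD, hw⟩ := exists_small_hom _ hT0 δ δ (homogeneousComponent_isHomogeneous _ _) le_rfl hpos 1
  have hsh : ∀ l : ℚ, shear l Q = aeval ![X 1 + C l * X 0, X 0] Q := fun l => rfl
  have hg : ∀ l : ℚ, ∀ i : Fin 2, ((![X 1 + C l * X 0, X 0] : Fin 2 → MvPolynomial (Fin 2) ℚ) i).totalDegree ≤ 1 := by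
    intro l i
    fin_cases i
    · have := td_lin (k := 2) 1 l 0 1 0
      simpa using this
    · simp
  refine ⟨w 0, hwD 0, ZL.of_le ?_ ?_, (MulEquiv.irreducible_iff (shear (w 0))).2 hQ, ?_⟩
  · rw [hsh]; exact totalDegree_aeval_le _ _ (hg _)
  · rw [hsh, top_aeval _ _ le_rfl _ (hg _)]
    have e : (fun i => eval (Pi.single 0 1) (homogeneousComponent 1 ((![X 1 + C ((w 0 : ℕ):ℚ) * X 0, X 0] : Fin 2 → MvPolynomial (Fin 2) ℚ) i)))
        = fun i => ((w i : ℕ) : ℚ) := by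
      ext i
      fin_cases i
      · show eval (Pi.single 0 1) (homogeneousComponent 1 (X 1 + C ((w 0 : ℕ):ℚ) * X 0)) = _
        rw [map_add, hom1_X, hom1_CX]; simp
      · show eval (Pi.single 0 1) (homogeneousComponent 1 (X 0)) = _
        rw [hom1_X]; simp [hw1]
    rw [e]; exact hw
  · intro x
    rw [hsh, ← AlgHom.coe_toRingHom, ← RingHom.comp_apply]
    congr 1
    apply MvPolynomial.ringHom_ext
    · intro; simp
    · intro i; fin_cases i <;> simp


lemma fiber_tail (f : MvPolynomial (Fin 3) ℤ) (d : ℕ) (hz : ZL (toQ f) d) (S : Finset (Fin 3 → ℤ)) (hS : ∀ w ∈ S, eval w f = 0)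
    (t : Fin 2 → ℤ) : (S.filter fun w => (Fin.tail w : Fin 2 → ℤ) = t).card ≤ d :=
  zfiber (toQ f) d hz t _ (fun z hz => (Finset.mem_filter.1 hz).2)
    fun z hz => by rw [eval_toQ, hS z (Finset.mem_filter.1 hz).1]; simp

theorem PQ (f : MvPolynomial (Fin 3) ℤ) (d : ℕ) (hd : 1 ≤ d) (hz : ZL (toQ f) d) (Q : MvPolynomial (Fin 2) ℚ) (hQ : Irreducible Q)
    (ρ : ℕ) (hρ : Q.totalDegree ≤ ρ) (hdρ : d ≤ ρ) (Y : ℕ) (hY : 48 ≤ Y) (hYρ : ρ + 1 ≤ Y) (S : Finset (Fin 3 → ℤ))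
    (hB : ∀ w ∈ S, inBox (Y^40) w) (hS : ∀ w ∈ S, eval w f = 0) (hSQ : ∀ w ∈ S, eval (qz (Fin.tail w : Fin 2 → ℤ)) Q = 0)
    (hL : ∀ w ∈ S, ¬ onLine f (Y^40) w) (P : Finset ℕ) (hP : ∀ p ∈ P, p.Prime ∧ Y < p ∧ p ≤ 8*Y) :
    Good S P (ρ*ρ^2) (bet 2 41 ρ) (ρ * ((ρ*24) * (ρ*(8*Y))^3)) := by
  classical
  obtain ⟨l, hl, hzl, hirr, hev⟩ := exists_shear Q hQ
  have hpos := td_pos_of_irr hQ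
  set δ := Q.totalDegree with hδ
  set Q' := shear l Q with hQ'
  have betm : ∀ a b : ℕ, a ≤ b → bet 2 41 a ≤ bet 2 41 b := by
    intro a b h; unfold bet; gcongr
  have boxs : ∀ x y : ℤ, |x| ≤ ((Y^40 : ℕ) : ℤ) → |y| ≤ ((Y^40 : ℕ) : ℤ) → |x - l * y| ≤ ((Y^41 : ℕ) : ℤ) := by
    intro x y hx hy
    have h1 : |x - l*y| ≤ |x| + l * |y| := by
      refine (abs_sub _ _).trans ?_
      rw [abs_mul, Nat.abs_cast]
    have h2 : ((Y^41 : ℕ) : ℤ) = Y * ((Y^40 : ℕ) : ℤ) := by push_cast; ring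
    have h3 : (l:ℤ) + 1 ≤ Y := by exact_mod_cast (by omega : l + 1 ≤ Y)
    rw [h2]
    nlinarith [abs_nonneg y, abs_nonneg x]
  have box0 : ∀ x : ℤ, |x| ≤ ((Y^40 : ℕ) : ℤ) → |x| ≤ ((Y^41 : ℕ) : ℤ) := by
    intro x hx
    have : Y^40 ≤ Y^41 := Nat.pow_le_pow_right (by omega) (by norm_num)
    exact hx.trans (by exact_mod_cast this)
  by_cases hδ2 : 2 ≤ δ
  · -- genuine plane curve
    let φ : (Fin 3 → ℤ) → Fin 2 → ℤ := fun w => ![w 2, w 1 - l * w 2]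
    have h0 : ∀ w ∈ S.image φ, eval (qz w) Q' = 0 := by
      intro t ht
      obtain ⟨w, hw, rfl⟩ := Finset.mem_image.1 ht
      have := hSQ w hw
      rw [← hev] at this
      have e : qz (φ w) = ![qz (Fin.tail w : Fin 2 → ℤ) 1, qz (Fin.tail w : Fin 2 → ℤ) 0 - l * qz (Fin.tail w : Fin 2 → ℤ) 1] := by
        ext i; fin_cases i <;> simp [qz, φ, Fin.tail]
      rw [e]; exact this
    have g := PC Q' δ hδ2 hzl hirr Y hY (by omega) (S.image φ) (by
      intro t ht
      obtain ⟨w, hw, rfl⟩ := Finset.mem_image.1 ht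
      intro i
      fin_cases i
      · exact box0 _ (hB w hw 2)
      · exact boxs _ _ (hB w hw 1) (hB w hw 2)) h0 P hP
    have g2 := g.of_map (S := S) φ (fun w hw => Finset.mem_image_of_mem _ hw) d (by
      intro t
      refine le_trans (Finset.card_le_card ?_) (fiber_tail f d hz S hS ![t 1 + l * t 0, t 0])
      intro w hw
      obtain ⟨hw', rfl⟩ := Finset.mem_filter.1 hw
      refine Finset.mem_filter.2 ⟨hw', ?_⟩
      ext i; fin_cases i <;> simp [φ, Fin.tail]) (by
      intro q w w' h i
      fin_cases i
      · exact h 2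
      · have e : φ w 1 - φ w' 1 = (w 1 - w' 1) - l * (w 2 - w' 2) := by simp [φ]; ring
        show q ∣ φ w 1 - φ w' 1
        rw [e]
        exact dvd_sub (h 1) (dvd_mul_of_dvd_right (h 2) _))
    refine g2.mono ?_ (betm _ _ hρ) ?_ <;> gcongr
  · -- a line in the plane
    have hδ1 : δ = 1 := by omega
    set q0 := coeff (Finsupp.single 0 1) Q' with hq0
    have hq0' : q0 ≠ 0 := by have := hzl.2; rw [hδ1] at this; exact this
    set q1 := coeff (Finsupp.single 1 1) Q' with hq1
    set q2 := coeff 0 Q' with hq2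
    have hQe : Q' = C q0 * X 0 + C q1 * X 1 + C q2 := deg_one_eq _ (by rw [hzl.1, hδ1])
    let sub : Fin 3 → MvPolynomial (Fin 2) ℚ := ![X 0, C 1 * X 1 + C ((l:ℚ) * (-q1/q0)) * X 1 + C ((l:ℚ) * (-q2/q0)), C (-q1/q0) * X 1 + C (-q2/q0)]
    have hsub : ∀ i, (sub i).totalDegree ≤ 1 := by
      intro i
      fin_cases i
      · simp [sub]
      · exact td_lin _ _ _ _ _
      · have := td_lin (k := 2) (-q1/q0) 0 (-q2/q0) 1 1
        simpa [sub] using this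
    set M := aeval sub (toQ f) with hM
    have hMz : ZL M d := by
      refine ZL.of_le ((totalDegree_aeval_le _ _ hsub).trans hz.1.le) ?_
      rw [hM, top_aeval _ _ hz.1.le _ hsub]
      have e : (fun i => eval (Pi.single 0 1) (homogeneousComponent 1 (sub i))) = Pi.single 0 1 := by
        ext i
        fin_cases i
        · show eval (Pi.single 0 1) (homogeneousComponent 1 (X 0)) = _
          rw [hom1_X]; simp
        · show eval (Pi.single 0 1) (homogeneousComponent 1 (C 1 * X 1 + C ((l:ℚ) * (-q1/q0)) * X 1 + C ((l:ℚ) * (-q2/q0)))) = _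
          rw [map_add (homogeneousComponent 1), map_add (homogeneousComponent 1), hom1_CX, hom1_CX, hom1_C]; simp
        · show eval (Pi.single 0 1) (homogeneousComponent 1 (C (-q1/q0) * X 1 + C (-q2/q0))) = _
          rw [map_add, hom1_CX, hom1_C]; simp
      rw [e]; exact hz.eval_ne
    let ψ : (Fin 3 → ℚ) → Fin 2 → ℚ := fun w => ![w 0, w 1 - l * w 2]
    have hMe : ∀ w : Fin 3 → ℚ, eval (Fin.tail w : Fin 2 → ℚ) Q = 0 → eval (ψ w) M = eval w (toQ f) := by
      intro w hw
      rw [← hev, hQe] at hw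
      simp only [map_add, map_mul, eval_C, eval_X, Fin.tail] at hw
      have hw2 : w 2 = (-q1/q0) * (w 1 - l * w 2) + (-q2/q0) := by
        have : q0 * w 2 + q1 * (w 1 - l * w 2) + q2 = 0 := by simpa using hw
        field_simp
        linarith
      rw [hM, ← AlgHom.coe_toRingHom, ← RingHom.comp_apply]
      congr 1
      apply MvPolynomial.ringHom_ext
      · intro; simp
      · intro i; fin_cases i
        · simp [sub, ψ]
        · simp only [sub, ψ]; simp; linear_combination (-(l:ℚ)) * hw2
        · simp only [sub, ψ]; simp; linear_combination (-1:ℚ) * hw2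
    let φ : (Fin 3 → ℤ) → Fin 2 → ℤ := fun w => ![w 0, w 1 - l * w 2]
    have hφψ : ∀ w, qz (φ w) = ψ (qz w) := by
      intro w; ext i; fin_cases i <;> simp [qz, φ, ψ]
    obtain ⟨J, hJc, hJ, hJz⟩ := exists_factors M (by intro h0; apply hMz.2; rw [h0]; simp)
    rw [hMz.1] at hJc
    let T : MvPolynomial (Fin 2) ℚ → Finset (Fin 3 → ℤ) := fun q => S.filter fun w => eval (qz (φ w)) q = 0
    have hT : ∀ q ∈ J, Good (T q) P (ρ^2) (bet 2 41 ρ) ((ρ*24) * (ρ*(8*Y))^3) := by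
      intro q hq
      have hqz := hMz.of_dvd (hJ q hq).2
      have hqp := td_pos_of_irr (hJ q hq).1
      have hqd : q.totalDegree ≤ d := by
        rw [← hMz.1]
        exact totalDegree_le_of_dvd_of_isDomain (hJ q hq).2 (by intro h0; apply hMz.2; rw [h0]; simp)
      by_cases hq2 : 2 ≤ q.totalDegree
      · have g := PC q _ hq2 hqz (hJ q hq).1 Y hY (by omega) ((T q).image φ) (by
          intro t ht
          obtain ⟨w, hw, rfl⟩ := Finset.mem_image.1 ht
          have hw := (Finset.mem_filter.1 hw).1
          intro i
          fin_cases i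
          · exact box0 _ (hB w hw 0)
          · exact boxs _ _ (hB w hw 1) (hB w hw 2)) (by
            intro t ht
            obtain ⟨w, hw, rfl⟩ := Finset.mem_image.1 ht
            exact (Finset.mem_filter.1 hw).2) P hP
        have g2 := g.of_map (S := T q) φ (fun w hw => Finset.mem_image_of_mem _ hw) 1 (by
          intro t
          rw [Finset.card_le_one]
          intro a ha b hb
          obtain ⟨ha1, ha2⟩ := Finset.mem_filter.1 ha
          obtain ⟨hb1, hb2⟩ := Finset.mem_filter.1 hb
          have h0 : ∀ w ∈ T q, q0 * (w 2 : ℚ) + q1 * ((w 1 : ℚ) - l * w 2) + q2 = 0 := by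
            intro w hw
            have := hSQ w (Finset.mem_filter.1 hw).1
            rw [← hev, hQe] at this
            simpa [qz, Fin.tail] using this
          have ea := h0 a ha1
          have eb := h0 b hb1
          have e1 : φ a 0 = φ b 0 := by rw [ha2, hb2]
          have e2 : φ a 1 = φ b 1 := by rw [ha2, hb2]
          have e1' : a 0 = b 0 := by simpa [φ] using e1
          have e2' : a 1 - l * a 2 = b 1 - l * b 2 := by simpa [φ] using e2
          have e2q : (a 1:ℚ) - l * a 2 = b 1 - l * b 2 := by exact_mod_cast e2'
          rw [e2q] at ea
          have e3 : (a 2 : ℚ) = b 2 := by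
            have : q0 * ((a 2:ℚ) - b 2) = 0 := by linarith
            have := (mul_eq_zero.1 this).resolve_left hq0'
            linarith
          have e3' : a 2 = b 2 := by exact_mod_cast e3
          rw [e3'] at e2'
          ext i
          fin_cases i
          · exact e1'
          · show a 1 = b 1
            linarith
          · exact e3') (by
          intro q w w' h i
          fin_cases i
          · exact h 0
          · have e : φ w 1 - φ w' 1 = (w 1 - w' 1) - l * (w 2 - w' 2) := by simp [φ]; ring
            show q ∣ φ w 1 - φ w' 1
            rw [e]
            exact dvd_sub (h 1) (dvd_mul_of_dvd_right (h 2) _))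
        have hqρ : q.totalDegree ≤ ρ := by omega
        refine g2.mono ?_ (betm _ _ hqρ) ?_ <;> rw [one_mul] <;> gcongr
      · -- a line in the surface
        refine Good.small _ _ _ _ _ (le_trans ?_ (Nat.one_le_pow 2 ρ (by omega)))
        rw [Finset.card_le_one]
        intro a ha b hb
        by_contra hab
        obtain ⟨ha1, ha2⟩ := Finset.mem_filter.1 ha
        obtain ⟨hb1, hb2⟩ := Finset.mem_filter.1 hb
        apply hL a ha1
        refine onLine_of_two f _ a b hab (hB a ha1) (hB b hb1) fun t => ?_
        rw [← hMe]
        · have e : ψ (fun i => qz a i + t * (qz b i - qz a i)) = fun i => qz (φ a) i + t * (qz (φ b) i - qz (φ a) i) := by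
            ext i; fin_cases i
            · simp [ψ, φ, qz]
            · simp [ψ, φ, qz]; ring
          rw [e]
          obtain ⟨r, hr⟩ := (hJ q hq).2
          have hq1 : q.totalDegree ≤ 1 := by omega
          rw [hr, map_mul, affine_eval q hq1 (qz (φ a)) (qz (φ b)) t ha2 hb2, zero_mul]
        · have hQ1 : Q.totalDegree ≤ 1 := by omega
          have := affine_eval Q hQ1 (qz (Fin.tail a : Fin 2 → ℤ)) (qz (Fin.tail b : Fin 2 → ℤ)) t (hSQ a ha1) (hSQ b hb1)
          exact this
    have g := Good.union J S T P _ _ _ hT (by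
      intro w hw
      have : eval (qz (φ w)) M = 0 := by
        have h1 : eval (Fin.tail (qz w) : Fin 2 → ℚ) Q = 0 := by
          rw [qz_tail']; exact hSQ w hw
        rw [hφψ, hMe _ h1, eval_toQ, hS w hw]; simp
      obtain ⟨q, hq, hq2⟩ := hJz _ this
      exact ⟨q, hq, Finset.mem_filter.2 ⟨hw, hq2⟩⟩)
    refine g.mono ?_ le_rfl ?_ <;> gcongr <;> omega

end DG

namespace DG
open MvPolynomial

lemma exchange (G : Finset ℕ) (p : Finset ℕ → Prop) (m : ℕ)
    (h : ∀ τ τ', τ ⊆ G → τ' ⊆ G → τ.card = m → τ'.card = m → (τ ∪ τ').card = m + 1 → p τ → p τ') :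
    ∀ τ τ', τ ⊆ G → τ' ⊆ G → τ.card = m → τ'.card = m → p τ → p τ' := by
  classical
  have key : ∀ n, ∀ τ τ', τ ⊆ G → τ' ⊆ G → τ.card = m → τ'.card = m → (τ' \ τ).card = n → p τ → p τ' := by
    intro n
    induction n with
    | zero =>
      intro τ τ' h1 h2 h3 h4 h5 h6
      rw [Finset.card_eq_zero, Finset.sdiff_eq_empty_iff_subset] at h5
      rw [Finset.eq_of_subset_of_card_le h5 (by omega)]; exact h6
    | succ n ih =>
      intro τ τ' h1 h2 h3 h4 h5 h6
      obtain ⟨b, hb⟩ : (τ' \ τ).Nonempty := Finset.card_pos.1 (by omega)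
      have hc : (τ \ τ').card = (τ' \ τ).card := by
        have a1 := Finset.card_sdiff_add_card_inter τ τ'
        have a2 := Finset.card_sdiff_add_card_inter τ' τ
        rw [Finset.inter_comm] at a2
        omega
      obtain ⟨a, ha⟩ : (τ \ τ').Nonempty := Finset.card_pos.1 (by omega)
      rw [Finset.mem_sdiff] at ha hb
      have hbe : b ∉ τ.erase a := fun h => hb.2 (Finset.mem_of_mem_erase h)
      have hmpos : 1 ≤ m := by rw [← h3]; exact Finset.card_pos.2 ⟨a, ha.1⟩
      have hcard : (insert b (τ.erase a)).card = m := by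
        rw [Finset.card_insert_of_notMem hbe, Finset.card_erase_of_mem ha.1]; omega
      have hsub : insert b (τ.erase a) ⊆ G := Finset.insert_subset (h2 hb.1) ((Finset.erase_subset _ _).trans h1)
      refine ih (insert b (τ.erase a)) τ' hsub h2 hcard h4 ?_ (h τ _ h1 hsub h3 hcard ?_ h6)
      · have : τ' \ insert b (τ.erase a) = (τ' \ τ).erase b := by
          ext x
          simp only [Finset.mem_sdiff, Finset.mem_insert, Finset.mem_erase, not_or, not_and]
          constructor
          · rintro ⟨q1, q2, q3⟩
            refine ⟨q2, q1, fun hx => ?_⟩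
            by_cases e : x = a
            · subst e; exact ha.2 q1
            · exact q3 e hx
          · rintro ⟨q1, q2, q3⟩
            exact ⟨q2, q1, fun _ => q3⟩
        rw [this, Finset.card_erase_of_mem (Finset.mem_sdiff.2 hb), h5]; rfl
      · have : τ ∪ insert b (τ.erase a) = insert b τ := by
          ext x
          simp only [Finset.mem_union, Finset.mem_insert, Finset.mem_erase]
          tauto
        rw [this, Finset.card_insert_of_notMem hb.2, h3]
  intro τ τ' h1 h2 h3 h4 h5
  exact key _ τ τ' h1 h2 h3 h4 rfl h5

theorem comb {𝒬 : Type*} (S : Finset (Fin 3 → ℤ)) (P : Finset ℕ) (G : (Fin 3 → ℤ) → Finset ℕ)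
    (J : Finset ℕ → (Fin 3 → ℤ) → Finset 𝒬) (van : 𝒬 → (Fin 3 → ℤ) → Prop) (ρ β3 β2 K m n c : ℕ)
    (hG : ∀ w ∈ S, G w ⊆ P ∧ (P \ G w).card ≤ β3) (hP : β3 + β2 + 21 ≤ P.card)
    (hJ : ∀ τ x, (J τ x).card ≤ ρ)
    (hvan : ∀ w ∈ S, ∀ τ ⊆ G w, τ.card = 18 → ∃ q ∈ J τ (cl (qq τ) w), van q w)
    (hK : ∀ τ ⊆ P, ((S.filter fun w => τ ⊆ G w).image (cl (qq τ))).card ≤ K^τ.card)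
    (hE : ∀ τ τ' x x', ∀ q ∈ J τ x, q ∉ J τ' x' → ∀ T ⊆ S, (∀ w ∈ T, τ ⊆ G w ∧ τ' ⊆ G w ∧ τ.card = 18 ∧ τ'.card = 18 ∧
      cl (qq τ) w = x ∧ cl (qq τ') w = x' ∧ van q w) → T.card ≤ m)
    (hgood : ∀ τ x, ∀ q ∈ J τ x, ∀ T ⊆ S, (∀ w ∈ T, van q w) → Good T P n β2 c) :
    S.card ≤ P.card^36 * (K^19 * (ρ * m)) + P.card^18 * (K^18 * (ρ * n)) + P.card^39 * (K^18 * (ρ * c)) := by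
  classical
  let pc := fun j : ℕ => P.powersetCard j
  have hpc : ∀ j, (pc j).card ≤ P.card^j := fun j => by
    rw [Finset.card_powersetCard]; exact Nat.choose_le_pow _ _
  let cls : Finset ℕ → Finset (Fin 3 → ℤ) := fun τ => (S.filter fun w => τ ⊆ G w).image (cl (qq τ))
  -- the exceptional set
  let E : Finset (Fin 3 → ℤ) := S.filter fun w => ∃ τ τ', τ ⊆ G w ∧ τ' ⊆ G w ∧ τ.card = 18 ∧ τ'.card = 18 ∧ (τ ∪ τ').card = 19 ∧
    ∃ q ∈ J τ (cl (qq τ) w), q ∉ J τ' (cl (qq τ') w) ∧ van q w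
  have hEc : E.card ≤ P.card^36 * (K^19 * (ρ * m)) := by
    let I : Finset (Finset ℕ × Finset ℕ) := (pc 18 ×ˢ pc 18).filter fun t => (t.1 ∪ t.2).card = 19
    have hsub : E ⊆ I.biUnion fun t => (cls (t.1 ∪ t.2)).biUnion fun x => ((J t.1 (cl (qq t.1) x)).filter fun q => q ∉ J t.2 (cl (qq t.2) x)).biUnion fun q =>
        S.filter fun w => t.1 ⊆ G w ∧ t.2 ⊆ G w ∧ t.1.card = 18 ∧ t.2.card = 18 ∧ 
          cl (qq t.1) w = cl (qq t.1) x ∧ cl (qq t.2) w = cl (qq t.2) x ∧ van q w := by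
      intro w hw
      obtain ⟨hwS, τ, τ', h1, h2, h3, h4, h5, q, hq, hq', hv⟩ := Finset.mem_filter.1 hw
      have hdv : ∀ σ, σ ⊆ τ ∪ τ' → cl (qq σ) w = cl (qq σ) (cl (qq (τ ∪ τ')) w) := by
        intro σ hσ
        rw [eq_comm, cl_eq_iff]
        intro i
        refine dvd_trans ?_ (cl_dvd (qq (τ ∪ τ')) w i)
        exact_mod_cast Finset.prod_dvd_prod_of_subset _ _ _ hσ
      have d1 := hdv τ Finset.subset_union_left
      have d2 := hdv τ' Finset.subset_union_right
      refine Finset.mem_biUnion.2 ⟨(τ, τ'), ?_, Finset.mem_biUnion.2 ⟨cl (qq (τ ∪ τ')) w, ?_, Finset.mem_biUnion.2 ⟨q, ?_, ?_⟩⟩⟩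
      · refine Finset.mem_filter.2 ⟨Finset.mem_product.2 ⟨?_, ?_⟩, h5⟩
        · exact Finset.mem_powersetCard.2 ⟨h1.trans (hG w hwS).1, h3⟩
        · exact Finset.mem_powersetCard.2 ⟨h2.trans (hG w hwS).1, h4⟩
      · exact Finset.mem_image_of_mem _ (Finset.mem_filter.2 ⟨hwS, Finset.union_subset h1 h2⟩)
      · refine Finset.mem_filter.2 ⟨?_, ?_⟩
        · rw [← d1]; exact hq
        · rw [← d2]; exact hq'
      · exact Finset.mem_filter.2 ⟨hwS, h1, h2, h3, h4, d1, d2, hv⟩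
    have hI : I.card ≤ P.card^36 := by
      refine (Finset.card_filter_le _ _).trans ?_
      rw [Finset.card_product]
      calc _ ≤ P.card^18 * P.card^18 := Nat.mul_le_mul (hpc 18) (hpc 18)
        _ = _ := by ring
    refine (Finset.card_le_card hsub).trans ?_
    refine (Finset.card_biUnion_le_card_mul _ _ (K^19 * (ρ * m)) fun t ht => ?_).trans (Nat.mul_le_mul_right _ hI)
    obtain ⟨ht1, ht2⟩ := Finset.mem_filter.1 ht
    obtain ⟨hta, htb⟩ := Finset.mem_product.1 ht1
    have hk := hK (t.1 ∪ t.2) (Finset.union_subset (Finset.mem_powersetCard.1 hta).1 (Finset.mem_powersetCard.1 htb).1)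
    rw [ht2] at hk
    refine (Finset.card_biUnion_le_card_mul _ _ (ρ * m) fun x hx => ?_).trans (Nat.mul_le_mul_right _ hk)
    refine (Finset.card_biUnion_le_card_mul _ _ m fun q hq => ?_).trans (Nat.mul_le_mul_right _ ((Finset.card_filter_le _ _).trans (hJ _ _)))
    obtain ⟨hq1, hq2⟩ := Finset.mem_filter.1 hq
    exact hE _ _ _ _ q hq1 hq2 _ (Finset.filter_subset _ _) fun w hw => (Finset.mem_filter.1 hw).2
  -- assign Q
  have hassign : ∀ w : Fin 3 → ℤ, ∃ q : Option 𝒬, w ∈ S → w ∉ E → ∃ q', q = some q' ∧ van q' w ∧ ∀ τ ⊆ G w, τ.card = 18 → q' ∈ J τ (cl (qq τ) w) := by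
    intro w
    by_cases hw : w ∈ S ∧ w ∉ E
    · obtain ⟨hwS, hwE⟩ := hw
      have hcard : 18 ≤ (G w).card := by
        have a1 := Finset.card_sdiff_add_card_inter P (G w)
        rw [Finset.inter_eq_right.2 (hG w hwS).1] at a1
        have := (hG w hwS).2
        omega
      obtain ⟨τ0, hτ0, hc0⟩ := Finset.exists_subset_card_eq hcard
      obtain ⟨q, hq, hv⟩ := hvan w hwS τ0 hτ0 hc0
      refine ⟨some q, fun _ _ => ⟨q, rfl, hv, fun τ hτ hc => ?_⟩⟩
      refine exchange (G w) (fun τ => q ∈ J τ (cl (qq τ) w)) 18 ?_ τ0 τ hτ0 hτ hc0 hc hq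
      intro σ σ' b1 b2 b3 b4 b5 b6
      by_contra hcon
      exact hwE (Finset.mem_filter.2 ⟨hwS, σ, σ', b1, b2, b3, b4, b5, q, b6, hcon, hv⟩)
    · exact ⟨none, fun h1 h2 => absurd ⟨h1, h2⟩ hw⟩
  choose A hA using hassign
  let T : 𝒬 → Finset (Fin 3 → ℤ) := fun q => S.filter fun w => w ∉ E ∧ A w = some q
  have hTg : ∀ q, (T q).Nonempty → Good (T q) P n β2 c := by
    intro q ⟨w, hw⟩
    have hw' := Finset.mem_filter.1 hw
    have hcard : 18 ≤ (G w).card := by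
      have a1 := Finset.card_sdiff_add_card_inter P (G w)
      rw [Finset.inter_eq_right.2 (hG w hw'.1).1] at a1
      have := (hG w hw'.1).2
      omega
    obtain ⟨τ0, hτ0, hc0⟩ := Finset.exists_subset_card_eq hcard
    have hmem : ∀ w ∈ T q, van q w ∧ ∀ τ ⊆ G w, τ.card = 18 → q ∈ J τ (cl (qq τ) w) := by
      intro w hw
      obtain ⟨b1, b2, b3⟩ := Finset.mem_filter.1 hw
      obtain ⟨q', e, h1, h2⟩ := hA w b1 b2
      rw [b3] at e; cases e; exact ⟨h1, h2⟩
    exact hgood τ0 _ q ((hmem w hw).2 τ0 hτ0 hc0) (T q) (Finset.filter_subset _ _) fun w hw => (hmem w hw).1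
  have hTg' : ∀ q, ∃ N : Finset (Fin 3 → ℤ), ∃ Bad : (Fin 3 → ℤ) → Finset ℕ, N.card ≤ n ∧ (∀ w ∈ T q, w ∉ N → (Bad w).card ≤ β2) ∧
    ∀ τ σ : Finset ℕ, τ ⊆ σ → σ ⊆ P → τ.card = 18 → σ.card = 21 → ∀ Z ⊆ T q, (∀ w ∈ Z, w ∉ N ∧ Disjoint σ (Bad w)) →
      (∀ w ∈ Z, ∀ w' ∈ Z, ∀ i, (qq τ : ℤ) ∣ w i - w' i) → Z.card ≤ c := by
    intro q
    by_cases h : (T q).Nonempty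
    · obtain ⟨N, -, h2, Bad, h3, h4⟩ := hTg q h
      exact ⟨N, Bad, h2, h3, h4⟩
    · rw [Finset.not_nonempty_iff_eq_empty] at h
      refine ⟨∅, fun _ => ∅, by simp, by simp, ?_⟩
      intro τ σ _ _ _ _ Z hZ _ _
      rw [h, Finset.subset_empty] at hZ
      simp [hZ]
  choose N Bad hN hBad hZ using hTg'
  let T1 : Finset (Fin 3 → ℤ) := (pc 18).biUnion fun τ => (cls τ).biUnion fun x => (J τ x).biUnion fun q => N q
  let T2 : Finset (Fin 3 → ℤ) := (pc 21 ×ˢ pc 18).biUnion fun t => (cls t.2).biUnion fun x => (J t.2 x).biUnion fun q =>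
    (T q).filter fun w => t.2 ⊆ t.1 ∧ w ∉ N q ∧ Disjoint t.1 (Bad q w) ∧ cl (qq t.2) w = x
  have hT1 : T1.card ≤ P.card^18 * (K^18 * (ρ * n)) := by
    refine (Finset.card_biUnion_le_card_mul _ _ (K^18 * (ρ * n)) fun t ht => ?_).trans (Nat.mul_le_mul_right _ (hpc 18))
    have ht := Finset.mem_powersetCard.1 ht
    have hk := hK t ht.1
    rw [ht.2] at hk
    refine (Finset.card_biUnion_le_card_mul _ _ (ρ * n) fun x hx => ?_).trans (Nat.mul_le_mul_right _ hk)
    exact (Finset.card_biUnion_le_card_mul _ _ n fun q hq => hN q).trans (Nat.mul_le_mul_right _ (hJ _ _))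
  have hT2 : T2.card ≤ P.card^39 * (K^18 * (ρ * c)) := by
    have hI : (pc 21 ×ˢ pc 18).card ≤ P.card^39 := by
      rw [Finset.card_product]
      calc _ ≤ P.card^21 * P.card^18 := Nat.mul_le_mul (hpc 21) (hpc 18)
        _ = _ := by ring
    refine (Finset.card_biUnion_le_card_mul _ _ (K^18 * (ρ * c)) fun t ht => ?_).trans (Nat.mul_le_mul_right _ hI)
    obtain ⟨hta, htb⟩ := Finset.mem_product.1 ht
    have hta := Finset.mem_powersetCard.1 hta
    have htb := Finset.mem_powersetCard.1 htb
    have hk := hK t.2 htb.1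
    rw [htb.2] at hk
    refine (Finset.card_biUnion_le_card_mul _ _ (ρ * c) fun x hx => ?_).trans (Nat.mul_le_mul_right _ hk)
    refine (Finset.card_biUnion_le_card_mul _ _ c fun q hq => ?_).trans (Nat.mul_le_mul_right _ (hJ _ _))
    by_cases hts : t.2 ⊆ t.1
    · refine hZ q t.2 t.1 hts hta.1 htb.2 hta.2 _ (Finset.filter_subset _ _) ?_ ?_
      · intro w hw
        have := (Finset.mem_filter.1 hw).2
        exact ⟨this.2.1, this.2.2.1⟩
      · intro w hw w' hw'
        have e1 := (Finset.mem_filter.1 hw).2.2.2.2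
        have e2 := (Finset.mem_filter.1 hw').2.2.2.2
        exact (cl_eq_iff _ _ _).1 (e1.trans e2.symm)
    · rw [Finset.filter_false_of_mem (fun w _ h => hts h.1)]; simp
  have hcover : S ⊆ E ∪ T1 ∪ T2 := by
    intro w hw
    by_cases hwE : w ∈ E
    · exact Finset.mem_union_left _ (Finset.mem_union_left _ hwE)
    obtain ⟨q, e, hv, hq⟩ := hA w hw hwE
    have hwT : w ∈ T q := Finset.mem_filter.2 ⟨hw, hwE, e⟩
    have hcard : β2 + 21 ≤ (G w).card := by
      have a1 := Finset.card_sdiff_add_card_inter P (G w)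
      rw [Finset.inter_eq_right.2 (hG w hw).1] at a1
      have := (hG w hw).2
      omega
    by_cases hwN : w ∈ N q
    · obtain ⟨τ0, hτ0, hc0⟩ := Finset.exists_subset_card_eq (by omega : 18 ≤ (G w).card)
      refine Finset.mem_union_left _ (Finset.mem_union_right _ ?_)
      refine Finset.mem_biUnion.2 ⟨τ0, Finset.mem_powersetCard.2 ⟨hτ0.trans (hG w hw).1, hc0⟩, 
        Finset.mem_biUnion.2 ⟨cl (qq τ0) w, Finset.mem_image_of_mem _ (Finset.mem_filter.2 ⟨hw, hτ0⟩), 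
        Finset.mem_biUnion.2 ⟨q, hq τ0 hτ0 hc0, hwN⟩⟩⟩
    · have hb := hBad q w hwT hwN
      have hc2 : 21 ≤ (G w \ Bad q w).card := by
        have := Finset.le_card_sdiff (Bad q w) (G w)
        omega
      obtain ⟨σ, hσ, hσc⟩ := Finset.exists_subset_card_eq hc2
      obtain ⟨τ, hτ, hτc⟩ := Finset.exists_subset_card_eq (by omega : 18 ≤ σ.card)
      have hσG : σ ⊆ G w := hσ.trans Finset.sdiff_subset
      refine Finset.mem_union_right _ (Finset.mem_biUnion.2 ⟨(σ, τ), Finset.mem_product.2 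
        ⟨Finset.mem_powersetCard.2 ⟨hσG.trans (hG w hw).1, hσc⟩, Finset.mem_powersetCard.2 ⟨(hτ.trans hσG).trans (hG w hw).1, hτc⟩⟩,
        Finset.mem_biUnion.2 ⟨cl (qq τ) w, Finset.mem_image_of_mem _ (Finset.mem_filter.2 ⟨hw, hτ.trans hσG⟩), 
        Finset.mem_biUnion.2 ⟨q, hq τ (hτ.trans hσG) hτc, Finset.mem_filter.2 ⟨hwT, hτ, hwN, ?_, rfl⟩⟩⟩⟩)
      exact Finset.disjoint_of_subset_left hσ Finset.sdiff_disjoint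
  refine (Finset.card_le_card hcover).trans ((Finset.card_union_le _ _).trans (Nat.add_le_add ((Finset.card_union_le _ _).trans (Nat.add_le_add hEc hT1)) hT2))

end DG

namespace DG
open MvPolynomial

lemma exists_factors' {K : Type*} [Field K] {k : ℕ} (g : MvPolynomial (Fin k) K) (hg : g ≠ 0) :
    ∃ J : Finset (Associates (MvPolynomial (Fin k) K)), J.card ≤ g.totalDegree ∧ (∀ q, Associates.mk q ∈ J → Irreducible q ∧ q ∣ g) ∧
      (∀ q, Irreducible q → q ∣ g → Associates.mk q ∈ J) ∧
      ∀ x, eval x g = 0 → ∃ q, Associates.mk q ∈ J ∧ eval x q = 0 := by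
  classical
  induction g using WfDvdMonoid.induction_on_irreducible with
  | zero => exact absurd rfl hg
  | unit u hu => 
    refine ⟨∅, by simp, by simp, fun q hq hqu => ?_, fun x hx => absurd hx (hu.map (eval x)).ne_zero⟩
    exact absurd (isUnit_of_dvd_unit hqu hu) hq.not_isUnit
  | mul a p ha hp ih =>
    obtain ⟨J, h1, h2, h4, h3⟩ := ih ha
    refine ⟨insert (Associates.mk p) J, ?_, ?_, ?_, ?_⟩
    · have := td_pos_of_irr hp
      rw [totalDegree_mul_of_isDomain hp.ne_zero ha]
      have := Finset.card_insert_le (Associates.mk p) J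
      omega
    · intro q hq
      rcases Finset.mem_insert.1 hq with hq | hq
      · have := Associates.mk_eq_mk_iff_associated.1 hq
        exact ⟨this.symm.irreducible hp, this.dvd.trans (dvd_mul_right _ _)⟩
      · exact ⟨(h2 q hq).1, (h2 q hq).2.trans (dvd_mul_left _ _)⟩
    · intro q hq hd
      rcases hq.prime.dvd_or_dvd hd with h | h
      · exact Finset.mem_insert.2 (Or.inl (Associates.mk_eq_mk_iff_associated.2 (hq.associated_of_dvd hp h)))
      · exact Finset.mem_insert_of_mem (h4 q hq h)
    · intro x hx
      rw [map_mul, mul_eq_zero] at hx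
      rcases hx with hx | hx
      · exact ⟨p, Finset.mem_insert_self _ _, hx⟩
      · obtain ⟨q, hq, hx⟩ := h3 x hx
        exact ⟨q, Finset.mem_insert_of_mem hq, hx⟩

lemma eval_assoc {K : Type*} [Field K] {k : ℕ} {p q : MvPolynomial (Fin k) K} (h : Associated p q) (x) (hp : eval x p = 0) : eval x q = 0 := by
  obtain ⟨r, rfl⟩ := h.dvd
  rw [map_mul, hp, zero_mul]

def kS (d : ℕ) : ℕ := bet 3 40 d + bet 2 41 ((402*d)^2) + 21

theorem surf : ∃ Y1 : ℕ, ∀ (f : MvPolynomial (Fin 3) ℤ) (d : ℕ) (_ : 5 ≤ d) (_ : ZL (toQ f) d) (_ : Irreducible (toQ f))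
    (Y : ℕ) (_ : Y1 ≤ Y) (_ : d * (4*(100*d)+1) * (2*(100*d)+1) ≤ Y) (_ : (402*d)^2 + 1 ≤ Y) (_ : kS d^2 ≤ Y) 
    (S : Finset (Fin 3 → ℤ)) (_ : ∀ w ∈ S, inBox (Y^40) w) (_ : ∀ w ∈ S, eval w f = 0) (_ : ∀ w ∈ S, ¬ onLine f (Y^40) w),
    S.card ≤ d*((d+d)^2*(2*Y^40+1)) + (kS d^36 * ((d*(8*Y)^2)^19 * ((402*d)^2 * ((402*d)^2*(402*d)^2*d))) + 
      kS d^18 * ((d*(8*Y)^2)^18 * ((402*d)^2 * ((402*d)^2*((402*d)^2)^2))) + 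
      kS d^39 * ((d*(8*Y)^2)^18 * ((402*d)^2 * ((402*d)^2 * (((402*d)^2*24) * ((402*d)^2*(8*Y))^3))))) := by
  classical
  obtain ⟨Y1, hY1⟩ := primes_exist
  refine ⟨Y1, ?_⟩
  intro f d hd hz hirr Y hYY hYa hYb hYk S hB hS hL
  obtain ⟨P, hPc, hP⟩ := hY1 Y hYY (kS d) hYk
  set ρ := (402*d)^2 with hρ
  have hdρ : d ≤ ρ := by rw [hρ]; nlinarith
  have hY48 : 48 ≤ Y := by nlinarith
  have hdY : d + 1 ≤ Y := by omega
  have hY2 : 1 ≤ Y^40 := Nat.one_le_pow _ _ (by omega)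
  have hkey := hb_or (toQ f) d (by omega) hz hirr Y 40 hdY S hB (fun z h => by rw [eval_toQ, hS z h]; simp) P (fun p hp => ⟨(hP p hp).1, (hP p hp).2.1⟩)
  rcases hkey with ⟨g, hg1, hg2, hg3⟩ | ⟨f', ⟨c, hc, hf'⟩, hbad⟩
  · have := elim_count (toQ f) g d (by omega) hz hirr hg2 (Y^40) S hB (fun z h => ⟨by rw [eval_toQ, hS z h]; simp, hg3 z h⟩)
    refine (this.trans ?_).trans (Nat.le_add_right _ _)
    rw [pow_one]
    gcongr
  have hz' : ZL (toQ f') d := by rw [hf']; exact hz.smul c hc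
  have hirr' : Irreducible (toQ f') := by rw [hf']; exact irr_smul hirr c hc
  have hev : ∀ w, eval w f' = 0 ↔ eval w f = 0 := by
    intro w
    have := congrArg (eval (qz w)) hf'
    rw [map_mul, eval_C, eval_toQ, eval_toQ] at this
    constructor
    · intro h; rw [h] at this; simpa [hc] using this
    · intro h; rw [h] at this; simpa using this
  have hS' : ∀ w ∈ S, eval w f' = 0 := fun w hw => (hev w).2 (hS w hw)
  have hL' : ∀ w ∈ S, ¬ onLine f' (Y^40) w := by
    intro w hw ⟨v, h⟩
    refine hL w hw ⟨v, ?_⟩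
    simpa only [hev] using h
  -- E1
  have hE1 : (S.filter fun w => eval w (pderiv 0 f') = 0).card ≤ d*((d+d)^2*(2*Y^40+1)) := by
    have := elim_count (toQ f') (pderiv 0 (toQ f')) d (by omega) hz' hirr' (not_dvd_pderiv _ d (by omega) hz').2 (Y^40) 
      (S.filter fun w => eval w (pderiv 0 f') = 0) (fun z h => hB z (Finset.mem_filter.1 h).1) (fun z h => by
        obtain ⟨h1, h2⟩ := Finset.mem_filter.1 h
        rw [← pderiv_toQ, eval_toQ, eval_toQ, hS' z h1, h2]; simp)
    refine this.trans ?_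
    rw [pow_one]
    have := totalDegree_pderiv_le (toQ f') 0
    rw [hz'.1] at this
    gcongr; omega
  set S1 := S.filter fun w => ¬ eval w (pderiv 0 f') = 0 with hS1
  have hsplit : (S.filter fun w => eval w (pderiv 0 f') = 0).card + S1.card = S.card := Finset.card_filter_add_card_filter_not _
  rw [← hsplit]
  refine Nat.add_le_add hE1 ?_
  have hS1S : ∀ w ∈ S1, w ∈ S ∧ eval w (pderiv 0 f') ≠ 0 := fun w hw => Finset.mem_filter.1 hw
  let G : (Fin 3 → ℤ) → Finset ℕ := fun w => P.filter fun p : ℕ => ¬ (p:ℤ) ∣ eval w (pderiv 0 f')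
  have hR : ∀ (τ : Finset ℕ) (x : Fin 3 → ℤ), ∃ R : MvPolynomial (Fin 2) ℚ, R ≠ 0 ∧ R.totalDegree ≤ ρ ∧ 
      (τ.card = 18 → ∀ w ∈ S1, τ ⊆ G w → cl (qq τ) w = x → eval (qz (Fin.tail w : Fin 2 → ℤ)) R = 0) := by
    intro τ x
    set Z := S1.filter fun w => τ ⊆ G w ∧ cl (qq τ) w = x with hZ
    by_cases hne : Z.Nonempty ∧ τ.card = 18
    · obtain ⟨⟨P0, hP0⟩, hτc⟩ := hne
      obtain ⟨hP1, hP2, hP3⟩ := Finset.mem_filter.1 hP0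
      have hτP : ∀ p ∈ τ, p ∈ P := fun p hp => (Finset.mem_filter.1 (hP2 hp)).1
      obtain ⟨R, h1, h2, h3⟩ := surface_class f' d hd hz' hirr' Y (qq τ) hYa (by
        rw [← hτc]; exact qq_ge τ Y fun p hp => (hP p (hτP p hp)).2.1.le) P0 
        (coprime_qq τ (fun p hp => (hP p (hτP p hp)).1) _ fun p hp => (Finset.mem_filter.1 (hP2 hp)).2) Z 
        (fun z hz => hB z (hS1S z (Finset.mem_filter.1 hz).1).1) (fun z hz k => by
          have := (Finset.mem_filter.1 hz).2.2
          exact (cl_eq_iff _ _ _).1 (this.trans hP3.symm) k) (fun z hz => hS' z (hS1S z (Finset.mem_filter.1 hz).1).1)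
      exact ⟨R, h1, h2, fun _ w hw hwG hwx => h3 w (Finset.mem_filter.2 ⟨hw, hwG, hwx⟩)⟩
    · refine ⟨1, one_ne_zero, by simp, fun hτ w hw hwG hwx => ?_⟩
      exact absurd ⟨⟨w, Finset.mem_filter.2 ⟨hw, hwG, hwx⟩⟩, hτ⟩ hne
  choose R hR0 hRd hRv using hR
  have hJ := fun τ x => exists_factors' (R τ x) (hR0 τ x)
  choose J hJc hJi hJall hJv using hJ
  let van : Associates (MvPolynomial (Fin 2) ℚ) → (Fin 3 → ℤ) → Prop := fun q w => ∀ q', Associates.mk q' = q → eval (qz (Fin.tail w : Fin 2 → ℤ)) q' = 0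
  have hk : P.card = bet 3 40 d + bet 2 41 ρ + 21 := hPc
  have hmain := comb S1 P G J van ρ (bet 3 40 d) (bet 2 41 ρ) (d*(8*Y)^2) (ρ*ρ*d) (ρ*ρ^2) (ρ * ((ρ*24) * (ρ*(8*Y))^3)) 
    (by
      intro w hw
      refine ⟨Finset.filter_subset _ _, ?_⟩
      refine le_trans (Finset.card_le_card ?_) (hbad w (hB w (hS1S w hw).1) (hS1S w hw).2)
      intro p hp
      obtain ⟨hp1, hp2⟩ := Finset.mem_sdiff.1 hp
      refine Finset.mem_filter.2 ⟨hp1, ?_⟩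
      by_contra hcon
      exact hp2 (Finset.mem_filter.2 ⟨hp1, hcon⟩)) 
    hk.ge (fun τ x => (hJc τ x).trans (hRd τ x)) 
    (by
      intro w hw τ hτ hτc
      obtain ⟨q, hq, hqe⟩ := hJv τ (cl (qq τ) w) _ (hRv τ _ hτc w hw hτ rfl)
      exact ⟨_, hq, fun q' hq' => eval_assoc (Associates.mk_eq_mk_iff_associated.1 hq'.symm) _ hqe⟩)
    (by
      intro τ hτ
      refine class_count f' d Y ((totalDegree_toQ f').symm.trans hz'.1).le _ τ (fun p hp => ⟨(hP p (hτ hp)).1, (hP p (hτ hp)).2.2⟩) ?_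
      intro z hz p hp
      obtain ⟨h1, h2⟩ := Finset.mem_filter.1 hz
      exact ⟨by rw [hS' z (hS1S z h1).1]; simp, (Finset.mem_filter.1 (h2 hp)).2⟩)
    (by
      intro τ τ' x x' q hq hq' T hT hTw
      obtain ⟨q0, rfl⟩ := Associates.mk_surjective q
      obtain ⟨hi, hdv⟩ := hJi τ x q0 hq
      have hnd : ¬ q0 ∣ R τ' x' := fun h => hq' (hJall _ _ q0 hi h)
      have hfib := card_le_fiber T (fun w => (Fin.tail w : Fin 2 → ℤ)) (T.image fun w => (Fin.tail w : Fin 2 → ℤ)) d 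
        (fun z hz => Finset.mem_image_of_mem _ hz) (fun t _ => fiber_tail f' d hz' T (fun w hw => hS' w (hS1S w (hT hw)).1) t)
      refine hfib.trans ?_
      rw [mul_comm d]
      refine Nat.mul_le_mul_right _ ?_
      have hbz := bezout q0 (R τ' x') hi hnd ((T.image fun w => (Fin.tail w : Fin 2 → ℤ)).image qz) (by
        intro z hz
        obtain ⟨t, ht, rfl⟩ := Finset.mem_image.1 hz
        obtain ⟨w, hw, rfl⟩ := Finset.mem_image.1 ht
        obtain ⟨h1, h2, h3, h4, h5, h6, h7⟩ := hTw w hw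
        exact ⟨h7 q0 rfl, hRv τ' x' h4 w (hT hw) h2 h6⟩)
      rw [Finset.card_image_of_injective _ qz_injective] at hbz
      refine hbz.trans (Nat.mul_le_mul ((totalDegree_le_of_dvd_of_isDomain hdv (hR0 _ _)).trans (hRd _ _)) (hRd _ _)))
    (by
      intro τ x q hq T hT hTv
      obtain ⟨q0, rfl⟩ := Associates.mk_surjective q
      obtain ⟨hi, hdv⟩ := hJi τ x q0 hq
      exact PQ f' d (by omega) hz' q0 hi ρ ((totalDegree_le_of_dvd_of_isDomain hdv (hR0 _ _)).trans (hRd _ _)) hdρ Y hY48 hYb T 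
        (fun w hw => hB w (hS1S w (hT hw)).1) (fun w hw => hS' w (hS1S w (hT hw)).1) (fun w hw => hTv w hw q0 rfl) 
        (fun w hw => hL' w (hS1S w (hT hw)).1) P hP)
  rw [hPc] at hmain
  exact hmain

end DG

namespace DG
open MvPolynomial

def prim {k : ℕ} (v : Fin k → ℤ) : Prop := ∀ a : ℤ, (∀ i, a ∣ v i) → IsUnit a

lemma prim.bezout {k : ℕ} {v : Fin k → ℤ} (h : prim v) : ∃ c : Fin k → ℤ, ∑ i, c i * v i = 1 := by
  obtain ⟨a, ha⟩ := (IsPrincipalIdealRing.principal (Ideal.span (Set.range v))).principal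
  have ha' : Ideal.span (Set.range v) = Ideal.span {a} := ha
  have hu : IsUnit a := h a fun i => by
    have : v i ∈ Ideal.span (Set.range v) := Ideal.subset_span ⟨i, rfl⟩
    rw [ha'] at this
    exact Ideal.mem_span_singleton.1 this
  have h1 : (1:ℤ) ∈ Ideal.span (Set.range v) := by
    rw [ha', Ideal.mem_span_singleton]; exact hu.dvd
  obtain ⟨c, hc⟩ := (Ideal.mem_span_range_iff_exists_fun).1 h1
  exact ⟨c, hc⟩

lemma prim.ratio {k : ℕ} {v : Fin k → ℤ} (h : prim v) (r : ℚ) (w : Fin k → ℤ) (hr : ∀ i, (w i : ℚ) = r * v i) : ∃ m : ℤ, r = m := by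
  obtain ⟨c, hc⟩ := h.bezout
  refine ⟨∑ i, c i * w i, ?_⟩
  have : (∑ i, (c i : ℚ) * v i) = 1 := by exact_mod_cast hc
  push_cast
  calc r = r * 1 := by ring
    _ = r * ∑ i, (c i : ℚ) * v i := by rw [this]
    _ = _ := by rw [Finset.mul_sum]; exact Finset.sum_congr rfl fun i _ => by rw [hr i]; ring

lemma prim.pm {k : ℕ} {v w : Fin k → ℤ} (h : prim v) (h' : prim w) (r : ℚ) (hr : ∀ i, (w i : ℚ) = r * v i) : w = v ∨ w = fun i => - v i := by
  obtain ⟨m, hm⟩ := h.ratio r w hr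
  have hw : ∀ i, w i = m * v i := fun i => by have := hr i; rw [hm] at this; exact_mod_cast this
  have hu := h' m fun i => ⟨v i, hw i⟩
  rcases Int.isUnit_iff.1 hu with e | e
  · left; ext i; rw [hw, e]; ring
  · right; ext i; rw [hw, e]; ring

lemma natDegree_aeval_le {K : Type*} [Field K] {k : ℕ} (f : MvPolynomial (Fin k) K) (g : Fin k → Polynomial K) (hg : ∀ i, (g i).natDegree ≤ 1) :
    (aeval g f).natDegree ≤ f.totalDegree := by
  rw [aeval_def, eval₂_eq']
  refine Polynomial.natDegree_sum_le_of_forall_le _ _ fun s hs => ?_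
  refine (Polynomial.natDegree_C_mul_le _ _).trans ((Polynomial.natDegree_prod_le _ _).trans ?_)
  refine le_trans (Finset.sum_le_sum fun i _ => (?_ : _ ≤ s i)) ?_
  · refine Polynomial.natDegree_pow_le.trans ?_
    nlinarith [hg i]
  · rw [← Finsupp.degree_eq_sum]; exact (totalDegree_le_iff_degree f _).1 le_rfl s hs

lemma zfiberK {K : Type*} [Field K] {k : ℕ} (f : MvPolynomial (Fin (k+1)) K) (d : ℕ) (hz : ZL f d) (t : Fin k → K)
    (Z : Finset (Fin (k+1) → K)) (ht : ∀ z ∈ Z, Fin.tail z = t) (hZ : ∀ z ∈ Z, eval z f = 0) :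
    Z.card ≤ d := by
  classical
  set P := Polynomial.map (eval t) (finSuccEquiv K k f) with hP
  have hc : P.coeff d = MvPolynomial.coeff (Finsupp.single 0 d) f := by
    rw [hP, Polynomial.coeff_map, hz.coeff]; simp
  have hP0 : P ≠ 0 := by
    intro h; rw [h] at hc; exact hz.2 (by simpa using hc.symm)
  have hd : P.natDegree ≤ d := (Polynomial.natDegree_map_le).trans hz.natDegree.le
  refine le_trans ?_ ((Polynomial.card_roots' P).trans hd)
  refine le_trans ?_ (Multiset.toFinset_card_le _)
  refine Finset.card_le_card_of_injOn (fun z => z 0) ?_ ?_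
  · intro z h
    simp only [Finset.mem_coe, Multiset.mem_toFinset]
    rw [Polynomial.mem_roots hP0, Polynomial.IsRoot, hP, ← ht z h]
    have := eval_eq_eval_mv_eval' (Fin.tail z) (z 0) f
    rw [Fin.cons_self_tail, hZ z h] at this
    exact this.symm
  · intro a ha b hb h
    simp at h
    rw [← Fin.cons_self_tail a, ← Fin.cons_self_tail b, ht a ha, ht b hb, h]

theorem slice_count (f g : MvPolynomial (Fin 3) ℚ) (d : ℕ) (hd : d ≠ 0)
    (hz : ZL f d) (hf : Irreducible f) (hfg : ¬ f ∣ g) (j j' : Fin 2) (hj : j ≠ j') : ∃ a : ℚ, a ≠ 0 ∧ 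
    ∀ U : Finset (Fin 3 → ℚ), (∀ u ∈ U, u j.succ = a ∧ eval u f = 0 ∧ eval u g = 0) → U.card ≤ d * (d + g.totalDegree)^2 := by
  classical
  have hjj : ∀ i : Fin 2, i = j ∨ i = j' := by
    revert j j'; decide
  obtain ⟨R, hR, hdeg, h⟩ := elim f g d hd hz hf hfg
  obtain ⟨w, -, hw⟩ := exists_small (R * X j) (mul_ne_zero hR (X_ne_zero j)) _ le_rfl
  rw [map_mul, mul_ne_zero_iff, eval_X] at hw
  refine ⟨w j, hw.2, fun U hU => ?_⟩
  let G : Fin 2 → Polynomial ℚ := fun i => if i = j then Polynomial.C (w j : ℚ) else Polynomial.X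
  set r : Polynomial ℚ := aeval G R with hr
  have hrev : ∀ u : Fin 2 → ℚ, u j = w j → r.eval (u j') = eval u R := by
    intro u hu
    rw [hr, ← Polynomial.coe_evalRingHom, ← AlgHom.coe_toRingHom, ← RingHom.comp_apply]
    congr 1
    apply MvPolynomial.ringHom_ext
    · intro c; simp
    · intro i
      rcases hjj i with rfl | rfl
      · simp [G, hu]
      · simp [G, hj.symm]
  have hr0 : r ≠ 0 := by
    intro h0
    have := hrev (fun i => w i) rfl
    rw [h0] at this; simp at this; exact hw.1 this.symm
  have hrd : r.natDegree ≤ (d + g.totalDegree)^2 := by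
    refine (natDegree_aeval_le R G fun i => ?_).trans hdeg
    by_cases hi : i = j <;> simp [G, hi]
  refine (card_le_fiber U (fun u => u j'.succ) r.roots.toFinset d ?_ ?_).trans (Nat.mul_le_mul_left _ 
    ((Multiset.toFinset_card_le _).trans ((Polynomial.card_roots' r).trans hrd)))
  · intro u hu
    obtain ⟨h1, h2, h3⟩ := hU u hu
    rw [Multiset.mem_toFinset, Polynomial.mem_roots hr0, Polynomial.IsRoot]
    exact (hrev (Fin.tail u) h1).trans (h u h2 h3)
  · intro t _
    refine zfiberK f d hz (fun i => if i = j then (w j : ℚ) else t) _ ?_ ?_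
    · intro z hz
      obtain ⟨h1, h2⟩ := Finset.mem_filter.1 hz
      ext i
      rcases hjj i with rfl | rfl
      · simp only [if_true]; exact (hU z h1).1
      · rw [if_neg hj.symm]; exact h2
    · intro z hz; exact (hU z (Finset.mem_filter.1 hz).1).2.1

lemma hom_zero0 {h : MvPolynomial (Fin 3) ℚ} {d : ℕ} (hh : h.IsHomogeneous d) (hz : ZL h d) (v : Fin 3 → ℤ) (hv : v ≠ 0) (h0 : eval (qz v) h = 0) : 
    v 1 ≠ 0 ∨ v 2 ≠ 0 := by
  by_contra! hcon
  have hv0 : v 0 ≠ 0 := by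
    intro h; apply hv; ext i; fin_cases i
    · exact h
    · exact hcon.1
    · exact hcon.2
  have e : qz v = fun i => (v 0 : ℚ) * (Pi.single 0 1 : Fin 3 → ℚ) i := by
    ext i; fin_cases i <;> simp [qz, hcon]
  rw [e, eval_hom_smul hh] at h0
  have := hz.eval_ne
  rw [homogeneousComponent_of_mem ((mem_homogeneousSubmodule _ _).2 hh), if_pos rfl] at this
  have h2 : ((v 0 : ℚ))^d ≠ 0 := pow_ne_zero _ (by exact_mod_cast hv0)
  exact mul_ne_zero h2 this h0

theorem hom_count (h g : MvPolynomial (Fin 3) ℚ) (d e : ℕ) (hd : d ≠ 0) (hh : h.IsHomogeneous d) (hg : g.IsHomogeneous e)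
    (hz : ZL h d) (hf : Irreducible h) (hfg : ¬ h ∣ g) (V : Finset (Fin 3 → ℤ)) 
    (hV : ∀ v ∈ V, v ≠ 0 ∧ prim v ∧ eval (qz v) h = 0 ∧ eval (qz v) g = 0) : V.card ≤ 4 * (d * (d + e)^2) := by
  classical
  have key : ∀ j j' : Fin 2, j ≠ j' → (V.filter fun v => v j.succ ≠ 0).card ≤ 2 * (d * (d+e)^2) := by
    intro j j' hj
    obtain ⟨a, ha, hU⟩ := slice_count h g d hd hz hf hfg j j' hj
    let φ : (Fin 3 → ℤ) → Fin 3 → ℚ := fun v i => (a / v j.succ) * v i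
    have h1 := card_le_fiber (V.filter fun v => v j.succ ≠ 0) φ ((V.filter fun v => v j.succ ≠ 0).image φ) 2 
      (fun z hz => Finset.mem_image_of_mem _ hz) (by
        intro t ht
        obtain ⟨v, hv, rfl⟩ := Finset.mem_image.1 ht
        refine (Finset.card_le_card (t := ({v, fun i => - v i} : Finset (Fin 3 → ℤ))) ?_).trans Finset.card_le_two
        intro w hw
        obtain ⟨hw1, hw2⟩ := Finset.mem_filter.1 hw
        obtain ⟨hv3, hv4⟩ := Finset.mem_filter.1 hv
        obtain ⟨hw3, hw4⟩ := Finset.mem_filter.1 hw1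
        have hv4' : (v j.succ : ℚ) ≠ 0 := by exact_mod_cast hv4
        have hw4' : (w j.succ : ℚ) ≠ 0 := by exact_mod_cast hw4
        rw [Finset.mem_insert, Finset.mem_singleton]
        refine prim.pm (hV v hv3).2.1 (hV w hw3).2.1 (w j.succ / v j.succ) fun i => ?_
        have := congrFun hw2 i
        simp only [φ] at this
        field_simp at this ⊢
        linarith)
    refine h1.trans (Nat.mul_le_mul_left _ ((hU _ ?_).trans ?_))
    · intro u hu
      obtain ⟨v, hv, rfl⟩ := Finset.mem_image.1 hu
      obtain ⟨hv3, hv4⟩ := Finset.mem_filter.1 hv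
      have hv4' : (v j.succ : ℚ) ≠ 0 := by exact_mod_cast hv4
      refine ⟨by simp only [φ]; field_simp, ?_, ?_⟩
      · have := eval_hom_smul hh (a / v j.succ) (qz v)
        rw [(hV v hv3).2.2.1, mul_zero] at this; exact this
      · have := eval_hom_smul hg (a / v j.succ) (qz v)
        rw [(hV v hv3).2.2.2, mul_zero] at this; exact this
    · gcongr
      exact hg.totalDegree_le
  have hsub : V ⊆ (V.filter fun v => v (0:Fin 2).succ ≠ 0) ∪ (V.filter fun v => v (1:Fin 2).succ ≠ 0) := by
    intro v hv
    obtain ⟨h1, h2, h3, h4⟩ := hV v hv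
    rcases hom_zero0 hh hz v h1 h3 with h | h
    · exact Finset.mem_union_left _ (Finset.mem_filter.2 ⟨hv, h⟩)
    · exact Finset.mem_union_right _ (Finset.mem_filter.2 ⟨hv, h⟩)
  have := (Finset.card_le_card hsub).trans (Finset.card_union_le _ _)
  have k1 := key 0 1 (by decide)
  have k2 := key 1 0 (by decide)
  omega

end DG

namespace DG
open MvPolynomial

lemma deg_weight {σ : Type*} (s : σ →₀ ℕ) : s.degree = Finsupp.weight (1 : σ → ℕ) s := by
  rw [Finsupp.degree_eq_weight_one]; rfl

lemma hom_iff {R σ : Type*} [CommSemiring R] {h : MvPolynomial σ R} {d : ℕ} : h.IsHomogeneous d ↔ ∀ s ∈ h.support, s.degree = d := by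
  constructor
  · intro hh s hs
    rw [deg_weight]; exact hh (mem_support_iff.1 hs)
  · intro hh s hs
    rw [← deg_weight]; exact hh s (mem_support_iff.2 hs)

/-- dehomogenisation -/
noncomputable def dh {R : Type*} [CommRing R] : MvPolynomial (Fin 3) R →ₐ[R] MvPolynomial (Fin 2) R := aeval ![X 0, X 1, 1]

lemma eval_dh {R : Type*} [CommRing R] (h : MvPolynomial (Fin 3) R) (x : Fin 2 → R) : eval x (dh h) = eval ![x 0, x 1, 1] h := by
  unfold dh
  rw [← AlgHom.coe_toRingHom, ← RingHom.comp_apply]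
  congr 1
  apply MvPolynomial.ringHom_ext
  · intro c; simp
  · intro i; fin_cases i <;> simp

lemma pderiv_dh {R : Type*} [CommRing R] (h : MvPolynomial (Fin 3) R) : pderiv 0 (dh h) = dh (pderiv 0 h) := by
  induction h using MvPolynomial.induction_on with
  | C a => simp [dh]
  | add p q hp hq => simp [hp, hq]
  | mul_X p i hp =>
    rw [map_mul, Derivation.leibniz, Derivation.leibniz, map_add, hp]
    fin_cases i <;> simp [dh, pderiv_X] 

lemma td_dh {R : Type*} [CommRing R] (h : MvPolynomial (Fin 3) R) : (dh h).totalDegree ≤ h.totalDegree := by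
  refine totalDegree_aeval_le h _ fun i => ?_
  fin_cases i
  · exact (totalDegree_monomial_le _ _).trans (by simp)
  · exact (totalDegree_monomial_le _ _).trans (by simp)
  · simp

lemma eval_hom_smulZ {k : ℕ} {h : MvPolynomial (Fin k) ℤ} {d : ℕ} (hh : h.IsHomogeneous d) (r : ℤ) (a : Fin k → ℤ) :
    eval (fun i => r * a i) h = r^d * eval a h := by
  rw [eval_eq', eval_eq', Finset.mul_sum]
  refine Finset.sum_congr rfl fun s hs => ?_
  have h1 : ∑ i, s i = d := by
    rw [← Finsupp.degree_eq_sum]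
    have := hh (mem_support_iff.1 hs)
    rw [← this, Finsupp.degree_eq_weight_one]; rfl
  simp only [mul_pow]
  rw [Finset.prod_mul_distrib, Finset.prod_pow_eq_pow_sum, h1]; ring

theorem conic_class (h : MvPolynomial (Fin 3) ℤ) (d : ℕ) (hd : 3 ≤ d) (hh : h.IsHomogeneous d) (hz : ZL (toQ h) d) (hirr : Irreducible (toQ h))
    (p W T : ℕ) (hp : p.Prime) (hW : W < p) (hT1 : 1 ≤ T) (hT : 720 * (T^2)^6 < W^15) (t : (Fin 3 → ℤ) → ℤ) (V : Finset (Fin 3 → ℤ))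
    (hV : ∀ v ∈ V, v ≠ 0 ∧ prim v ∧ eval v h = 0 ∧ inBox T v ∧ ¬ (p:ℤ) ∣ eval v (pderiv 0 h) ∧ (p:ℤ)^15 ∣ t v * v 2 - 1)
    (hcl : ∀ v ∈ V, ∀ w ∈ V, (p:ℤ) ∣ t v * v 0 - t w * w 0 ∧ (p:ℤ) ∣ t v * v 1 - t w * w 1) : V.card ≤ 4 * (d * (d+2)^2) := by
  classical
  let φ : ℕ × ℕ ↪ (Fin 3 →₀ ℕ) := ⟨fun t => Finsupp.equivFunOnFinite.symm ![t.1, t.2, 2 - t.1 - t.2], by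
    rintro ⟨a, b⟩ ⟨a', b'⟩ h
    have h0 := DFunLike.congr_fun h 0
    have h1 := DFunLike.congr_fun h 1
    simp at h0 h1; simp [h0, h1]⟩
  let J := (tri 2).map φ
  have hJc : J.card = 6 := by simp only [J, Finset.card_map]; rfl
  have hJd : ∀ s ∈ J, s 0 + s 1 + s 2 = 2 := by
    intro s hs
    obtain ⟨t, ht, rfl⟩ := Finset.mem_map.1 hs
    rw [mem_tri] at ht
    show t.1 + t.2 + (2 - t.1 - t.2) = 2
    omega
  have hpZ : Prime (p:ℤ) := Nat.prime_iff_prime_int.1 hp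
  have htp : ∀ v ∈ V, ¬ (p:ℤ) ∣ t v := by
    intro v hv hdv
    have h1 := (dvd_pow_self (p:ℤ) (by norm_num : 15 ≠ 0)).trans (hV v hv).2.2.2.2.2
    have h2 : (p:ℤ) ∣ 1 := by
      have := dvd_sub (hdv.mul_right (v 2)) h1
      simpa using this
    exact hpZ.not_dvd_one h2
  let Pt : (Fin 3 → ℤ) → Fin 2 → ℤ := fun v => ![t v * v 0, t v * v 1]
  have hcong : ∀ v ∈ V, ∀ i, (p:ℤ)^15 ∣ (fun i => t v * v i) i - (![Pt v 0, Pt v 1, 1] : Fin 3 → ℤ) i := by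
    intro v hv i
    fin_cases i
    · simp [Pt]
    · simp [Pt]
    · exact (hV v hv).2.2.2.2.2
  obtain ⟨c, hc0, hc⟩ := exists_of_det_zero (J := J) V (fun v s => ∏ i, (qz v i) ^ s.1 i) (by
    intro P hPV
    have hne : Nonempty J := ⟨⟨φ (0,0), Finset.mem_map_of_mem _ (by rw [mem_tri]; simp)⟩⟩
    obtain ⟨j0⟩ := hne
    have hP0 := hPV j0
    have h1 := class_det_dvd (m := 1) (dh h) p (Pt (P j0)) (by
        rw [isCoprime_comm, hpZ.coprime_iff_not_dvd, pderiv_dh, eval_dh]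
        intro hdv
        have h2 := (dvd_pow_self (p:ℤ) (by norm_num : 15 ≠ 0)).trans (eval_congr_mod (pderiv 0 h) _ _ _ (hcong _ hP0))
        have h3 := dvd_add h2 hdv
        rw [sub_add_cancel, eval_hom_smulZ (hh.pderiv)] at h3
        rcases hpZ.dvd_or_dvd h3 with h | h
        · exact htp _ hP0 (hpZ.dvd_of_dvd_pow h)
        · exact (hV _ hP0).2.2.2.2.1 h) 5 (fun i => Pt (P i)) (by
        intro i k
        obtain ⟨a1, a2⟩ := hcl _ (hPV i) _ hP0
        fin_cases k
        · exact a1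
        · exact a2) (by
        intro i
        rw [eval_dh]
        have h2 := eval_congr_mod h _ _ _ (hcong _ (hPV i))
        rw [eval_hom_smulZ hh, (hV _ (hPV i)).2.2.1, mul_zero, zero_sub, dvd_neg] at h2
        exact (pow_dvd_pow _ (by norm_num)).trans h2) (fun s : J => X 0 ^ (s.1 0) * X 1 ^ (s.1 1)) 15 (by
        simp only [ncard_exps1, Fintype.card_coe, hJc]
        decide)
    set D := (Matrix.of fun i (j : J) => ∏ k, P i k ^ j.1 k).det with hD
    have e1 : (p:ℤ)^15 ∣ (∏ i : J, (t (P i))^2) * D := by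
      rw [hD, ← Matrix.det_mul_column]
      have h1' : (((p:ℤ)^15 : ℤ)) ∣ _ := h1
      have hcast : ((p:ℤ)^15) = ((p^15 : ℕ) : ℤ) := by push_cast; rfl
      rw [hcast] at h1' ⊢
      rw [← ZMod.intCast_zmod_eq_zero_iff_dvd] at h1' ⊢
      rw [← h1', Int.cast_det, Int.cast_det]
      congr 1
      ext i j
      simp only [Matrix.map_apply, Matrix.of_apply]
      rw [← sub_eq_zero, ← Int.cast_sub, ZMod.intCast_zmod_eq_zero_iff_dvd, ← hcast]
      have h2 := eval_congr_mod (X 0 ^ (j.1 0) * X 1 ^ (j.1 1) * X 2 ^ (j.1 2)) _ _ _ (hcong _ (hPV i))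
      have h3 := hJd j.1 j.2
      simp only [map_mul, map_pow, eval_X] at h2
      convert h2 using 1
      have e2 : t (P i)^2 = t (P i)^(j.1 0) * t (P i)^(j.1 1) * t (P i)^(j.1 2) := by rw [← pow_add, ← pow_add, h3]
      rw [Fin.prod_univ_three, e2]
      simp
      ring
    have e2 : (p:ℤ)^15 ∣ D := by
      refine (IsCoprime.pow_left (m := 15) ?_).dvd_of_dvd_mul_left e1
      refine IsCoprime.prod_right fun i _ => IsCoprime.pow_right ?_
      rw [hpZ.coprime_iff_not_dvd]
      exact htp _ (hPV i)
    have e3 : |D| ≤ ((720 * (T^2)^6 : ℕ) : ℤ) := by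
      have := det_abs_le (Matrix.of fun i (j : J) => ∏ k, P i k ^ j.1 k) (fun _ => T^2) (by
        intro i j
        refine monomial_le (P i) T 2 hT1 (hV _ (hPV i)).2.2.2.1 j.1 ?_
        rw [Finsupp.degree_eq_sum, Fin.sum_univ_three, hJd _ j.2])
      refine this.trans ?_
      rw [Fintype.card_coe, hJc, Finset.prod_const, Finset.card_univ, Fintype.card_coe, hJc]
      rfl
    have e4 : D = 0 := by
      refine Int.eq_zero_of_abs_lt_dvd e2 (e3.trans_lt ?_)
      have : 720 * (T^2)^6 < p^15 := hT.trans_le (Nat.pow_le_pow_left hW.le _)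
      exact_mod_cast this
    have e5 : (Matrix.of fun i (j : J) => ∏ k, (qz (P i) k)^ j.1 k).det = ((D : ℤ) : ℚ) := by
      rw [hD, Int.cast_det]
      congr 1
      ext i j
      simp [qz]
    rw [e5, e4]; simp)
  obtain ⟨g, h1, h2, h3⟩ := poly_of_coeffs J c hc0
  have hgh : g.IsHomogeneous 2 := by
    intro s hs
    have := hJd s (h2 (mem_support_iff.2 hs))
    rw [← deg_weight]
    rw [Finsupp.degree_eq_sum, Fin.sum_univ_three, this]
  refine hom_count (toQ h) g d 2 (by omega) (hh.map _) hgh hz hirr ?_ V fun v hv => ⟨(hV v hv).1, (hV v hv).2.1, ?_, ?_⟩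
  · refine not_dvd_of_deg _ g d hz h1 fun s hs => ?_
    have := hJd s (h2 hs)
    omega
  · rw [eval_toQ, (hV v hv).2.2.1]; simp
  · rw [h3]; exact hc v hv
end DG

namespace DG
open MvPolynomial

lemma bad_small {k : ℕ} (g : MvPolynomial (Fin (k+1)) ℤ) (d Y E : ℕ) (hY : d + 1 ≤ Y) (hY2 : 2 ≤ Y) (hgd : g.totalDegree ≤ d)
    (hgc : ∀ s, |coeff s g| ≤ ((((d+1)^(k+1) * (Y^E)^d)^((d+1)^(k+1)) : ℕ) : ℤ)) (P : Finset ℕ) (hP : ∀ p ∈ P, p.Prime ∧ Y < p) :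
    ∀ z, inBox (Y^E) z → eval z (pderiv 0 g) ≠ 0 →
        (P.filter fun p : ℕ => (p:ℤ) ∣ eval z (pderiv 0 g)).card ≤ bet (k+1) E d := by
  intro z hzb hne
  have hB1 : 1 ≤ Y^E := Nat.one_le_pow _ _ (by omega)
  refine bad_card P Y _ (by omega) hP _ hne ?_
  set c := ((d+1)^(k+1) * (Y^E)^d)^((d+1)^(k+1)) with hc
  have h1 := eval_abs_le (pderiv 0 g) z (Y^E) d (c * Y) hB1 hzb
    ((totalDegree_pderiv_le g 0).trans (by omega)) (by
      intro s
      rw [coeff_pderiv]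
      by_cases h0 : coeff (s + Finsupp.single 0 1) g = 0
      · rw [h0]; simp only [zero_mul, abs_zero]; positivity
      have h2 := (totalDegree_le_iff_degree g d).1 hgd _ (mem_support_iff.2 h0)
      simp only [map_add, Finsupp.degree_single] at h2
      have h3 : s 0 ≤ s.degree := Finsupp.le_degree 0 s
      rw [abs_mul]; push_cast
      have h4 := hgc (s + Finsupp.single 0 1)
      have h5 : |((s 0 : ℤ) + 1)| ≤ (Y:ℤ) := by rw [abs_of_nonneg (by positivity)]; omega
      exact mul_le_mul h4 h5 (abs_nonneg _) (by positivity))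
  refine h1.trans ?_
  have h6 : (d+1)^(k+1) ≤ Y^(k+1) := Nat.pow_le_pow_left hY _
  have h7 : (d+1)^(k+1) * (Y^E)^d ≤ Y^(k+1+E*d) := by
    rw [pow_add Y, ← pow_mul]; exact Nat.mul_le_mul_right _ h6
  have h8 : c ≤ Y^((k+1+E*d)*(d+1)^(k+1)) := by
    rw [pow_mul, hc]; exact Nat.pow_le_pow_left h7 _
  have : (d+1)^(k+1) * (c*Y) * (Y^E)^d ≤ Y^(bet (k+1) E d) := by
    calc _ = ((d+1)^(k+1) * (Y^E)^d) * Y * c := by ring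
      _ ≤ Y^(k+1+E*d) * Y * Y^((k+1+E*d)*(d+1)^(k+1)) := by gcongr
      _ = _ := by unfold bet; rw [← pow_succ, ← pow_add]; congr 1; ring
  exact_mod_cast this

lemma prop_of_dvd {k : ℕ} (f : MvPolynomial (Fin (k+1)) ℚ) (g : MvPolynomial (Fin (k+1)) ℚ) (hg : g ≠ 0) (hd : g.totalDegree ≤ f.totalDegree) (hf : f ≠ 0) (h : f ∣ g) :
    ∃ c : ℚ, c ≠ 0 ∧ g = C c * f := by
  obtain ⟨w, hw⟩ := h
  have hw0 : w ≠ 0 := by rintro rfl; apply hg; rw [hw]; simp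
  have ht : w.totalDegree = 0 := by
    rw [hw, totalDegree_mul_of_isDomain hf hw0] at hd
    omega
  rw [totalDegree_eq_zero_iff_eq_C] at ht
  refine ⟨coeff 0 w, ?_, ?_⟩
  · intro h; apply hw0; rw [ht, h]; simp
  · rw [hw, ← ht, mul_comm]

def kD (d : ℕ) : ℕ := bet 3 2 d + 3

/-- one prime -/
theorem dir_prime (h : MvPolynomial (Fin 3) ℤ) (d : ℕ) (hd : 3 ≤ d) (hh : h.IsHomogeneous d) (hz : ZL (toQ h) d) (hirr : Irreducible (toQ h))
    (p W T : ℕ) (hp : p.Prime) (hW : W < p) (hW8 : p ≤ 8*W) (hT1 : 1 ≤ T) (hT : 720 * (T^2)^6 < W^15) (V : Finset (Fin 3 → ℤ))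
    (hV : ∀ v ∈ V, v ≠ 0 ∧ prim v ∧ eval v h = 0 ∧ inBox T v ∧ ¬ (p:ℤ) ∣ eval v (pderiv 0 h) ∧ ¬ (p:ℤ) ∣ v 2) :
    V.card ≤ (4 * (d * (d+2)^2)) * (d * (8*W)) := by
  classical
  have hpZ : Prime (p:ℤ) := Nat.prime_iff_prime_int.1 hp
  have ht : ∀ v : Fin 3 → ℤ, ∃ t : ℤ, ¬ (p:ℤ) ∣ v 2 → (p:ℤ)^15 ∣ t * v 2 - 1 := by
    intro v
    by_cases hv : (p:ℤ) ∣ v 2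
    · exact ⟨0, fun h => absurd hv h⟩
    · have : IsCoprime ((p:ℤ)^15) (v 2) := IsCoprime.pow_left ((hpZ.coprime_iff_not_dvd).2 hv)
      obtain ⟨a, b, hab⟩ := this
      exact ⟨b, fun _ => ⟨-a, by linarith⟩⟩
  choose t ht using ht
  let Pt : (Fin 3 → ℤ) → Fin 2 → ℤ := fun v => ![t v * v 0, t v * v 1]
  have htp : ∀ v ∈ V, ¬ (p:ℤ) ∣ t v := by
    intro v hv hdv
    have h1 := (dvd_pow_self (p:ℤ) (by norm_num : 15 ≠ 0)).trans (ht v (hV v hv).2.2.2.2.2)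
    have h2 : (p:ℤ) ∣ 1 := by
      have := dvd_sub (hdv.mul_right (v 2)) h1
      simpa using this
    exact hpZ.not_dvd_one h2
  have hcong : ∀ v ∈ V, ∀ i, (p:ℤ) ∣ (fun i => t v * v i) i - (![Pt v 0, Pt v 1, 1] : Fin 3 → ℤ) i := by
    intro v hv i
    fin_cases i
    · simp [Pt]
    · simp [Pt]
    · exact (dvd_pow_self (p:ℤ) (by norm_num : 15 ≠ 0)).trans (ht v (hV v hv).2.2.2.2.2)
  have hcc := class_count (k := 1) (dh h) d W ((td_dh h).trans ((totalDegree_toQ h).symm.trans hz.1).le) (V.image Pt) {p} 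
    (by intro q hq; rw [Finset.mem_singleton] at hq; subst hq; exact ⟨hp, hW8⟩) (by
      intro z hz q hq
      rw [Finset.mem_singleton] at hq; subst hq
      obtain ⟨v, hv, rfl⟩ := Finset.mem_image.1 hz
      rw [pderiv_dh, eval_dh, eval_dh]
      constructor
      · have h2 := eval_congr_mod h _ _ _ (hcong v hv)
        rw [eval_hom_smulZ hh, (hV v hv).2.2.1, mul_zero, zero_sub, dvd_neg] at h2
        exact h2
      · intro hdv
        have h3 := dvd_add (eval_congr_mod (pderiv 0 h) _ _ _ (hcong v hv)) hdv
        rw [sub_add_cancel, eval_hom_smulZ (hh.pderiv)] at h3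
        rcases hpZ.dvd_or_dvd h3 with h | h
        · exact htp _ hv (hpZ.dvd_of_dvd_pow h)
        · exact (hV _ hv).2.2.2.2.1 h)
  have hq : qq {p} = p := by simp [qq]
  rw [hq, Finset.card_singleton, pow_one, pow_one, Finset.image_image] at hcc
  refine (card_le_fiber V (cl p ∘ Pt) _ (4 * (d * (d+2)^2)) (fun z hz => Finset.mem_image_of_mem _ hz) ?_).trans (Nat.mul_le_mul_left _ hcc)
  intro x _
  refine conic_class h d hd hh hz hirr p W T hp hW hT1 hT t _ ?_ ?_
  · intro v hv
    obtain ⟨h1, h2, h3, h4, h5, h6⟩ := hV v (Finset.mem_filter.1 hv).1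
    exact ⟨h1, h2, h3, h4, h5, ht v h6⟩
  · intro v hv w hw
    have h1 := (Finset.mem_filter.1 hv).2
    have h2 := (Finset.mem_filter.1 hw).2
    have h3 := (cl_eq_iff p (Pt v) (Pt w)).1 (h1.trans h2.symm)
    exact ⟨h3 0, h3 1⟩

theorem dir_count : ∃ Y1 : ℕ, ∀ (h : MvPolynomial (Fin 3) ℤ) (d : ℕ) (_ : 3 ≤ d) (_ : h.IsHomogeneous d) (_ : ZL (toQ h) d) (_ : Irreducible (toQ h))
    (W T : ℕ) (_ : Y1 ≤ W) (_ : d + 1 ≤ W) (_ : kD d ^2 ≤ W) (_ : 1 ≤ T) (_ : 720 * (T^2)^6 < W^15) (_ : T ≤ W^2) (V : Finset (Fin 3 → ℤ))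
    (_ : ∀ v ∈ V, v ≠ 0 ∧ prim v ∧ eval v h = 0 ∧ inBox T v), 
    V.card ≤ 12 * (d*(d+d)^2) + kD d * ((4 * (d * (d+2)^2)) * (d * (8*W))) := by
  classical
  obtain ⟨Y1, hY1⟩ := primes_exist
  refine ⟨Y1, ?_⟩
  intro h d hd hh hz hirr W T hW1 hWd hWk hT1 hT hTW V hV
  obtain ⟨P, hPc, hP⟩ := hY1 W hW1 (kD d) hWk
  have hbox : ∀ v ∈ V, inBox (W^2) v := fun v hv i => ((hV v hv).2.2.2 i).trans (by exact_mod_cast hTW)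
  obtain ⟨A0, hA0, hmem0⟩ := card_deg_le 3 d
  set A := A0.filter fun s => s.degree = d with hA
  have hmem : ∀ s, s ∈ A ↔ s.degree = d := fun s => by rw [hA, Finset.mem_filter, hmem0]; constructor <;> intro h <;> [exact h.2; exact ⟨h.le, h⟩]
  have hAc : A.card ≤ (d+1)^3 := (Finset.card_filter_le _ _).trans hA0
  have hB1 : 1 ≤ W^2 := Nat.one_le_pow _ _ (by omega)
  have hsup : (toQ h).support ⊆ A := fun s hs => (hmem s).2 (hom_iff.1 (hh.map _) s hs)
  have hVz : ∀ v ∈ V, eval (qz v) (toQ h) = 0 := fun v hv => by rw [eval_toQ, (hV v hv).2.2.1]; simp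
  obtain ⟨g, hg0, hgA, hgV, hgc⟩ := hb V A ((W^2)^d) (Nat.one_le_pow _ _ hB1) 
    (fun z hz s hs => monomial_le z (W^2) d hB1 (hbox z hz) s ((hmem s).1 hs).le) (toQ h) hirr.ne_zero hsup hVz
  have hgh : g.IsHomogeneous d := hom_iff.2 fun s hs => (hmem s).1 (hgA hs)
  by_cases hdv : toQ h ∣ toQ g
  swap
  · have := hom_count (toQ h) (toQ g) d d (by omega) (hh.map _) (hgh.map _) hz hirr hdv V fun v hv => 
      ⟨(hV v hv).1, (hV v hv).2.1, hVz v hv, by rw [eval_toQ, hgV v hv]; simp⟩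
    refine this.trans ((Nat.mul_le_mul_right _ (by norm_num)).trans (Nat.le_add_right _ _))
  obtain ⟨c, hc, hgc'⟩ := prop_of_dvd (toQ h) (toQ g) (toQ_ne_zero hg0) (by rw [hz.1]; exact (hgh.map _).totalDegree_le) hirr.ne_zero hdv
  have hz' : ZL (toQ g) d := by rw [hgc']; exact hz.smul c hc
  have hirr' : Irreducible (toQ g) := by rw [hgc']; exact irr_smul hirr c hc
  have hVz' : ∀ v ∈ V, eval (qz v) (toQ g) = 0 := fun v hv => by rw [eval_toQ, hgV v hv]; simp
  -- exceptional sets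
  have hV0 : (V.filter fun v => v 2 = 0).card ≤ 4 * (d*(d+d)^2) := by
    have := hom_count (toQ g) (X 2) d 1 (by omega) (hgh.map _) (isHomogeneous_X _ _) hz' hirr' (by
      refine not_dvd_of_deg _ _ d hz' (X_ne_zero _) fun s hs => ?_
      rw [support_X, Finset.mem_singleton] at hs
      rw [hs]; simp; omega) (V.filter fun v => v 2 = 0) (by
      intro v hv
      obtain ⟨h1, h2⟩ := Finset.mem_filter.1 hv
      exact ⟨(hV v h1).1, (hV v h1).2.1, hVz' v h1, by simp [qz, h2]⟩)
    refine this.trans ?_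
    gcongr; omega
  have hV1 : (V.filter fun v => eval v (pderiv 0 g) = 0).card ≤ 4 * (d*(d+d)^2) := by
    have := hom_count (toQ g) (pderiv 0 (toQ g)) d (d-1) (by omega) (hgh.map _) (hgh.map _).pderiv hz' hirr' 
      (not_dvd_pderiv _ d (by omega) hz').2 (V.filter fun v => eval v (pderiv 0 g) = 0) (by
      intro v hv
      obtain ⟨h1, h2⟩ := Finset.mem_filter.1 hv
      exact ⟨(hV v h1).1, (hV v h1).2.1, hVz' v h1, by rw [← pderiv_toQ, eval_toQ, h2]; simp⟩)
    refine this.trans ?_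
    gcongr; omega
  let Vp : ℕ → Finset (Fin 3 → ℤ) := fun p => V.filter fun v => ¬ (p:ℤ) ∣ eval v (pderiv 0 g) ∧ ¬ (p:ℤ) ∣ v 2
  have hcov : V ⊆ ((V.filter fun v => v 2 = 0) ∪ (V.filter fun v => eval v (pderiv 0 g) = 0)) ∪ P.biUnion Vp := by
    intro v hv
    by_cases h1 : v 2 = 0
    · exact Finset.mem_union_left _ (Finset.mem_union_left _ (Finset.mem_filter.2 ⟨hv, h1⟩))
    by_cases h2 : eval v (pderiv 0 g) = 0
    · exact Finset.mem_union_left _ (Finset.mem_union_right _ (Finset.mem_filter.2 ⟨hv, h2⟩))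
    have b1 := bad_small g d W 2 hWd (by omega) hgh.totalDegree_le (by
      intro s
      refine (hgc s).trans ?_
      have : (A.card * (W^2)^d)^A.card ≤ ((d+1)^(2+1) * (W^2)^d)^((d+1)^(2+1)) := by
        have q1 : 1 ≤ (d+1)^(2+1) * (W^2)^d := Nat.mul_pos (by positivity) (by positivity)
        calc _ ≤ ((d+1)^(2+1) * (W^2)^d)^A.card := Nat.pow_le_pow_left (Nat.mul_le_mul_right _ hAc) _
          _ ≤ _ := Nat.pow_le_pow_right q1 hAc
      exact_mod_cast this) P (fun p hp => ⟨(hP p hp).1, (hP p hp).2.1⟩) v (hbox v hv) h2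
    have b2 := bad_card P W 2 (by omega) (fun p hp => ⟨(hP p hp).1, (hP p hp).2.1⟩) (v 2) h1 (by exact_mod_cast hbox v hv 2)
    obtain ⟨p, hp, hp1⟩ : ∃ p ∈ P, p ∉ (P.filter fun p : ℕ => (p:ℤ) ∣ eval v (pderiv 0 g)) ∪ (P.filter fun p : ℕ => (p:ℤ) ∣ v 2) := by
      by_contra! hcon
      have := (Finset.card_le_card (show P ⊆ _ from hcon)).trans (Finset.card_union_le _ _)
      rw [hPc, kD] at this
      have b1' : _ ≤ bet 3 2 d := b1
      omega
    rw [Finset.mem_union, not_or, Finset.mem_filter, Finset.mem_filter] at hp1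
    exact Finset.mem_union_right _ (Finset.mem_biUnion.2 ⟨p, hp, Finset.mem_filter.2 ⟨hv, fun h => hp1.1 ⟨hp, h⟩, fun h => hp1.2 ⟨hp, h⟩⟩⟩)
  have hVp : (P.biUnion Vp).card ≤ kD d * ((4 * (d * (d+2)^2)) * (d * (8*W))) := by
    rw [← hPc]
    refine Finset.card_biUnion_le_card_mul _ _ _ fun p hp => ?_
    refine dir_prime g d hd hgh hz' hirr' p W T (hP p hp).1 (hP p hp).2.1 (hP p hp).2.2 hT1 hT _ fun v hv => ?_
    obtain ⟨h1, h2, h3⟩ := Finset.mem_filter.1 hv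
    exact ⟨(hV v h1).1, (hV v h1).2.1, hgV v h1, (hV v h1).2.2.2, h2, h3⟩
  have := (Finset.card_le_card hcov).trans ((Finset.card_union_le _ _).trans (Nat.add_le_add_right (Finset.card_union_le _ _) _))
  omega

end DG

namespace DG
open MvPolynomial

lemma hc_mul {K : Type*} [Field K] [CharZero K] {k : ℕ} (a b : MvPolynomial (Fin k) K) (m n : ℕ) (ha : a.totalDegree ≤ m) (hb : b.totalDegree ≤ n) :
    homogeneousComponent (m+n) (a*b) = homogeneousComponent m a * homogeneousComponent n b := by
  apply MvPolynomial.funext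
  intro v
  have hab : (a*b).totalDegree ≤ m + n := (totalDegree_mul _ _).trans (by omega)
  rw [map_mul (eval v), ← coeff_aff (a*b) _ hab v 0, ← coeff_aff a m ha v 0, ← coeff_aff b n hb v 0, map_mul]
  have hl : ∀ i, (Polynomial.C (v i) * Polynomial.X + Polynomial.C ((0 : Fin k → K) i)).natDegree ≤ 1 := fun i => Polynomial.natDegree_linear_le
  exact Polynomial.coeff_mul_add_eq_of_natDegree_le ((natDegree_aeval_le a _ hl).trans ha) ((natDegree_aeval_le b _ hl).trans hb)

lemma isUnit_of_td {K : Type*} [Field K] {σ : Type*} {a : MvPolynomial σ K} (h0 : a ≠ 0) (h : a.totalDegree = 0) : IsUnit a := by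
  rw [totalDegree_eq_zero_iff_eq_C] at h
  rw [h]
  refine (isUnit_iff_ne_zero.2 ?_).map C
  intro h1; apply h0; rw [h, h1]; simp

lemma td_of_isUnit {K : Type*} [Field K] {σ : Type*} {a : MvPolynomial σ K} (h : IsUnit a) : a.totalDegree = 0 := by
  obtain ⟨b, hb⟩ := h.exists_right_inv
  have h1 : a ≠ 0 := h.ne_zero
  have h2 : b ≠ 0 := by rintro rfl; simp at hb
  have := totalDegree_mul_of_isDomain h1 h2
  rw [hb, totalDegree_one] at this; omega

lemma irr_of_td {K : Type*} [Field K] {σ : Type*} {f : MvPolynomial σ K} (h0 : 1 ≤ f.totalDegree) 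
    (h : ∀ a b, f = a * b → a ≠ 0 → b ≠ 0 → a.totalDegree = 0 ∨ b.totalDegree = 0) : Irreducible f := by
  refine ⟨fun hu => by have := td_of_isUnit hu; omega, fun a b hab => ?_⟩
  have hf : f ≠ 0 := by rintro rfl; simp at h0
  rw [hab, mul_ne_zero_iff] at hf
  rcases h a b hab hf.1 hf.2 with e | e
  · exact Or.inl (isUnit_of_td hf.1 e)
  · exact Or.inr (isUnit_of_td hf.2 e)

lemma td_of_irr {K : Type*} [Field K] {σ : Type*} {f a b : MvPolynomial σ K} (h : Irreducible f) (hab : f = a * b) :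
    a.totalDegree = 0 ∨ b.totalDegree = 0 := by
  rcases h.isUnit_or_isUnit hab with e | e
  · exact Or.inl (td_of_isUnit e)
  · exact Or.inr (td_of_isUnit e)

lemma irr_of_top {K : Type*} [Field K] [CharZero K] {k : ℕ} {f : MvPolynomial (Fin k) K} {d : ℕ} (hd : f.totalDegree = d) 
    (h : Irreducible (homogeneousComponent d f)) : Irreducible f := by
  have hdd : (homogeneousComponent d f).totalDegree = d := (homogeneousComponent_isHomogeneous d f).totalDegree h.ne_zero
  have h1 := td_pos_of_irr h
  refine irr_of_td (by omega) fun a b hab ha hb => ?_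
  have e : d = a.totalDegree + b.totalDegree := by rw [← hd, hab, totalDegree_mul_of_isDomain ha hb]
  have := hc_mul a b _ _ le_rfl le_rfl
  rw [← e, ← hab] at this
  rcases td_of_irr h this with e | e
  · rw [(homogeneousComponent_isHomogeneous _ a).totalDegree (top_ne_zero ha)] at e; exact Or.inl e
  · rw [(homogeneousComponent_isHomogeneous _ b).totalDegree (top_ne_zero hb)] at e; exact Or.inr e

lemma td_map {K L : Type*} [Field K] [Field L] (φ : K →+* L) {σ : Type*} (f : MvPolynomial σ K) : (map φ f).totalDegree = f.totalDegree := by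
  unfold totalDegree
  rw [support_map_of_injective f φ.injective]

lemma irr_of_map {K L : Type*} [Field K] [Field L] (φ : K →+* L) {σ : Type*} {f : MvPolynomial σ K} (h : Irreducible (map φ f)) : Irreducible f := by
  have := td_pos_of_irr h
  rw [td_map] at this
  refine irr_of_td this fun a b hab _ _ => ?_
  have := td_of_irr h (a := map φ a) (b := map φ b) (by rw [hab, map_mul])
  rwa [td_map, td_map] at this

lemma eval_line {K : Type*} [Field K] {k : ℕ} (f : MvPolynomial (Fin k) K) (a b : Fin k → K) (t : K) :
    (aeval (fun i => Polynomial.C (a i) * Polynomial.X + Polynomial.C (b i)) f).eval t = eval (fun i => b i + t * a i) f := by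
  rw [← Polynomial.coe_evalRingHom, ← AlgHom.coe_toRingHom, ← RingHom.comp_apply]
  congr 1
  apply MvPolynomial.ringHom_ext
  · intro; simp
  · intro i; simp; ring

/-- a polynomial constant on all naturals is constant -/
lemma poly_const {K : Type*} [Field K] [CharZero K] (p : Polynomial K) (c : K) (h : ∀ n : ℕ, p.eval (n : K) = c) : p = Polynomial.C c := by
  apply Polynomial.eq_of_infinite_eval_eq
  refine Set.Infinite.mono (s := Set.range (fun n : ℕ => (n : K))) ?_ (Set.infinite_range_of_injective Nat.cast_injective)
  rintro _ ⟨n, rfl⟩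
  simp [h n]

lemma no_linear {K : Type*} [Field K] [CharZero K] {k : ℕ} {h : MvPolynomial (Fin (k+1)) K} {d : ℕ} (hd : 2 ≤ d) (hz : ZL h d) (hirr : Irreducible h)
    (r : MvPolynomial (Fin k) K) (hr : ∀ x : Fin k → K, eval (Fin.cons (eval x r) x : Fin (k+1) → K) h = 0) : False := by
  have h1 : (finSuccEquiv K k h).eval r = 0 := by
    apply MvPolynomial.funext
    intro x
    have := eval_eq_eval_mv_eval' x (eval x r) h
    rw [hr x] at this
    rw [map_zero, this, Polynomial.eval_map, Polynomial.eval₂_hom]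
  have h2 : Polynomial.X - Polynomial.C r ∣ finSuccEquiv K k h := Polynomial.dvd_iff_isRoot.2 h1
  obtain ⟨q, hq⟩ := h2
  have h3 : Irreducible (finSuccEquiv K k h) := (MulEquiv.irreducible_iff (finSuccEquiv K k)).2 hirr
  have hnd := hz.natDegree
  rcases h3.isUnit_or_isUnit hq with e | e
  · have := Polynomial.natDegree_eq_zero_of_isUnit e
    simp at this
  · have h4 := Polynomial.natDegree_eq_zero_of_isUnit e
    rw [hq] at hnd
    have := Polynomial.natDegree_mul_le (p := Polynomial.X - Polynomial.C r) (q := q)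
    rw [Polynomial.natDegree_X_sub_C] at this; omega

theorem cyl (F : MvPolynomial (Fin 3) ℂ) (d : ℕ) (hd : 2 ≤ d) (hz : ZL F d) (hirr : Irreducible (homogeneousComponent d F))
    (v : Fin 3 → ℂ) (j j' : Fin 2) (hj : j ≠ j') (hv : v j.succ ≠ 0) (hs : ∀ w, eval (fun i => w i + v i) F = eval w F) : False := by
  have hjj : ∀ i : Fin 2, i = j ∨ i = j' := by
    clear hv
    revert j j'; decide
  set h := homogeneousComponent d F with hh
  have hhom : h.IsHomogeneous d := homogeneousComponent_isHomogeneous d F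
  have hzh : ZL h d := by
    refine ZL.of_le hhom.totalDegree_le ?_
    rw [homogeneousComponent_of_mem ((mem_homogeneousSubmodule _ _).2 hhom), if_pos rfl]
    exact hz.eval_ne
  have s1 : ∀ w (n : ℕ), eval (fun i => w i + n * v i) F = eval w F := by
    intro w n
    induction n with
    | zero => simp
    | succ n ih => 
      rw [← ih, ← hs (fun i => w i + n * v i)]
      congr 2
      ext i; push_cast; ring
  have s2 : ∀ w (t : ℂ), eval (fun i => w i + t * v i) F = eval w F := by
    intro w t
    have := poly_const (aeval (fun i => Polynomial.C (v i) * Polynomial.X + Polynomial.C (w i)) F) (eval w F) fun n => by rw [eval_line, s1]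
    rw [← eval_line, this]
    simp
  have s3 : ∀ w (t : ℂ), eval (fun i => w i + t * v i) h = eval w h := by
    intro w t
    rw [hh, ← coeff_aff F d hz.1.le w 0, ← coeff_aff F d hz.1.le _ 0]
    have : aeval (fun i => Polynomial.C (w i + t * v i) * Polynomial.X + Polynomial.C ((0 : Fin 3 → ℂ) i)) F =
        aeval (fun i => Polynomial.C (w i) * Polynomial.X + Polynomial.C ((0 : Fin 3 → ℂ) i)) F := by
      apply Polynomial.funext
      intro T
      rw [eval_line F (fun i => w i + t * v i) 0, eval_line F w 0, ← s2 (fun i => (0 : Fin 3 → ℂ) i + T * w i) (T * t)]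
      have e : (fun i => (0 : Fin 3 → ℂ) i + T * (w i + t * v i)) = fun i => (0 : Fin 3 → ℂ) i + T * w i + T * t * v i := by
        ext i; simp; ring
      rw [e]
    rw [this]
  -- a root
  set e : Fin 2 → ℂ := Pi.single j' 1 with he
  obtain ⟨ζ, hζ⟩ : ∃ ζ : ℂ, eval (Fin.cons ζ e : Fin 3 → ℂ) h = 0 := by
    set P := Polynomial.map (eval e) (finSuccEquiv ℂ 2 h) with hP
    have hc : P.coeff d ≠ 0 := by
      rw [hP, Polynomial.coeff_map, hzh.coeff]; simpa using hzh.2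
    have hdeg : P.degree ≠ 0 := by
      intro h0
      have := Polynomial.le_degree_of_ne_zero hc
      rw [h0] at this
      have : d ≤ 0 := by exact_mod_cast this
      omega
    obtain ⟨ζ, hζ⟩ := IsAlgClosed.exists_root P hdeg
    exact ⟨ζ, by rw [eval_eq_eval_mv_eval']; exact hζ⟩
  -- x = lam e_{j'} + τ tail v ; τ = x j / v j
  refine no_linear hd hzh hirr (C ζ * (X j' - C (v j'.succ / v j.succ) * X j) + C (v 0 / v j.succ) * X j) fun x => ?_
  have e1 : (Fin.cons (eval x (C ζ * (X j' - C (v j'.succ / v j.succ) * X j) + C (v 0 / v j.succ) * X j)) x : Fin 3 → ℂ) = 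
    fun i => (x j' - v j'.succ / v j.succ * x j) * (Fin.cons ζ e : Fin 3 → ℂ) i + (x j / v j.succ) * v i := by
    ext i
    refine Fin.cases ?_ (fun i => ?_) i
    · simp; ring
    · simp only [Fin.cons_succ, he]
      rcases hjj i with rfl | rfl
      · simp [hj]; field_simp
      · simp [hj]; field_simp; ring
  rw [e1, s3, eval_hom_smul hhom, hζ, mul_zero]

noncomputable def toC {k : ℕ} (f : MvPolynomial (Fin k) ℤ) : MvPolynomial (Fin k) ℂ := map (Int.castRingHom ℂ) f

lemma toC_eq {k : ℕ} (f : MvPolynomial (Fin k) ℤ) : toC f = map (algebraMap ℚ ℂ) (toQ f) := by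
  rw [toC, toQ, map_map]
  congr 1

theorem not_dvd_shift (f : MvPolynomial (Fin 3) ℤ) (d : ℕ) (hd : 2 ≤ d) (hz : ZL (toQ f) d) (hirr : Irreducible (homogeneousComponent d (toC f)))
    (v : Fin 3 → ℤ) (j j' : Fin 2) (hj : j ≠ j') (hv : v j.succ ≠ 0) : ¬ toQ f ∣ aeval (fun i => X i + C (v i : ℚ)) (toQ f) := by
  set F := toQ f with hF
  rintro ⟨q, hq⟩
  have hlin : ∀ i : Fin 3, (X i + C (v i : ℚ) : MvPolynomial (Fin 3) ℚ).totalDegree ≤ 1 := fun i => by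
    refine (totalDegree_add _ _).trans ?_
    rw [totalDegree_X, totalDegree_C]; simp
  have hF0 : F ≠ 0 := by intro h; apply hz.2; rw [h]; simp
  have htd := totalDegree_aeval_le F _ hlin
  have e1 : eval (Pi.single 0 1) (homogeneousComponent d (aeval (fun i => X i + C (v i : ℚ)) F)) = eval (Pi.single 0 1) (homogeneousComponent d F) := by
    rw [top_aeval F d hz.1.le _ hlin]
    congr 2
    ext i
    rw [map_add, hom1_X, hom1_C]; simp
  have hq0 : q ≠ 0 := by
    rintro rfl
    rw [hq] at e1
    exact hz.eval_ne (by rw [← e1]; simp)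
  have hqd : q.totalDegree = 0 := by
    rw [hq, totalDegree_mul_of_isDomain hF0 hq0] at htd; omega
  rw [totalDegree_eq_zero_iff_eq_C] at hqd
  set c := coeff 0 q
  have hc : c = 1 := by
    rw [hq, hqd, mul_comm, homogeneousComponent_C_mul, map_mul, eval_C] at e1
    exact mul_right_cancel₀ hz.eval_ne (by rw [e1, one_mul])
  rw [hqd, hc, C_1, mul_one] at hq
  have e2 := congrArg (map (algebraMap ℚ ℂ)) hq
  rw [hF, ← toC_eq] at e2
  refine cyl (toC f) d hd ?_ hirr (fun i => (v i : ℂ)) j j' hj (by exact_mod_cast hv) fun w => ?_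
  · refine ⟨?_, ?_⟩
    · rw [toC_eq, td_map]; exact hz.1
    · rw [toC_eq, coeff_map]
      exact (map_ne_zero _).2 hz.2
  · conv_rhs => rw [← e2]
    rw [toC_eq, eval_map, eval_map, ← coe_eval₂Hom, ← coe_eval₂Hom, ← AlgHom.coe_toRingHom, ← RingHom.comp_apply]
    congr 1
    apply MvPolynomial.ringHom_ext
    · intro c; simp
    · intro i; simp
      rw [show ((v i : ℤ) : MvPolynomial (Fin 3) ℚ) = C (v i : ℚ) by simp, eval₂_C]; simp
end DG

namespace DG
open MvPolynomial

lemma line_all {f : MvPolynomial (Fin 3) ℤ} {w v : Fin 3 → ℤ} (h : ∀ t : ℤ, eval (fun i => w i + t * v i) f = 0) :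
    aeval (fun i => Polynomial.C (qz v i) * Polynomial.X + Polynomial.C (qz w i)) (toQ f) = 0 := by
  have := poly_const (aeval (fun i => Polynomial.C (qz v i) * Polynomial.X + Polynomial.C (qz w i)) (toQ f)) 0 fun n => by
    rw [eval_line]
    have e : (fun i => qz w i + n * qz v i) = qz (fun i => w i + (n:ℤ) * v i) := by ext i; simp [qz]
    rw [e, eval_toQ, h]; simp
  simpa using this

lemma toQ_hc {k : ℕ} (f : MvPolynomial (Fin k) ℤ) (d : ℕ) : toQ (homogeneousComponent d f) = homogeneousComponent d (toQ f) := by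
  ext s
  rw [toQ, coeff_map, coeff_homogeneousComponent, coeff_homogeneousComponent, toQ, coeff_map]
  split_ifs <;> simp

lemma line_hom {f : MvPolynomial (Fin 3) ℤ} {d : ℕ} (hd : f.totalDegree ≤ d) {w v : Fin 3 → ℤ} (h : ∀ t : ℤ, eval (fun i => w i + t * v i) f = 0) :
    eval v (homogeneousComponent d f) = 0 := by
  have h1 := coeff_aff (toQ f) d (by rw [totalDegree_toQ]; exact hd) (qz v) (qz w)
  rw [line_all h, ← toQ_hc, eval_toQ] at h1
  simp at h1; exact_mod_cast h1.symm

lemma ZL.hc {K : Type*} [Field K] {k : ℕ} {f : MvPolynomial (Fin (k+1)) K} {d : ℕ} (hz : ZL f d) : ZL (homogeneousComponent d f) d := by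
  have hhom := homogeneousComponent_isHomogeneous d f
  refine ZL.of_le hhom.totalDegree_le ?_
  rw [homogeneousComponent_of_mem ((mem_homogeneousSubmodule _ _).2 hhom), if_pos rfl]
  exact hz.eval_ne

theorem dir_pts (f : MvPolynomial (Fin 3) ℤ) (d : ℕ) (hd : 2 ≤ d) (hz : ZL (toQ f) d) (hirr : Irreducible (homogeneousComponent d (toC f)))
    (hirrQ : Irreducible (toQ f)) (B M : ℕ) (hM : 1 ≤ M) (v : Fin 3 → ℤ) (hv : v ≠ 0) (hp : prim v) (hvM : ∃ i, (M : ℤ) ≤ |v i|)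
    (S : Finset (Fin 3 → ℤ)) (hB : ∀ w ∈ S, inBox B w) (hS : ∀ w ∈ S, ∀ t : ℤ, eval (fun i => w i + t * v i) f = 0) :
    S.card ≤ (2 * (2*B/M) + 1) * (d * (d+d)^2) := by
  classical
  rcases S.eq_empty_or_nonempty with rfl | ⟨w0, hw0⟩
  · simp
  have htd : f.totalDegree = d := by rw [← totalDegree_toQ]; exact hz.1
  have hv12 := hom_zero0 (homogeneousComponent_isHomogeneous d (toQ f)) hz.hc v hv (by
    rw [← toQ_hc, eval_toQ, line_hom htd.le (hS w0 hw0)]; simp)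
  obtain ⟨j, j', hj, hvj⟩ : ∃ j j' : Fin 2, j ≠ j' ∧ v j.succ ≠ 0 := by
    rcases hv12 with h | h
    · exact ⟨0, 1, by decide, h⟩
    · exact ⟨1, 0, by decide, h⟩
  have hnd := not_dvd_shift f d hd hz hirr v j j' hj hvj
  set G := aeval (fun i => X i + C (v i : ℚ)) (toQ f) with hG
  have hGd : G.totalDegree ≤ d := by
    refine (totalDegree_aeval_le _ _ fun i => ?_).trans hz.1.le
    refine (totalDegree_add _ _).trans ?_
    rw [totalDegree_X, totalDegree_C]; simp
  have hGe : ∀ u : Fin 3 → ℚ, eval u G = eval (fun i => u i + v i) (toQ f) := by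
    intro u
    rw [hG, ← AlgHom.coe_toRingHom, ← RingHom.comp_apply]
    congr 1
    apply MvPolynomial.ringHom_ext
    · intro; simp
    · intro i; simp
  obtain ⟨a, ha, hcount⟩ := slice_count (toQ f) G d (by omega) hz hirrQ hnd j j' hj
  have hvq : (v j.succ : ℚ) ≠ 0 := by exact_mod_cast hvj
  let u : (Fin 3 → ℤ) → Fin 3 → ℚ := fun w i => w i + ((a - w j.succ) / v j.succ) * v i
  have hu0 : ∀ w ∈ S, ∀ t : ℚ, eval (fun i => qz w i + t * qz v i) (toQ f) = 0 := by
    intro w hw t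
    rw [← eval_line, line_all (hS w hw)]; simp
  have hU := hcount (S.image u) (by
    intro x hx
    obtain ⟨w, hw, rfl⟩ := Finset.mem_image.1 hx
    refine ⟨?_, ?_, ?_⟩
    · simp only [u]; field_simp; ring
    · exact hu0 w hw _
    · rw [hGe, ← hu0 w hw ((a - w j.succ) / v j.succ + 1)]
      congr 2
      ext i; simp [u, qz]; ring)
  have hU' : (S.image u).card ≤ d * (d+d)^2 := hU.trans (by gcongr)
  refine (card_le_fiber S u (S.image u) (2 * (2*B/M) + 1) (fun w hw => Finset.mem_image_of_mem _ hw) ?_).trans (Nat.mul_le_mul_left _ hU')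
  intro x hx
  obtain ⟨w1, hw1, rfl⟩ := Finset.mem_image.1 hx
  obtain ⟨i0, hi0⟩ := hvM
  have key : ∀ w ∈ S.filter (fun z => u z = u w1), ∃ m : ℤ, m ∈ Finset.Icc (-((2*B/M : ℕ):ℤ)) ((2*B/M : ℕ):ℤ) ∧ w = fun i => w1 i + m * v i := by
    intro w hw
    obtain ⟨hwS, hwu⟩ := Finset.mem_filter.1 hw
    obtain ⟨m, hm⟩ := hp.ratio ((w j.succ - w1 j.succ)/ v j.succ) (fun i => w i - w1 i) (fun i => by
      have := congrFun hwu i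
      simp only [u] at this
      push_cast
      linear_combination this)
    have hwm : ∀ i, w i = w1 i + m * v i := by
      intro i
      have := congrFun hwu i
      simp only [u] at this
      have e : (w i : ℚ) = w1 i + m * v i := by rw [← hm]; linear_combination this
      exact_mod_cast e
    refine ⟨m, ?_, funext hwm⟩
    rw [Finset.mem_Icc, ← abs_le]
    have h1 := hB w hwS i0
    have h2 := hB w1 hw1 i0
    have h3 : |m| * |v i0| ≤ 2 * B := by
      rw [← abs_mul, show m * v i0 = w i0 - w1 i0 by rw [hwm]; ring]
      refine (abs_sub _ _).trans (by linarith)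
    have h4 : |m| * M ≤ 2 * B := le_trans (by gcongr) h3
    rw [← Int.natCast_natAbs] at h4 ⊢
    have h5 : m.natAbs * M ≤ 2 * B := by exact_mod_cast h4
    exact_mod_cast (Nat.le_div_iff_mul_le (by omega)).2 h5
  choose! m hm hwm using key
  calc _ ≤ (Finset.Icc (-((2*B/M : ℕ):ℤ)) ((2*B/M : ℕ):ℤ)).card := by
        refine Finset.card_le_card_of_injOn m (fun w hw => hm w hw) ?_
        intro x hx y hy hxy
        rw [hwm x hx, hwm y hy, hxy]
    _ = _ := by rw [Int.card_Icc]; omega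
end DG

namespace DG
open MvPolynomial

lemma toC_hc {k : ℕ} (f : MvPolynomial (Fin k) ℤ) (d : ℕ) : toC (homogeneousComponent d f) = homogeneousComponent d (toC f) := by
  ext s
  rw [toC, coeff_map, coeff_homogeneousComponent, coeff_homogeneousComponent, toC, coeff_map]
  split_ifs <;> simp

lemma irrQ_hc {k : ℕ} {f : MvPolynomial (Fin k) ℤ} {d : ℕ} (h : Irreducible (homogeneousComponent d (toC f))) :
    Irreducible (toQ (homogeneousComponent d f)) := by
  apply irr_of_map (algebraMap ℚ ℂ)
  rw [← toC_eq, toC_hc]; exact h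

lemma irrQ {k : ℕ} {f : MvPolynomial (Fin k) ℤ} {d : ℕ} (hd : f.totalDegree = d) (h : Irreducible (homogeneousComponent d (toC f))) :
    Irreducible (toQ f) := by
  have := irrQ_hc h
  rw [toQ_hc] at this
  exact irr_of_top (by rw [totalDegree_toQ]; exact hd) this

def aE (d : ℕ) : ℕ := 12*(d*(d+d)^2) + kD d*((4*(d*(d+2)^2))*(d*8))

theorem e2 : ∃ Y1 : ℕ, ∀ (f : MvPolynomial (Fin 3) ℤ) (d : ℕ), 3 ≤ d → ZL (toQ f) d → Irreducible (homogeneousComponent d (toC f)) →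
    ∀ Y : ℕ, Y1 ≤ Y → 9 ≤ Y → d + 1 ≤ Y → kD d^2 ≤ Y → ∀ (B : ℕ) (hB1 : 1 ≤ B) (S : Finset (Fin 3 → ℤ)), (∀ w ∈ S, inBox B w) →
    (∀ w ∈ S, onLine f B w) → S.card ≤ (aE d * (d*(d+d)^2)) * (5 * Y^5 + 384) * B := by
  classical
  obtain ⟨Y1, hdir⟩ := dir_count
  refine ⟨Y1, fun f d hd hz hirr Y hY1 hY9 hYd hYk B hB1 S hSB hS => ?_⟩
  have htd : f.totalDegree = d := by rw [← totalDegree_toQ]; exact hz.1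
  have hfQ := irrQ htd hirr
  choose! v hv0 hvp hvB hvt using hS
  set K := d*(d+d)^2 with hK
  -- shell count
  have shell : ∀ (Z M : ℕ) (S' : Finset (Fin 3 → ℤ)), Y ≤ Z → S' ⊆ S → 1 ≤ M → (∀ w ∈ S', inBox (Z^6) (v w)) →
      (∀ w ∈ S', ∃ i, (M:ℤ) ≤ |v w i|) → S'.card ≤ ((2 * (2*B/M) + 1) * K) * (aE d * Z^5) := by
    intro Z M S' hYZ hS' hM hT hvM
    have hZ1 : 1 ≤ Z := by omega
    have hZ5 : Z ≤ Z^5 := Nat.le_self_pow (by norm_num) Z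
    have hV : (S'.image v).card ≤ aE d * Z^5 := by
      refine (hdir (homogeneousComponent d f) d hd (homogeneousComponent_isHomogeneous d f) (by rw [toQ_hc]; exact hz.hc) (irrQ_hc hirr)
        (Z^5) (Z^6) (by omega) (by omega) (by omega) (Nat.one_le_pow _ _ (by omega)) ?_ ?_ (S'.image v) ?_).trans ?_
      · calc 720 * ((Z^6)^2)^6 = 720 * Z^72 := by ring
          _ < Z^3 * Z^72 := by
            have : 9^3 ≤ Z^3 := Nat.pow_le_pow_left (by omega) 3
            have : 0 < Z^72 := by positivity
            nlinarith
          _ = (Z^5)^15 := by ring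
      · rw [← pow_mul]; exact Nat.pow_le_pow_right (by omega) (by norm_num)
      · intro x hx
        obtain ⟨w, hw, rfl⟩ := Finset.mem_image.1 hx
        exact ⟨hv0 w (hS' hw), hvp w (hS' hw), line_hom htd.le (hvt w (hS' hw)), hT w hw⟩
      · have : 1 ≤ Z^5 := Nat.one_le_pow _ _ (by omega)
        rw [aE, add_mul]
        refine add_le_add (Nat.le_mul_of_pos_right _ (by omega)) (le_of_eq (by ring))
    refine (card_le_fiber S' v (S'.image v) ((2 * (2*B/M) + 1) * K) (fun w hw => Finset.mem_image_of_mem _ hw) ?_).trans (Nat.mul_le_mul_left _ hV)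
    intro x hx
    obtain ⟨w, hw, rfl⟩ := Finset.mem_image.1 hx
    refine dir_pts f d (by omega) hz hirr hfQ B M hM (v w) (hv0 w (hS' hw)) (hvp w (hS' hw)) (hvM w hw) _ ?_ ?_
    · intro x hx; exact hSB x (hS' (Finset.mem_filter.1 hx).1)
    · intro x hx
      have := Finset.mem_filter.1 hx
      rw [← this.2]; exact hvt x (hS' this.1)
  have hex : ∀ w ∈ S, ∃ i, (1:ℤ) ≤ |v w i| := by
    intro w hw
    by_contra! hcon
    apply hv0 w hw
    ext i
    have := hcon i
    rw [Int.abs_lt_one_iff] at this; exact this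
  have hBr : (1:ℝ) ≤ B := by exact_mod_cast hB1
  have hYr : (1:ℝ) ≤ Y := by exact_mod_cast (by omega : 1 ≤ Y)
  have main : ∀ J : ℕ, ((S.filter fun w => inBox ((2^J*Y)^6) (v w)).card : ℝ) ≤ (aE d * K : ℕ) * (5 * Y^5 + 384 * (1 - (1/2)^J)) * B := by
    intro J
    induction J with
    | zero => 
      have := shell Y 1 (S.filter fun w => inBox ((2^0*Y)^6) (v w)) le_rfl (Finset.filter_subset _ _) le_rfl (fun w hw => by simpa using (Finset.mem_filter.1 hw).2)
        (fun w hw => by simpa using hex w (Finset.mem_filter.1 hw).1)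
      have h2 : ((S.filter fun w => inBox ((2^0*Y)^6) (v w)).card : ℝ) ≤ ((2 * (2*B/1 : ℕ) + 1) * K) * (aE d * Y^5) := by exact_mod_cast this
      refine h2.trans ?_
      rw [Nat.div_one]
      push_cast
      have : (0:ℝ) ≤ aE d * K * Y^5 := by positivity
      simp only [pow_zero, sub_self, mul_zero, add_zero]
      nlinarith
    | succ J ih =>
      set S' := S.filter fun w => inBox ((2^(J+1)*Y)^6) (v w) ∧ ¬ inBox ((2^J*Y)^6) (v w) with hS'
      have hsplit : (S.filter fun w => inBox ((2^(J+1)*Y)^6) (v w)) ⊆ (S.filter fun w => inBox ((2^J*Y)^6) (v w)) ∪ S' := by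
        intro w hw
        simp only [hS', Finset.mem_union, Finset.mem_filter] at hw ⊢
        tauto
      have hc := (Finset.card_le_card hsplit).trans (Finset.card_union_le _ _)
      have hc' : ((S.filter fun w => inBox ((2^(J+1)*Y)^6) (v w)).card : ℝ) ≤ (S.filter fun w => inBox ((2^J*Y)^6) (v w)).card + S'.card := by exact_mod_cast hc
      refine hc'.trans ((add_le_add_left ih _).trans ?_)
      have hS'c : (S'.card : ℝ) ≤ (aE d * K : ℕ) * (384 * (1/2)^(J+1)) * B := by
        rcases S'.eq_empty_or_nonempty with h0 | ⟨w0, hw0⟩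
        · rw [h0]; simp; positivity
        have hbig : ∀ w ∈ S', ∃ i, (((2^J*Y)^6 : ℕ):ℤ) ≤ |v w i| := by
          intro w hw
          have := (Finset.mem_filter.1 hw).2.2
          unfold inBox at this
          push Not at this
          obtain ⟨i, hi⟩ := this
          exact ⟨i, hi.le⟩
        have hT1 : 1 ≤ (2^J*Y)^6 := Nat.one_le_pow _ _ (by positivity)
        have hTB : (2^J*Y)^6 ≤ 2*B := by
          obtain ⟨i, hi⟩ := hbig w0 hw0
          have := hvB w0 (Finset.mem_filter.1 hw0).1 i
          exact_mod_cast hi.trans this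
        have := shell (2^(J+1)*Y) ((2^J*Y)^6) S' (Nat.le_mul_of_pos_left _ (by positivity)) (Finset.filter_subset _ _) hT1
          (fun w hw => (Finset.mem_filter.1 hw).2.1) hbig
        have h2 : (S'.card : ℝ) ≤ ((2 * (2*B/(2^J*Y)^6 : ℕ) + 1) * K) * (aE d * (2^(J+1)*Y)^5) := by exact_mod_cast this
        refine h2.trans ?_
        have h3 : 1 ≤ 2*B/(2^J*Y)^6 := (Nat.one_le_div_iff (by omega)).2 hTB
        have h3' : (1:ℝ) ≤ (2*B/(2^J*Y)^6 : ℕ) := by exact_mod_cast h3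
        have h4 : ((2*B/(2^J*Y)^6 : ℕ) : ℝ) ≤ (2 * B : ℝ) / (2^J*Y)^6 := by
          refine Nat.cast_div_le.trans (le_of_eq ?_)
          push_cast; ring
        have h5 : (2 * ((2*B/(2^J*Y)^6 : ℕ):ℝ) + 1) ≤ 6 * B / (2^J*Y)^6 := by
          calc _ ≤ 3 * ((2*B/(2^J*Y)^6 : ℕ):ℝ) := by linarith
            _ ≤ 3 * ((2 * B : ℝ) / (2^J*Y)^6) := by linarith
            _ = _ := by ring
        calc _ ≤ ((6 * B / (2^J*Y)^6 : ℝ) * K) * (aE d * (2^(J+1)*Y)^5) := by gcongr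
          _ = (aE d * K) * (192 * (1/2)^J) * B * (1/Y) := by
            rw [pow_succ, one_div_pow]
            field_simp
            ring
          _ ≤ (aE d * K) * (192 * (1/2)^J) * B * 1 := by
            gcongr
            rw [div_le_one (by linarith)]; exact hYr
          _ = _ := by push_cast; rw [pow_succ]; ring
      have e : ((1:ℝ)/2)^(J+1) = (1/2)^J * (1/2) := pow_succ _ _
      rw [e] at hS'c ⊢
      linarith
  have hfin := main B
  have hall : (S.filter fun w => inBox ((2^B*Y)^6) (v w)) = S := by
    apply Finset.filter_true_of_mem
    intro w hw i
    refine (hvB w hw i).trans ?_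
    have : 2 * B ≤ (2^B*Y)^6 := by
      calc 2 * B ≤ 2^B * Y := by nlinarith [Nat.lt_two_pow_self (n := B)]
        _ ≤ _ := Nat.le_self_pow (by norm_num) _
    exact_mod_cast this
  rw [hall] at hfin
  have : (S.card : ℝ) ≤ ((aE d * K * (5 * Y^5 + 384) * B : ℕ) : ℝ) := by
    refine hfin.trans ?_
    push_cast
    have : (0:ℝ) ≤ (1/2)^B := by positivity
    gcongr
    linarith
  exact_mod_cast this
end DG

namespace DG
open MvPolynomial

/-- polynomially bounded -/
def PB (g : ℕ → ℕ) : Prop := ∃ C : ℕ, ∀ d, g d ≤ C * (d+1)^C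

lemma PB.of_le {g g' : ℕ → ℕ} (h : PB g') (hle : ∀ d, g d ≤ g' d) : PB g := by
  obtain ⟨C, hC⟩ := h
  exact ⟨C, fun d => (hle d).trans (hC d)⟩

lemma PB.const (c : ℕ) : PB (fun _ => c) := ⟨c, fun d => Nat.le_mul_of_pos_right _ (by positivity)⟩
lemma PB.id : PB (fun d => d) := ⟨1, fun d => by simp⟩

lemma PB.add {g g' : ℕ → ℕ} (h : PB g) (h' : PB g') : PB (fun d => g d + g' d) := by
  obtain ⟨C, hC⟩ := h
  obtain ⟨C', hC'⟩ := h'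
  refine ⟨C + C', fun d => ?_⟩
  have h1 : (d+1)^C ≤ (d+1)^(C+C') := Nat.pow_le_pow_right (by omega) (by omega)
  have h2 : (d+1)^C' ≤ (d+1)^(C+C') := Nat.pow_le_pow_right (by omega) (by omega)
  calc g d + g' d ≤ C * (d+1)^(C+C') + C' * (d+1)^(C+C') := add_le_add ((hC d).trans (Nat.mul_le_mul_left _ h1)) ((hC' d).trans (Nat.mul_le_mul_left _ h2))
    _ = _ := by ring

lemma PB.mul {g g' : ℕ → ℕ} (h : PB g) (h' : PB g') : PB (fun d => g d * g' d) := by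
  obtain ⟨C, hC⟩ := h
  obtain ⟨C', hC'⟩ := h'
  refine ⟨C * C' + C + C', fun d => ?_⟩
  calc g d * g' d ≤ (C * (d+1)^C) * (C' * (d+1)^C') := Nat.mul_le_mul (hC d) (hC' d)
    _ = (C * C') * (d+1)^(C+C') := by ring
    _ ≤ _ := Nat.mul_le_mul (by omega) (Nat.pow_le_pow_right (by omega) (by nlinarith [Nat.zero_le (C*C')]))

lemma PB.pow {g : ℕ → ℕ} (h : PB g) (k : ℕ) : PB (fun d => g d ^ k) := by
  induction k with
  | zero => simpa using PB.const 1
  | succ k ih => simpa only [pow_succ] using ih.mul h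

lemma PB.bet (k E : ℕ) {g : ℕ → ℕ} (h : PB g) : PB (fun d => bet k E (g d)) := by
  unfold DG.bet
  exact (((PB.const (k+1)).add ((PB.const E).mul h))).add (((PB.const k).add ((PB.const E).mul h)).mul ((h.add (PB.const 1)).pow k))

lemma PB.kS : PB kS := by
  unfold DG.kS
  exact ((PB.bet 3 40 PB.id).add (PB.bet 2 41 (((PB.const 402).mul PB.id).pow 2))).add (PB.const 21)

lemma PB.kD : PB kD := by
  unfold DG.kD
  exact (PB.bet 3 2 PB.id).add (PB.const 3)

lemma PB.aE : PB aE := by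
  unfold DG.aE
  exact ((PB.const 12).mul (PB.id.mul ((PB.id.add PB.id).pow 2))).add (PB.kD.mul (((PB.const 4).mul (PB.id.mul ((PB.id.add (PB.const 2)).pow 2))).mul 
    (PB.id.mul (PB.const 8))))

def gS (d Y : ℕ) : ℕ := d*((d+d)^2*(2*Y^40+1)) + (kS d^36*((d*(8*Y)^2)^19*((402*d)^2*((402*d)^2*(402*d)^2*d))) + kS d^18*((d*(8*Y)^2)^18*((402*d)^2*((402*d)^2*((402*d)^2)^2))) + kS d^39*((d*(8*Y)^2)^18*((402*d)^2*((402*d)^2*(((402*d)^2*24)*((402*d)^2*(8*Y))^3)))))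

lemma gS_le (d Y : ℕ) (hY : 1 ≤ Y) : gS d Y ≤ gS d 1 * Y^40 := by
  have h38 : Y^38 ≤ Y^40 := Nat.pow_le_pow_right hY (by norm_num)
  have h36 : Y^36 ≤ Y^40 := Nat.pow_le_pow_right hY (by norm_num)
  have h39 : Y^39 ≤ Y^40 := Nat.pow_le_pow_right hY (by norm_num)
  have h40 : 1 ≤ Y^40 := Nat.one_le_pow _ _ hY
  unfold gS
  rw [add_mul, add_mul, add_mul]
  generalize kS d = k
  generalize 402 * d = a
  refine add_le_add ?_ (add_le_add (add_le_add ?_ ?_) ?_)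
  · calc d*((d+d)^2*(2*Y^40+1)) ≤ d*((d+d)^2*(2*Y^40+Y^40)) := by gcongr
      _ = _ := by ring
  · calc k^36*((d*(8*Y)^2)^19*(a^2*(a^2*a^2*d))) = k^36*((d*8^2)^19*(a^2*(a^2*a^2*d))) * Y^38 := by
          rw [show d*(8*Y)^2 = (d*8^2)*Y^2 by ring, mul_pow (d*8^2), ← pow_mul]; ring
      _ ≤ _ := by rw [mul_one]; gcongr
  · calc k^18*((d*(8*Y)^2)^18*(a^2*(a^2*(a^2)^2))) = k^18*((d*8^2)^18*(a^2*(a^2*(a^2)^2))) * Y^36 := by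
          rw [show d*(8*Y)^2 = (d*8^2)*Y^2 by ring, mul_pow (d*8^2), ← pow_mul]; ring
      _ ≤ _ := by rw [mul_one]; gcongr
  · calc k^39*((d*(8*Y)^2)^18*(a^2*(a^2*((a^2*24)*(a^2*(8*Y))^3)))) = k^39*((d*8^2)^18*(a^2*(a^2*((a^2*24)*(a^2*8)^3)))) * Y^39 := by
          rw [show d*(8*Y)^2 = (d*8^2)*Y^2 by ring, mul_pow (d*8^2), ← pow_mul]; ring
      _ ≤ _ := by rw [mul_one]; gcongr

lemma PB.gS : PB (fun d => gS d 1) := by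
  unfold DG.gS
  have a := ((PB.const 402).mul PB.id).pow 2
  have b := (PB.id.mul (((PB.const 8).mul (PB.const 1)).pow 2))
  refine (PB.id.mul (((PB.id.add PB.id).pow 2).mul (PB.const _))).add (((PB.add ?_ ?_)).add ?_)
  · exact (PB.kS.pow 36).mul ((b.pow 19).mul (a.mul ((a.mul a).mul PB.id)))
  · exact (PB.kS.pow 18).mul ((b.pow 18).mul (a.mul (a.mul (a.pow 2))))
  · exact (PB.kS.pow 39).mul ((b.pow 18).mul (a.mul (a.mul ((a.mul (PB.const 24)).mul ((a.mul ((PB.const 8).mul (PB.const 1))).pow 3)))))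

theorem thmS : ∃ g : ℕ → ℕ, PB g ∧ ∀ (f : MvPolynomial (Fin 3) ℤ) (d : ℕ), 5 ≤ d → ZL (toQ f) d → Irreducible (homogeneousComponent d (toC f)) →
    ∀ (B : ℕ), 1 ≤ B → ∀ (S : Finset (Fin 3 → ℤ)), (∀ w ∈ S, inBox B w) → (∀ w ∈ S, eval w f = 0) → S.card ≤ g d * B := by
  classical
  obtain ⟨Y1, h1⟩ := surf
  obtain ⟨Y2, h2⟩ := e2
  set Y0 : ℕ → ℕ := fun d => Y1 + Y2 + 9 + (d + 1) + kD d^2 + d*(4*(100*d)+1)*(2*(100*d)+1) + ((402*d)^2+1) + kS d^2 with hY0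
  have pY0 : PB Y0 := by
    refine (((((((PB.const _).add (PB.const _)).add (PB.const _)).add (PB.id.add (PB.const 1))).add (PB.kD.pow 2)).add ?_).add ?_).add (PB.kS.pow 2)
    · have a := (PB.const 100).mul PB.id
      exact (PB.id.mul (((PB.const 4).mul a).add (PB.const 1))).mul (((PB.const 2).mul a).add (PB.const 1))
    · exact (((PB.const 402).mul PB.id).pow 2).add (PB.const 1)
  refine ⟨fun d => 9 * d * Y0 d^40 + 2^40 * (gS d 1 + aE d * (d*(d+d)^2) * (5 * Y0 d^5 + 384)), ?_, ?_⟩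
  · refine (((PB.const 9).mul PB.id).mul (pY0.pow 40)).add ((PB.const _).mul (PB.gS.add ((PB.aE.mul (PB.id.mul ((PB.id.add PB.id).pow 2))).mul 
      (((PB.const 5).mul (pY0.pow 5)).add (PB.const 384)))))
  intro f d hd hz hirr B hB S hSB hS
  have htd : f.totalDegree = d := by rw [← totalDegree_toQ]; exact hz.1
  have hfQ := irrQ htd hirr
  have hex : ∃ Y : ℕ, B ≤ Y^40 := ⟨B, Nat.le_self_pow (by norm_num) B⟩
  set Y := Nat.find hex with hY
  have hYB : B ≤ Y^40 := Nat.find_spec hex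
  have hY1 : 1 ≤ Y := by
    by_contra h
    have : Y = 0 := by omega
    rw [this] at hYB; simp at hYB; omega
  have hYd : Y0 d = Y1 + Y2 + 9 + (d + 1) + kD d^2 + d*(4*(100*d)+1)*(2*(100*d)+1) + ((402*d)^2+1) + kS d^2 := rfl
  rcases le_total Y (Y0 d) with hle | hle
  · have := triv_count (toQ f) d hz B S hSB (fun w hw => by rw [eval_toQ, hS w hw]; simp)
    refine this.trans ?_
    have hB2 : B ≤ Y0 d^40 := hYB.trans (Nat.pow_le_pow_left hle 40)
    calc d * (2*B+1)^2 ≤ d * (3*B)^2 := by gcongr; omega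
      _ = 9 * d * B * B := by ring
      _ ≤ 9 * d * Y0 d^40 * B := by gcongr
      _ ≤ _ := by
        dsimp only
        gcongr
        exact Nat.le_add_right _ _
  · have hYB2 : Y^40 ≤ 2^40 * B := by
      have h3 : ¬ B ≤ (Y-1)^40 := Nat.find_min hex (by omega)
      calc Y^40 ≤ (2*(Y-1))^40 := Nat.pow_le_pow_left (by omega) 40
        _ = 2^40 * (Y-1)^40 := mul_pow _ _ _
        _ ≤ _ := by gcongr; omega
    have hBox : ∀ w ∈ S, inBox (Y^40) w := fun w hw i => (hSB w hw i).trans (by exact_mod_cast hYB)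
    have c1 := h1 f d hd hz hfQ Y (by omega) (by omega) (by omega) (by omega) (S.filter fun w => ¬ onLine f (Y^40) w)
      (fun w hw => hBox w (Finset.mem_filter.1 hw).1) (fun w hw => hS w (Finset.mem_filter.1 hw).1) (fun w hw => (Finset.mem_filter.1 hw).2)
    have c2 := h2 f d (by omega) hz hirr (Y0 d) (by omega) (by omega) (by omega) (by omega) (Y^40) (Nat.one_le_pow _ _ hY1) (S.filter fun w => onLine f (Y^40) w)
      (fun w hw => hBox w (Finset.mem_filter.1 hw).1) (fun w hw => (Finset.mem_filter.1 hw).2)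
    have c1' := c1.trans (gS_le d Y hY1)
    have hs := Finset.card_filter_add_card_filter_not (s := S) (fun w => onLine f (Y^40) w)
    dsimp only
    generalize aE d * (d*(d+d)^2) * (5 * Y0 d^5 + 384) = a at *
    generalize gS d 1 = b at *
    calc S.card ≤ a * Y^40 + b * Y^40 := by omega
      _ = (b + a) * Y^40 := by ring
      _ ≤ (b + a) * (2^40 * B) := by gcongr
      _ = 2^40 * (b + a) * B := by ring
      _ ≤ _ := by gcongr; exact Nat.le_add_left _ _
end DG

namespace DG
open MvPolynomial

/-- the substitution `y₀ ↦ t`, `y_{j+1} ↦ t a_j` -/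
noncomputable def th (s : ℕ) : MvPolynomial (Fin (s+1)) ℂ →+* Polynomial (MvPolynomial (Fin s) ℂ) :=
  eval₂Hom (Polynomial.C.comp C) (Fin.cons Polynomial.X (fun j => Polynomial.C (X j) * Polynomial.X) : Fin (s+1) → Polynomial (MvPolynomial (Fin s) ℂ))

@[simp] lemma th_C (s : ℕ) (c : ℂ) : th s (C c) = Polynomial.C (C c) := by simp [th]
@[simp] lemma th_X0 (s : ℕ) : th s (X 0) = Polynomial.X := by simp [th]
@[simp] lemma th_Xs (s : ℕ) (j : Fin s) : th s (X j.succ) = Polynomial.C (X j) * Polynomial.X := by simp [th]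

lemma th_coeff_deg (s : ℕ) (F : MvPolynomial (Fin (s+1)) ℂ) (k : ℕ) : ((th s F).coeff k).totalDegree ≤ k := by
  induction F using MvPolynomial.induction_on generalizing k with
  | C a => 
    rw [th_C, Polynomial.coeff_C]
    split_ifs <;> simp
  | add p q hp hq =>
    rw [map_add, Polynomial.coeff_add]
    exact (totalDegree_add _ _).trans (max_le (hp k) (hq k))
  | mul_X p i hp =>
    rw [map_mul]
    refine Fin.cases ?_ (fun j => ?_) i
    · rw [th_X0]
      cases k with
      | zero => simp
      | succ k => rw [Polynomial.coeff_mul_X]; exact (hp k).trans (by omega)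
    · rw [th_Xs, ← mul_assoc]
      cases k with
      | zero => simp
      | succ k => 
        rw [Polynomial.coeff_mul_X, Polynomial.coeff_mul_C]
        refine (totalDegree_mul _ _).trans ?_
        rw [totalDegree_X]
        exact add_le_add (hp k) le_rfl

lemma th_natDegree (s : ℕ) (F : MvPolynomial (Fin (s+1)) ℂ) : (th s F).natDegree ≤ F.totalDegree := by
  rw [th, coe_eval₂Hom, eval₂_eq']
  refine Polynomial.natDegree_sum_le_of_forall_le _ _ fun m hm => ?_
  refine (Polynomial.natDegree_C_mul_le _ _).trans ((Polynomial.natDegree_prod_le _ _).trans ?_)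
  refine le_trans (Finset.sum_le_sum fun i _ => (?_ : _ ≤ m i)) ?_
  · refine Polynomial.natDegree_pow_le.trans ?_
    have : ((Fin.cons Polynomial.X (fun j => Polynomial.C (X j) * Polynomial.X) : Fin (s+1) → Polynomial (MvPolynomial (Fin s) ℂ)) i).natDegree ≤ 1 := by
      refine Fin.cases ?_ (fun j => ?_) i
      · simp
      · simp only [Fin.cons_succ]
        exact (Polynomial.natDegree_C_mul_le _ _).trans (by simp)
    nlinarith
  · rw [← Finsupp.degree_eq_sum]; exact (totalDegree_le_iff_degree F _).1 le_rfl m hm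

lemma th_eval (s : ℕ) (F : MvPolynomial (Fin (s+1)) ℂ) (a : Fin s → ℂ) (t : ℂ) :
    ((th s F).map (eval a)).eval t = eval (Fin.cons t (fun j => a j * t) : Fin (s+1) → ℂ) F := by
  have : ((Polynomial.evalRingHom t).comp (Polynomial.mapRingHom (eval a))).comp (th s) = eval (Fin.cons t (fun j => a j * t) : Fin (s+1) → ℂ) := by
    apply MvPolynomial.ringHom_ext
    · intro c; simp
    · intro i
      refine Fin.cases ?_ (fun j => ?_) i
      · simp
      · simp
  have := congrArg (fun g => g F) this
  simpa using this

lemma th_inj (s : ℕ) : Function.Injective (th s) := by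
  rw [injective_iff_map_eq_zero]
  intro F hF
  have : F * X 0 = 0 := by
    apply MvPolynomial.funext
    intro y
    rw [map_mul, eval_X, map_zero]
    by_cases h0 : y 0 = 0
    · rw [h0, mul_zero]
    · have h1 := th_eval s F (fun j => y j.succ / y 0) (y 0)
      rw [hF] at h1
      have e : (Fin.cons (y 0) (fun j : Fin s => y j.succ / y 0 * y 0) : Fin (s+1) → ℂ) = y := by
        ext i
        refine Fin.cases ?_ (fun j => ?_) i
        · simp
        · simp [h0]
      rw [e] at h1
      rw [← h1]; simp
  exact (mul_eq_zero.1 this).resolve_right (X_ne_zero 0)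

lemma th_surj0 (s : ℕ) (a : MvPolynomial (Fin s) ℂ) : ∃ (k : ℕ) (N : MvPolynomial (Fin (s+1)) ℂ), th s N = Polynomial.X^k * Polynomial.C a := by
  induction a using MvPolynomial.induction_on with
  | C c => exact ⟨0, C c, by simp⟩
  | add p q hp hq => 
    obtain ⟨k1, N1, h1⟩ := hp
    obtain ⟨k2, N2, h2⟩ := hq
    refine ⟨k1+k2, X 0^k2 * N1 + X 0^k1 * N2, ?_⟩
    rw [map_add, map_mul, map_mul, h1, h2, map_pow, map_pow, th_X0, map_add]; ring
  | mul_X p j hp =>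
    obtain ⟨k, N, h⟩ := hp
    refine ⟨k+1, N * X j.succ, ?_⟩
    rw [map_mul, h, th_Xs, map_mul]; ring

lemma th_surj1 (s : ℕ) (F : Polynomial (MvPolynomial (Fin s) ℂ)) : ∃ (k : ℕ) (N : MvPolynomial (Fin (s+1)) ℂ), th s N = Polynomial.X^k * F := by
  induction F using Polynomial.induction_on with
  | C a => exact th_surj0 s a
  | add p q hp hq => 
    obtain ⟨k1, N1, h1⟩ := hp
    obtain ⟨k2, N2, h2⟩ := hq
    refine ⟨k1+k2, X 0^k2 * N1 + X 0^k1 * N2, ?_⟩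
    rw [map_add, map_mul, map_mul, h1, h2, map_pow, map_pow, th_X0]; ring
  | monomial n a hp =>
    obtain ⟨k, N, h⟩ := hp
    refine ⟨k, N * X 0, ?_⟩
    rw [map_mul, h, th_X0]; ring

lemma th_surj2 (s : ℕ) (G : Polynomial (Polynomial (MvPolynomial (Fin s) ℂ))) : 
    ∃ (k : ℕ) (N : Polynomial (MvPolynomial (Fin (s+1)) ℂ)), N.map (th s) = Polynomial.C (Polynomial.X^k) * G := by
  induction G using Polynomial.induction_on with
  | C a => 
    obtain ⟨k, N, h⟩ := th_surj1 s a
    exact ⟨k, Polynomial.C N, by rw [Polynomial.map_C, h, map_mul]⟩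
  | add p q hp hq => 
    obtain ⟨k1, N1, h1⟩ := hp
    obtain ⟨k2, N2, h2⟩ := hq
    refine ⟨k1+k2, Polynomial.C (X 0^k2) * N1 + Polynomial.C (X 0^k1) * N2, ?_⟩
    have e : ∀ k : ℕ, Polynomial.map (th s) (Polynomial.C (X 0 ^ k)) = Polynomial.C (Polynomial.X ^ k) := fun k => by
      rw [Polynomial.map_C, map_pow (th s), th_X0]
    rw [Polynomial.map_add, Polynomial.map_mul, Polynomial.map_mul, h1, h2, e, e, pow_add, Polynomial.C_mul]; ring
  | monomial n a hp =>
    obtain ⟨k, N, h⟩ := hp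
    refine ⟨k, N * Polynomial.X, ?_⟩
    rw [Polynomial.map_mul, h, Polynomial.map_X]; ring

/-- Newton iteration -/
lemma newton (s : ℕ) (Q : Polynomial (MvPolynomial (Fin (s+1)) ℂ)) (ζ c : ℂ) (hc : c ≠ 0)
    (h0 : Polynomial.X ∣ (Q.map (th s)).eval (Polynomial.C (C ζ))) 
    (h1 : Polynomial.X ∣ (Q.map (th s)).derivative.eval (Polynomial.C (C ζ)) - Polynomial.C (C c)) (l : ℕ) :
    ∃ Φ, Polynomial.X ∣ th s Φ - Polynomial.C (C ζ) ∧ Polynomial.X^(l+1) ∣ (Q.map (th s)).eval (th s Φ) := by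
  induction l with
  | zero => exact ⟨C ζ, by simp, by simpa using h0⟩
  | succ l ih =>
    obtain ⟨Φ, h2, h3⟩ := ih
    set q := Q.map (th s) with hq
    set φ := th s Φ with hφ
    have hX1 : Polynomial.X ∣ q.eval φ := (dvd_pow_self _ (by omega)).trans h3
    have he : th s (Q.eval Φ) = q.eval φ := by
      rw [hq, hφ, Polynomial.eval_map, Polynomial.eval₂_hom]
    set D : Polynomial (MvPolynomial (Fin s) ℂ) := Polynomial.C (C (c⁻¹)) with hD
    have hDc : D * Polynomial.C (C c) = 1 := by
      rw [hD, ← map_mul, ← map_mul, inv_mul_cancel₀ hc]; simp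
    have e1 : th s (Φ - C c⁻¹ * Q.eval Φ) = φ + (-(D * q.eval φ)) := by
      rw [map_sub, map_mul, he, th_C]; ring
    refine ⟨Φ - C c⁻¹ * Q.eval Φ, ?_, ?_⟩
    · rw [e1, show φ + -(D * q.eval φ) - Polynomial.C (C ζ) = (φ - Polynomial.C (C ζ)) - D * q.eval φ by ring]
      exact dvd_sub h2 (hX1.mul_left _)
    · obtain ⟨k, hk⟩ := Polynomial.binomExpansion q φ (-(D * q.eval φ))
      have h4 : Polynomial.X ∣ q.derivative.eval φ - Polynomial.C (C c) := by
        have := h2.trans (Polynomial.sub_dvd_eval_sub φ (Polynomial.C (C ζ)) q.derivative)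
        have := dvd_add this h1
        rwa [sub_add_sub_cancel] at this
      rw [e1, hk]
      have e2 : q.eval φ + q.derivative.eval φ * (-(D * q.eval φ)) + k * (-(D * q.eval φ))^2 = 
        q.eval φ * (-D * (q.derivative.eval φ - Polynomial.C (C c)) + k * D^2 * q.eval φ) := by
        linear_combination (- q.eval φ) * hDc
      rw [e2, pow_succ]
      exact mul_dvd_mul h3 (dvd_add (h4.mul_left _) (hX1.mul_left _))

lemma natDegree_det_le' {R ι : Type*} [CommRing R] [Fintype ι] [DecidableEq ι]
    (A : Matrix ι ι (Polynomial R)) (e : ℕ) (h : ∀ i j, (A i j).natDegree ≤ e) :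
    A.det.natDegree ≤ Fintype.card ι * e := by
  rw [Matrix.det_apply]
  refine Polynomial.natDegree_sum_le_of_forall_le _ _ fun s _ => ?_
  refine (Polynomial.natDegree_smul_le _ _).trans ?_
  refine (Polynomial.natDegree_prod_le _ _).trans ?_
  refine (Finset.sum_le_card_nsmul _ _ e fun i _ => h _ _).trans ?_
  simp

lemma natDegree_resultant_le' {R : Type*} [CommRing R] (F G : Polynomial (Polynomial R)) (m n e : ℕ)
    (hF : ∀ i, (F.coeff i).natDegree ≤ e) (hG : ∀ i, (G.coeff i).natDegree ≤ e) :
    (Polynomial.resultant F G m n).natDegree ≤ (m + n) * e := by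
  rw [Polynomial.resultant]
  refine (natDegree_det_le' _ e ?_).trans (by rw [Fintype.card_fin])
  intro i j
  rw [Polynomial.sylvester, Matrix.of_apply]
  refine Fin.addCases (fun j => ?_) (fun j => ?_) j
  · rw [Fin.addCases_left]
    split_ifs
    · exact hG _
    · simp
  · rw [Fin.addCases_right]
    split_ifs
    · exact hF _
    · simp

/-- the generic kernel is trivial -/
lemma gen_kernel (s d : ℕ) (hd : 1 ≤ d) (Q : Polynomial (MvPolynomial (Fin (s+1)) ℂ)) (hQ : Irreducible Q) (hp : Q.IsPrimitive)
    (hQd : Q.natDegree = d) (hQc : ∀ i, (Q.coeff i).totalDegree ≤ d) (φ : Polynomial (MvPolynomial (Fin s) ℂ))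
    (l : ℕ) (hl : 2*d*d ≤ l) (hφ : Polynomial.X^(l+1) ∣ (Q.map (th s)).eval φ)
    (G : Polynomial (Polynomial (MvPolynomial (Fin s) ℂ))) (hG : G.natDegree < d) (hGc : ∀ i, (G.coeff i).natDegree < d)
    (hGφ : Polynomial.X^(l+1) ∣ G.eval φ) : G = 0 := by
  classical
  by_contra hG0
  let _ : NormalizedGCDMonoid (MvPolynomial (Fin (s+1)) ℂ) :=
    Classical.choice (inferInstance : Nonempty (NormalizedGCDMonoid (MvPolynomial (Fin (s+1)) ℂ)))
  obtain ⟨k, N, hN⟩ := th_surj2 s G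
  set q := Q.map (th s) with hq
  have hqd : q.natDegree = d := by rw [hq, Polynomial.natDegree_map_eq_of_injective (th_inj s), hQd]
  have hX : (Polynomial.X^k : Polynomial (MvPolynomial (Fin s) ℂ)) ≠ 0 := pow_ne_zero _ Polynomial.X_ne_zero
  have hNd : N.natDegree = G.natDegree := by
    rw [← Polynomial.natDegree_map_eq_of_injective (th_inj s), hN, Polynomial.natDegree_C_mul hX]
  have hN0 : N ≠ 0 := by
    rintro rfl
    rw [Polynomial.map_zero] at hN
    exact (mul_ne_zero (Polynomial.C_ne_zero.2 hX) hG0) hN.symm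
  have hnd : ¬ Q ∣ N := fun h => by
    have := Polynomial.natDegree_le_of_dvd h hN0
    omega
  have hR := res_ne_zero Q N hQ hp hnd
  have hR2 : Polynomial.resultant q G d G.natDegree ≠ 0 := by
    intro h0
    apply hR
    apply th_inj s
    rw [map_zero, ← Polynomial.resultant_map_map, hN, hQd, hNd, Polynomial.resultant_C_mul_right]
    rw [← hq, h0, mul_zero]
  obtain ⟨u, v, -, -, h⟩ := Polynomial.exists_mul_add_mul_eq_C_resultant q G hqd.le le_rfl (Or.inl (by omega))
  have h3 := congrArg (Polynomial.eval φ) h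
  rw [Polynomial.eval_C, Polynomial.eval_add, Polynomial.eval_mul, Polynomial.eval_mul] at h3
  have h4 : Polynomial.X^(l+1) ∣ Polynomial.resultant q G d G.natDegree := by
    rw [← h3]
    exact dvd_add (hφ.mul_right _) (hGφ.mul_right _)
  have h5 := Polynomial.natDegree_le_of_dvd h4 hR2
  rw [Polynomial.natDegree_X_pow] at h5
  have h6 := natDegree_resultant_le' q G d G.natDegree d (fun i => by
    rw [hq, Polynomial.coeff_map]; exact (th_natDegree s _).trans (hQc i)) (fun i => (hGc i).le)
  have : (d + G.natDegree) * d ≤ 2*d*d := Nat.mul_le_mul_right _ (by omega)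
  omega
end DG

namespace DG
open MvPolynomial

lemma exists_of_det_zeroK {K : Type*} [Field K] {ι J : Type*} [Fintype J] [DecidableEq J] (Z : Finset ι) (a : ι → J → K)
    (h : ∀ P : J → ι, (∀ i, P i ∈ Z) → (Matrix.of fun i j => a (P i) j).det = 0) :
    ∃ c : J → K, c ≠ 0 ∧ ∀ i ∈ Z, ∑ j, c j * a i j = 0 := by
  classical
  by_cases htop : Submodule.span K (a '' (Z : Set ι)) = ⊤
  · exfalso
    obtain ⟨b, hb, hspan, hind⟩ := exists_linearIndependent K (a '' (Z : Set ι))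
    have hfin : b.Finite := (Z.finite_toSet.image a).subset hb
    have _ : Fintype b := hfin.fintype
    have hcard : Fintype.card J = Fintype.card b := by
      have h1 := finrank_span_set_eq_card hind
      rw [hspan, htop, finrank_top, Module.finrank_fintype_fun_eq_card, Set.toFinset_card] at h1
      exact h1
    obtain e := Fintype.equivOfCardEq hcard
    have hrow : ∀ w : b, ∃ i ∈ Z, a i = w.1 := fun w => by
      obtain ⟨i, hi, h⟩ := hb w.2
      exact ⟨i, hi, h⟩
    choose r hrS hr using hrow
    have h1 := h (fun j => r (e j)) (fun j => hrS _)
    have h2 : LinearIndependent K (fun j => a (r (e j))) := by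
      have : (fun j => a (r (e j))) = (Subtype.val : b → _) ∘ e := by
        ext1 j; exact hr (e j)
      rw [this]
      exact hind.comp _ e.injective
    have h3 := (Matrix.linearIndependent_rows_iff_isUnit (A := Matrix.of fun i j => a (r (e i)) j)).1 h2
    rw [Matrix.isUnit_iff_isUnit_det, h1] at h3
    simp at h3
  · obtain ⟨φ, hφ0, hφ⟩ := Submodule.exists_le_ker_of_lt_top _ (lt_top_iff_ne_top.2 htop)
    refine ⟨fun j => φ (Pi.single j 1), ?_, ?_⟩
    · intro h0
      apply hφ0
      apply LinearMap.pi_ext'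
      intro j; ext; simpa using congrFun h0 j
    · intro i hi
      have h1 : φ (a i) = 0 := hφ (Submodule.subset_span ⟨i, hi, rfl⟩)
      rw [LinearMap.pi_apply_eq_sum_univ φ (a i)] at h1
      rw [← h1]
      refine Finset.sum_congr rfl fun j _ => ?_
      rw [smul_eq_mul, mul_comm]
      congr 1
      show φ _ = φ _
      congr 1
      funext k; simp [Pi.single_apply, eq_comm]

/-- bivariate polynomial with prescribed coefficients -/
noncomputable def mkG {R : Type*} [CommRing R] (d : ℕ) (g : Fin d × Fin d → R) : Polynomial (Polynomial R) :=
  ∑ p, Polynomial.C (Polynomial.C (g p) * Polynomial.X ^ (p.2 : ℕ)) * Polynomial.X ^ (p.1 : ℕ)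

lemma mkG_natDegree {R : Type*} [CommRing R] (d : ℕ) (hd : 1 ≤ d) (g : Fin d × Fin d → R) : (mkG d g).natDegree < d := by
  have : (mkG d g).natDegree ≤ d - 1 := by
    refine Polynomial.natDegree_sum_le_of_forall_le _ _ fun p _ => ?_
    refine (Polynomial.natDegree_C_mul_X_pow_le _ _).trans (by have := p.1.2; omega)
  omega

lemma mkG_coeff {R : Type*} [CommRing R] (d : ℕ) (g : Fin d × Fin d → R) (i : ℕ) :
    (mkG d g).coeff i = ∑ p, if i = p.1 then Polynomial.C (g p) * Polynomial.X ^ (p.2 : ℕ) else 0 := by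
  rw [mkG, Polynomial.finsetSum_coeff]
  simp only [Polynomial.coeff_C_mul_X_pow]

lemma mkG_coeff_natDegree {R : Type*} [CommRing R] (d : ℕ) (hd : 1 ≤ d) (g : Fin d × Fin d → R) (i : ℕ) : ((mkG d g).coeff i).natDegree < d := by
  have : ((mkG d g).coeff i).natDegree ≤ d - 1 := by
    rw [mkG_coeff]
    refine Polynomial.natDegree_sum_le_of_forall_le _ _ fun p _ => ?_
    split_ifs
    · exact (Polynomial.natDegree_C_mul_X_pow_le _ _).trans (by have := p.2.2; omega)
    · simp
  omega

lemma mkG_coeff2 {R : Type*} [CommRing R] (d : ℕ) (g : Fin d × Fin d → R) (q : Fin d × Fin d) :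
    ((mkG d g).coeff q.1).coeff q.2 = g q := by
  rw [mkG_coeff, Polynomial.finsetSum_coeff, Finset.sum_eq_single q]
  · simp
  · intro p _ hp
    split_ifs with h
    · rw [Polynomial.coeff_C_mul_X_pow, if_neg]
      intro h2
      exact hp (Prod.ext (Fin.ext h.symm) (Fin.ext h2.symm))
    · simp
  · simp

lemma mkG_self {R : Type*} [CommRing R] (d : ℕ) (hd : 1 ≤ d) (U : Polynomial (Polynomial R)) (h1 : U.natDegree < d)
    (h2 : ∀ i, (U.coeff i).natDegree < d) : mkG d (fun p => (U.coeff p.1).coeff p.2) = U := by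
  ext i j
  by_cases hi : i < d
  · by_cases hj : j < d
    · exact mkG_coeff2 d _ (⟨i, hi⟩, ⟨j, hj⟩)
    · rw [Polynomial.coeff_eq_zero_of_natDegree_lt, Polynomial.coeff_eq_zero_of_natDegree_lt]
      · have := h2 i; omega
      · have := mkG_coeff_natDegree d hd (fun p => (U.coeff p.1).coeff p.2) i; omega
  · rw [Polynomial.coeff_eq_zero_of_natDegree_lt (n := i), Polynomial.coeff_eq_zero_of_natDegree_lt (p := U)]
    · omega
    · have := mkG_natDegree d hd (fun p => (U.coeff p.1).coeff p.2); omega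

lemma mkG_eval_coeff {R : Type*} [CommRing R] (d : ℕ) (g : Fin d × Fin d → R) (φ : Polynomial R) (k : ℕ) :
    ((mkG d g).eval φ).coeff k = ∑ p, g p * (Polynomial.X ^ (p.2 : ℕ) * φ ^ (p.1 : ℕ)).coeff k := by
  rw [mkG, Polynomial.eval_finsetSum, Polynomial.finsetSum_coeff]
  refine Finset.sum_congr rfl fun p _ => ?_
  rw [Polynomial.eval_mul, Polynomial.eval_C, Polynomial.eval_pow, Polynomial.eval_X, mul_assoc, Polynomial.coeff_C_mul]

set_option maxHeartbeats 1600000 in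
lemma bertK (s d : ℕ) (hd : 1 ≤ d) (Q : Polynomial (MvPolynomial (Fin (s+1)) ℂ)) (hQ : Irreducible Q) (hp : Q.IsPrimitive)
    (hQd : Q.natDegree = d) (hQc : ∀ i, (Q.coeff i).totalDegree ≤ d) (ζ c : ℂ) (hc : c ≠ 0)
    (h0 : Polynomial.X ∣ (Q.map (th s)).eval (Polynomial.C (C ζ))) 
    (h1 : Polynomial.X ∣ (Q.map (th s)).derivative.eval (Polynomial.C (C ζ)) - Polynomial.C (C c)) :
    ∃ W : MvPolynomial (Fin s) ℂ, W ≠ 0 ∧ W.totalDegree ≤ d*d*(2*d*d) ∧ ∀ a, eval a W ≠ 0 → ∀ U V : Polynomial (Polynomial ℂ),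
      (Q.map (th s)).map (Polynomial.mapRingHom (eval a)) = U*V → U ≠ 0 → V ≠ 0 → U.natDegree<d → V.natDegree<d →
      (∀ i, (U.coeff i).natDegree<d) → (∀ i, (V.coeff i).natDegree<d) → False := by
  classical
  obtain ⟨Φ, hΦ, hΦl⟩ := newton s Q ζ c hc h0 h1 (2*d*d)
  set l := 2*d*d with hl
  set φ := th s Φ with hφ
  let M : ℕ → Fin d × Fin d → MvPolynomial (Fin s) ℂ := fun k p => (Polynomial.X ^ (p.2 : ℕ) * φ ^ (p.1 : ℕ)).coeff k
  have hM : ∀ k p, (M k p).totalDegree ≤ k := fun k p => by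
    have : Polynomial.X ^ (p.2 : ℕ) * φ ^ (p.1 : ℕ) = th s (X 0 ^ (p.2 : ℕ) * Φ ^ (p.1:ℕ)) := by
      rw [map_mul, map_pow, map_pow, th_X0]
    show ((Polynomial.X ^ (p.2 : ℕ) * φ ^ (p.1 : ℕ)).coeff k).totalDegree ≤ k
    rw [this]; exact th_coeff_deg _ _ _
  obtain ⟨P, hP, hdet⟩ : ∃ P : Fin d × Fin d → ℕ, (∀ i, P i ∈ Finset.range (l+1)) ∧ (Matrix.of fun i j => M (P i) j).det ≠ 0 := by
    by_contra hcon
    push Not at hcon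
    let K := FractionRing (MvPolynomial (Fin s) ℂ)
    obtain ⟨e, he0, he⟩ := exists_of_det_zeroK (K := K) (Finset.range (l+1)) (fun k p => algebraMap _ K (M k p)) (by
      intro P hP
      have := congrArg (algebraMap _ K) (hcon P hP)
      rw [RingHom.map_det, map_zero] at this
      rw [← this]; rfl)
    obtain ⟨b, hb⟩ := IsLocalization.exist_integer_multiples_of_finite (nonZeroDivisors (MvPolynomial (Fin s) ℂ)) e
    choose g hg using hb
    have hb0 : algebraMap _ K (b : MvPolynomial (Fin s) ℂ) ≠ 0 := by
      intro h
      exact nonZeroDivisors.coe_ne_zero b ((IsFractionRing.injective _ K) (by rw [h, map_zero]))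
    have hker : ∀ k ∈ Finset.range (l+1), ∑ p, g p * M k p = 0 := by
      intro k hk
      apply IsFractionRing.injective _ K
      rw [map_sum, map_zero]
      have := he k hk
      rw [← mul_zero (algebraMap _ K (b : MvPolynomial (Fin s) ℂ)), ← this, Finset.mul_sum]
      refine Finset.sum_congr rfl fun p _ => ?_
      rw [map_mul, hg p, Algebra.smul_def]; ring
    have hG := gen_kernel s d hd Q hQ hp hQd hQc φ l le_rfl hΦl (mkG d g) (mkG_natDegree d hd g) (mkG_coeff_natDegree d hd g) (by
      rw [Polynomial.X_pow_dvd_iff]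
      intro k hk
      rw [mkG_eval_coeff]
      exact hker k (Finset.mem_range.2 hk))
    apply he0
    ext p
    have h3 := mkG_coeff2 d g p
    rw [hG] at h3
    have h4 := hg p
    rw [← h3, Algebra.smul_def] at h4
    simp only [Polynomial.coeff_zero, map_zero] at h4
    exact (mul_eq_zero.1 h4.symm).resolve_left hb0
  refine ⟨_, hdet, ?_, ?_⟩
  · refine (totalDegree_det_le _ l fun i j => ?_).trans (by simp [hl])
    have := Finset.mem_range.1 (hP i)
    exact (hM _ _).trans (by omega)
  · intro a ha U V hUV hU0 hV0 hUd hVd hUc hVc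
    set φa := φ.map (eval a) with hφa
    have key : ∀ U : Polynomial (Polynomial ℂ), U ≠ 0 → U.natDegree<d → (∀ i, (U.coeff i).natDegree<d) → Polynomial.X^(l+1) ∣ U.eval φa → False := by
      intro U hU0 hUd hUc hdv
      apply hU0
      set g : Fin d × Fin d → ℂ := fun p => (U.coeff p.1).coeff p.2 with hg
      have hUg : mkG d g = U := mkG_self d hd U hUd hUc
      rw [← hUg] at hdv ⊢
      have hg0 : g = 0 := by
        refine Matrix.eq_zero_of_mulVec_eq_zero (M := Matrix.of fun i j => eval a (M (P i) j)) ?_ ?_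
        · have := RingHom.map_det (eval a) (Matrix.of fun i j => M (P i) j)
          rw [this] at ha
          exact ha
        · ext i
          rw [Polynomial.X_pow_dvd_iff] at hdv
          have h3 := hdv (P i) (Finset.mem_range.1 (hP i))
          rw [mkG_eval_coeff] at h3
          rw [Matrix.mulVec, dotProduct, Pi.zero_apply, ← h3]
          refine Finset.sum_congr rfl fun p _ => ?_
          rw [Matrix.of_apply, mul_comm]
          congr 1
          show eval a ((Polynomial.X ^ (p.2 : ℕ) * φ ^ (p.1 : ℕ)).coeff (P i)) = _
          rw [← Polynomial.coeff_map, Polynomial.map_mul, Polynomial.map_pow, Polynomial.map_pow, Polynomial.map_X]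
      rw [hg0]
      simp [mkG]
    set q := Q.map (th s) with hq
    set ψ := Polynomial.mapRingHom (eval a) with hψ
    have hψφ : ψ φ = φa := rfl
    have hev : ∀ F : Polynomial (Polynomial (MvPolynomial (Fin s) ℂ)), ∀ x, (F.map ψ).eval (ψ x) = ψ (F.eval x) := fun F x => by
      rw [Polynomial.eval_map, Polynomial.eval₂_hom]
    have hψX : ψ Polynomial.X = Polynomial.X := by simp [hψ]
    have hd1 : Polynomial.X^(l+1) ∣ U.eval φa * V.eval φa := by
      rw [← Polynomial.eval_mul, ← hUV, ← hψφ, hev]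
      have := map_dvd ψ hΦl
      rwa [map_pow, hψX] at this
    -- derivative
    have hd2 : Polynomial.X ∣ (U.derivative.eval φa * V.eval φa + U.eval φa * V.derivative.eval φa) - Polynomial.C c := by
      have h4 : Polynomial.X ∣ q.derivative.eval φ - Polynomial.C (C c) := by
        have := hΦ.trans (Polynomial.sub_dvd_eval_sub φ (Polynomial.C (C ζ)) q.derivative)
        have := dvd_add this h1
        rwa [sub_add_sub_cancel] at this
      have h5 := map_dvd ψ h4
      rw [map_sub, hψX, ← hev, ← Polynomial.derivative_map, hUV, Polynomial.derivative_mul, hψφ] at h5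
      simpa [hψ] using h5
    have hpX : Prime (Polynomial.X : Polynomial ℂ) := Polynomial.prime_X
    have hnot : ¬ (Polynomial.X ∣ U.eval φa ∧ Polynomial.X ∣ V.eval φa) := by
      rintro ⟨hu, hv⟩
      have h5 := dvd_sub (dvd_add (hv.mul_left (U.derivative.eval φa)) (hu.mul_right (V.derivative.eval φa))) hd2
      rw [sub_sub_cancel, Polynomial.X_dvd_iff, Polynomial.coeff_C_zero] at h5
      exact hc h5
    by_cases hu : Polynomial.X ∣ U.eval φa
    · have hv : ¬ Polynomial.X ∣ V.eval φa := fun hv => hnot ⟨hu, hv⟩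
      exact key U hU0 hUd hUc (hpX.pow_dvd_of_dvd_mul_right _ hv hd1)
    · exact key V hV0 hVd hVc (hpX.pow_dvd_of_dvd_mul_left _ hu hd1)
end DG

namespace DG
open MvPolynomial

lemma ZL.aeval' {K : Type*} [Field K] {k m : ℕ} {f : MvPolynomial (Fin (k+1)) K} {d : ℕ} (h : ZL f d)
    (g : Fin (k+1) → MvPolynomial (Fin (m+1)) K) (hg : ∀ i, (g i).totalDegree ≤ 1)
    (he : ∀ i, eval (Pi.single 0 1) (homogeneousComponent 1 (g i)) = (Pi.single 0 1 : Fin (k+1) → K) i) : ZL (aeval g f) d := by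
  refine ZL.of_le ((totalDegree_aeval_le f g hg).trans h.1.le) ?_
  rw [top_aeval f d h.1.le g hg, funext he]
  exact h.eval_ne

/-- dehomogenisation images -/
noncomputable def dhg (s : ℕ) : Fin (s+3) → MvPolynomial (Fin (s+2)) ℂ := Fin.cons (X 0) (Fin.cons 1 (fun j : Fin (s+1) => X j.succ))

@[simp] lemma dhg_0 (s : ℕ) : dhg s 0 = X 0 := rfl
@[simp] lemma dhg_1 (s : ℕ) : dhg s 1 = 1 := rfl
@[simp] lemma dhg_ss (s : ℕ) (j : Fin (s+1)) : dhg s j.succ.succ = X j.succ := rfl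

lemma dhg_td (s : ℕ) (i : Fin (s+3)) : (dhg s i).totalDegree ≤ 1 := by
  refine Fin.cases ?_ (fun i => Fin.cases ?_ (fun j => ?_) i) i
  · simp
  · rw [Fin.succ_zero_eq_one, dhg_1]; simp
  · simp

lemma dh_ZL (s d : ℕ) (P : MvPolynomial (Fin (s+3)) ℂ) (h : ZL P d) : ZL (aeval (dhg s) P) d := by
  refine h.aeval' _ (dhg_td s) fun i => ?_
  refine Fin.cases ?_ (fun i => Fin.cases ?_ (fun j => ?_) i) i
  · rw [dhg_0, hom1_X]; simp
  · rw [Fin.succ_zero_eq_one, dhg_1, ← C_1, hom1_C]; simp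
  · rw [dhg_ss, hom1_X]; simp

lemma dh_eval (s : ℕ) (P : MvPolynomial (Fin (s+3)) ℂ) (z : Fin (s+2) → ℂ) :
    eval z (aeval (dhg s) P) = eval (fun i => eval z (dhg s i)) P := by
  rw [← AlgHom.coe_toRingHom, ← RingHom.comp_apply]
  congr 1
  apply MvPolynomial.ringHom_ext <;> simp

lemma dh_inj (s d : ℕ) (P : MvPolynomial (Fin (s+3)) ℂ) (h : P.IsHomogeneous d) (h0 : aeval (dhg s) P = 0) : P = 0 := by
  have : P * X 1 = 0 := by
    apply MvPolynomial.funext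
    intro y
    rw [map_mul, eval_X, map_zero]
    by_cases h1 : y 1 = 0
    · rw [h1, mul_zero]
    · have e : y = fun i => y 1 * (fun i => eval (fun k : Fin (s+2) => (Fin.cons (y 0 / y 1) (fun j : Fin (s+1) => y j.succ.succ / y 1) : Fin (s+2) → ℂ) k) (dhg s i)) i := by
        ext i
        refine Fin.cases ?_ (fun i => Fin.cases ?_ (fun j => ?_) i) i
        · simp [mul_div_cancel₀ _ h1]
        · show y 1 = y 1 * eval _ (dhg s 1)
          rw [dhg_1]; simp
        · simp [mul_div_cancel₀ _ h1]
      rw [e, eval_hom_smul h, ← dh_eval, h0]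
      simp
  exact (mul_eq_zero.1 this).resolve_right (X_ne_zero 1)

lemma dh_surj (s e : ℕ) (N : MvPolynomial (Fin (s+2)) ℂ) (h : N.totalDegree ≤ e) : ∃ P : MvPolynomial (Fin (s+3)) ℂ, P.IsHomogeneous e ∧ aeval (dhg s) P = N := by
  classical
  refine ⟨∑ m ∈ N.support, C (coeff m N) * (rename (Fin.cons 0 (fun j : Fin (s+1) => j.succ.succ) : Fin (s+2) → Fin (s+3)) (monomial m (1:ℂ))) * X 1 ^ (e - m.degree), ?_, ?_⟩
  · apply IsHomogeneous.sum
    intro m hm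
    have h1 := (totalDegree_le_iff_degree N e).1 h m hm
    have h2 : (rename (Fin.cons 0 (fun j : Fin (s+1) => j.succ.succ) : Fin (s+2) → Fin (s+3)) (monomial m (1:ℂ))).IsHomogeneous m.degree :=
      IsHomogeneous.rename_isHomogeneous (isHomogeneous_monomial _ rfl)
    have h3 := ((isHomogeneous_C (Fin (s+3)) (coeff m N)).mul h2).mul ((isHomogeneous_X ℂ (1 : Fin (s+3))).pow (e - m.degree))
    have e1 : 0 + m.degree + 1 * (e - m.degree) = e := by omega
    rwa [e1] at h3
  · rw [map_sum]
    conv_rhs => rw [N.as_sum]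
    refine Finset.sum_congr rfl fun m _ => ?_
    rw [map_mul, map_mul, map_pow, aeval_X, dhg_1, one_pow, mul_one, aeval_rename]
    have : (dhg s ∘ (Fin.cons 0 (fun j : Fin (s+1) => j.succ.succ) : Fin (s+2) → Fin (s+3))) = X := by
      ext1 i
      refine Fin.cases ?_ (fun j => ?_) i
      · simp
      · simp
    rw [this, aeval_X_left_apply, aeval_C, algebraMap_eq, C_mul_monomial, mul_one]

lemma dh_irr (s d : ℕ) (P : MvPolynomial (Fin (s+3)) ℂ) (h : ZL P d) (hh : P.IsHomogeneous d) (hP : Irreducible P) : Irreducible (aeval (dhg s) P) := by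
  have h1 := td_pos_of_irr hP
  have h2 := dh_ZL s d P h
  refine irr_of_td (by rw [h2.1, ← h.1]; exact h1) fun a b hab ha hb => ?_
  have e : d = a.totalDegree + b.totalDegree := by rw [← h2.1, hab, totalDegree_mul_of_isDomain ha hb]
  obtain ⟨A, hA, hA'⟩ := dh_surj s a.totalDegree a le_rfl
  obtain ⟨B, hB, hB'⟩ := dh_surj s b.totalDegree b le_rfl
  have h3 : P = A * B := by
    rw [← sub_eq_zero]
    refine dh_inj s d _ (hh.sub (by rw [e]; exact hA.mul hB)) ?_
    rw [map_sub, map_mul, hA', hB', hab, sub_self]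
  have hA0 : A ≠ 0 := by rintro rfl; apply ha; rw [← hA', map_zero]
  have hB0 : B ≠ 0 := by rintro rfl; apply hb; rw [← hB', map_zero]
  rw [← hA.totalDegree hA0, ← hB.totalDegree hB0]
  exact td_of_irr hP h3

lemma th_coeff_zero (s : ℕ) (F : MvPolynomial (Fin (s+1)) ℂ) : (th s F).coeff 0 = C (eval 0 F) := by
  have : (Polynomial.constantCoeff.comp (th s)) = C.comp (eval (0 : Fin (s+1) → ℂ)) := by
    apply MvPolynomial.ringHom_ext
    · intro c; simp
    · intro i
      refine Fin.cases ?_ (fun j => ?_) i <;> simp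
  have := congrArg (fun g => g F) this
  simpa using this

/-- existence of a small fibre with a simple root -/
lemma sep (s d : ℕ) (hd : 1 ≤ d) (P : MvPolynomial (Fin (s+3)) ℂ) (h : ZL P d) (hh : P.IsHomogeneous d) (hP : Irreducible P) :
    ∃ c : Fin (s+1) → ℕ, (∀ i, c i ≤ 2*d*d) ∧ ∃ ζ : ℂ, 
      ((finSuccEquiv ℂ (s+1) (aeval (dhg s) P)).map (eval fun i => (c i : ℂ))).eval ζ = 0 ∧
      ((finSuccEquiv ℂ (s+1) (aeval (dhg s) P)).map (eval fun i => (c i : ℂ))).derivative.eval ζ ≠ 0 := by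
  classical
  let _ : NormalizedGCDMonoid (MvPolynomial (Fin (s+1)) ℂ) :=
    Classical.choice (inferInstance : Nonempty (NormalizedGCDMonoid (MvPolynomial (Fin (s+1)) ℂ)))
  have h2 := dh_ZL s d P h
  have hi := dh_irr s d P h hh hP
  set p := aeval (dhg s) P with hp
  set Q := finSuccEquiv ℂ (s+1) p with hQ
  have hQi : Irreducible Q := (MulEquiv.irreducible_iff (finSuccEquiv ℂ (s+1))).2 hi
  have hQd : Q.natDegree = d := h2.natDegree
  have hD0 : Q.derivative ≠ 0 := by
    intro h0
    have := Polynomial.derivative_eq_zero.1 h0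
    omega
  have hnd : ¬ Q ∣ Q.derivative := fun h => by
    have := Polynomial.natDegree_le_of_dvd h hD0
    have := Polynomial.natDegree_derivative_lt (p := Q) (by omega)
    omega
  have hR := res_ne_zero Q Q.derivative hQi h2.primitive hnd
  have hQc : ∀ i, (Q.coeff i).totalDegree ≤ d := fun i => (totalDegree_coeff_fse p i).trans h2.1.le
  have hRd : (Polynomial.resultant Q Q.derivative).totalDegree ≤ 2*d*d := by
    refine (totalDegree_resultant_le Q Q.derivative _ _ d hQc (fun i => ?_)).trans ?_
    · rw [Polynomial.coeff_derivative]
      refine (totalDegree_mul _ _).trans ?_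
      have : ((i:MvPolynomial (Fin (s+1)) ℂ) + 1).totalDegree = 0 := by
        have : ((i:MvPolynomial (Fin (s+1)) ℂ) + 1) = C ((i:ℂ)+1) := by simp
        rw [this, totalDegree_C]
      rw [this]; exact hQc _
    · have := Polynomial.natDegree_derivative_le Q
      exact Nat.mul_le_mul_right _ (by omega)
  obtain ⟨c, hc, hce⟩ := exists_small _ hR _ hRd
  refine ⟨c, hc, ?_⟩
  set q := Q.map (eval fun i => (c i : ℂ)) with hq
  have hqd : q.natDegree = d := by
    rw [hq, Polynomial.natDegree_map_of_leadingCoeff_ne_zero _, hQd]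
    rw [h2.leadingCoeff, eval_C]; exact h2.2
  obtain ⟨ζ, hζ⟩ := IsAlgClosed.exists_root q (by 
    intro h0
    have := Polynomial.natDegree_eq_zero_iff_degree_le_zero.2 (le_of_eq h0)
    omega)
  refine ⟨ζ, hζ, fun h0 => hce ?_⟩
  obtain ⟨u, v, -, -, h⟩ := Polynomial.exists_mul_add_mul_eq_C_resultant Q Q.derivative le_rfl le_rfl
      (Or.inl (by omega))
  have h3 := congrArg (fun P => Polynomial.eval ζ (Polynomial.map (eval fun i => (c i : ℂ)) P)) h
  have e1 : Polynomial.eval ζ (Polynomial.map (eval fun i => (c i : ℂ)) Q) = 0 := hζ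
  have e2 : Polynomial.eval ζ (Polynomial.map (eval fun i => (c i : ℂ)) Q.derivative) = 0 := by
    rw [← Polynomial.derivative_map]; exact h0
  simp only [Polynomial.map_add, Polynomial.map_mul, Polynomial.eval_add, Polynomial.eval_mul, e1, e2, zero_mul, add_zero, Polynomial.map_C, Polynomial.eval_C] at h3
  exact h3.symm

/-- the 3-dimensional slice images -/
noncomputable def slg {K : Type*} [Field K] (s : ℕ) (a : Fin s → K) : Fin (s+3) → MvPolynomial (Fin 3) K := 
  Fin.cons (X 0) (Fin.cons (X 1) (Fin.cons (X 2) (fun j => C (a j) * X 2)))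

lemma slg_0 {K : Type*} [Field K] (s : ℕ) (a : Fin s → K) : slg s a 0 = X 0 := rfl
lemma slg_1 {K : Type*} [Field K] (s : ℕ) (a : Fin s → K) : slg s a (Fin.succ 0) = X 1 := rfl
lemma slg_2 {K : Type*} [Field K] (s : ℕ) (a : Fin s → K) : slg s a (Fin.succ (Fin.succ 0)) = X 2 := rfl
lemma slg_s {K : Type*} [Field K] (s : ℕ) (a : Fin s → K) (j : Fin s) : slg s a j.succ.succ.succ = C (a j) * X 2 := rfl

lemma slg_td {K : Type*} [Field K] (s : ℕ) (a : Fin s → K) (i : Fin (s+3)) : (slg s a i).totalDegree ≤ 1 := by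
  refine Fin.cases ?_ (fun i => Fin.cases ?_ (fun i => Fin.cases ?_ (fun j => ?_) i) i) i
  · rw [slg_0]; simp
  · rw [slg_1]; simp
  · rw [slg_2]; simp
  · rw [slg_s]
    exact (totalDegree_mul _ _).trans (by simp)

lemma slg_ZL {K : Type*} [Field K] (s d : ℕ) (a : Fin s → K) (P : MvPolynomial (Fin (s+3)) K) (h : ZL P d) : ZL (aeval (slg s a) P) d := by
  refine h.aeval' _ (slg_td s a) fun i => ?_
  refine Fin.cases ?_ (fun i => Fin.cases ?_ (fun i => Fin.cases ?_ (fun j => ?_) i) i) i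
  · rw [slg_0, hom1_X]; simp
  · rw [slg_1, hom1_X, Pi.single_eq_of_ne (Fin.succ_ne_zero _)]; simp
  · rw [slg_2, hom1_X, Pi.single_eq_of_ne (Fin.succ_ne_zero _)]; simp
  · rw [slg_s, hom1_CX, Pi.single_eq_of_ne (Fin.succ_ne_zero _)]; simp

theorem bert (s d : ℕ) (hd : 1 ≤ d) (P : MvPolynomial (Fin (s+3)) ℂ) (h : ZL P d) (hh : P.IsHomogeneous d) (hP : Irreducible P)
    (ζ : ℂ) (h0 : ((finSuccEquiv ℂ (s+1) (aeval (dhg s) P)).map (eval 0)).eval ζ = 0)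
    (h1 : ((finSuccEquiv ℂ (s+1) (aeval (dhg s) P)).map (eval 0)).derivative.eval ζ ≠ 0) :
    ∃ W : MvPolynomial (Fin s) ℂ, W ≠ 0 ∧ W.totalDegree ≤ d*d*(2*d*d) ∧ ∀ a, eval a W ≠ 0 → Irreducible (aeval (slg s a) P) := by
  have h2 := dh_ZL s d P h
  have hi := dh_irr s d P h hh hP
  set p := aeval (dhg s) P with hp
  set Q := finSuccEquiv ℂ (s+1) p with hQ
  have hQi : Irreducible Q := (MulEquiv.irreducible_iff (finSuccEquiv ℂ (s+1))).2 hi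
  have hQd : Q.natDegree = d := h2.natDegree
  have hQc : ∀ i, (Q.coeff i).totalDegree ≤ d := fun i => (totalDegree_coeff_fse p i).trans h2.1.le
  have hev : ∀ F : Polynomial (MvPolynomial (Fin (s+1)) ℂ), ((F.map (th s)).eval (Polynomial.C (C ζ))).coeff 0 = C ((F.map (eval 0)).eval ζ) := by
    intro F
    have e1 : (F.map (th s)).eval (Polynomial.C (C ζ)) = th s (F.eval (C ζ)) := by
      rw [← th_C, Polynomial.eval_map, Polynomial.eval₂_hom]
    rw [e1, th_coeff_zero]
    congr 1
    have : (eval (0 : Fin (s+1) → ℂ)) (C ζ) = ζ := eval_C ζ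
    conv_rhs => rw [← this, Polynomial.eval_map, Polynomial.eval₂_hom]
  obtain ⟨W, hW0, hWd, hW⟩ := bertK s d hd Q hQi h2.primitive hQd hQc ζ _ h1 
    (by rw [Polynomial.X_dvd_iff, hev, h0, map_zero]) 
    (by rw [Polynomial.X_dvd_iff, Polynomial.coeff_sub, Polynomial.derivative_map, hev, Polynomial.coeff_C_zero, Polynomial.derivative_map, sub_self])
  refine ⟨W, hW0, hWd, fun a ha => ?_⟩
  have hF := slg_ZL s d a P h
  refine irr_of_td (by rw [hF.1]; exact hd) fun u v huv hu hv => ?_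
  by_contra hcon
  push Not at hcon
  have e : d = u.totalDegree + v.totalDegree := by rw [← hF.1, huv, totalDegree_mul_of_isDomain hu hv]
  have zu : ZL u u.totalDegree := hF.of_dvd ⟨v, huv⟩
  have zv : ZL v v.totalDegree := hF.of_dvd ⟨u, by rw [huv, mul_comm]⟩
  let τ : MvPolynomial (Fin 2) ℂ →ₐ[ℂ] Polynomial ℂ := aeval ![1, Polynomial.X]
  have hτ : ∀ F, (τ F).natDegree ≤ F.totalDegree := fun F => by
    refine natDegree_aeval_le F _ fun i => ?_
    fin_cases i <;> simp
  have key : ∀ u : MvPolynomial (Fin 3) ℂ, ZL u u.totalDegree → u.totalDegree < d → 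
      ((finSuccEquiv ℂ 2 u).map τ.toRingHom) ≠ 0 ∧ ((finSuccEquiv ℂ 2 u).map τ.toRingHom).natDegree < d ∧ 
      ∀ i, (((finSuccEquiv ℂ 2 u).map τ.toRingHom).coeff i).natDegree < d := by
    intro u zu hud
    refine ⟨fun h0 => ?_, ?_, fun i => ?_⟩
    · have := congrArg (fun F => Polynomial.coeff F u.totalDegree) h0
      simp only [Polynomial.coeff_map, zu.coeff, Polynomial.coeff_zero] at this
      have h3 : τ.toRingHom (C (coeff (Finsupp.single 0 u.totalDegree) u)) = Polynomial.C (coeff (Finsupp.single 0 u.totalDegree) u) := by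
        show τ (C _) = _
        simp [τ]
      rw [h3, Polynomial.C_eq_zero] at this
      exact zu.2 this
    · refine lt_of_le_of_lt (Polynomial.natDegree_map_le.trans (natDegree_fse_le u)) hud
    · rw [Polynomial.coeff_map]
      exact lt_of_le_of_lt ((hτ _).trans (totalDegree_coeff_fse u i)) hud
  obtain ⟨hU0, hU1, hU2⟩ := key u zu (by omega)
  obtain ⟨hV0, hV1, hV2⟩ := key v zv (by omega)
  refine hW a ha _ _ ?_ hU0 hV0 hU1 hV1 hU2 hV2
  rw [← Polynomial.map_mul, ← map_mul, ← huv, hQ, hp]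
  have fX0 : ∀ k, finSuccEquiv ℂ k (X 0) = Polynomial.X := fun k => finSuccEquiv_X_zero
  have fXs : ∀ k (j : Fin k), finSuccEquiv ℂ k (X j.succ) = Polynomial.C (X j) := fun k j => finSuccEquiv_X_succ
  have fC : ∀ k (c : ℂ), finSuccEquiv ℂ k (C c) = Polynomial.C (C c) := fun k c => by simp [finSuccEquiv_apply]
  have τC : ∀ c, τ (C c) = Polynomial.C c := fun c => by simp [τ]
  let A1 : MvPolynomial (Fin (s+3)) ℂ →+* MvPolynomial (Fin (s+2)) ℂ := (aeval (dhg s) : MvPolynomial (Fin (s+3)) ℂ →ₐ[ℂ] _)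
  let A2 : MvPolynomial (Fin (s+3)) ℂ →+* MvPolynomial (Fin 3) ℂ := (aeval (slg s a) : MvPolynomial (Fin (s+3)) ℂ →ₐ[ℂ] _)
  let E1 : MvPolynomial (Fin (s+2)) ℂ →+* Polynomial (MvPolynomial (Fin (s+1)) ℂ) := RingHomClass.toRingHom (finSuccEquiv ℂ (s+1))
  let E2 : MvPolynomial (Fin 3) ℂ →+* Polynomial (MvPolynomial (Fin 2) ℂ) := RingHomClass.toRingHom (finSuccEquiv ℂ 2)
  have : (((Polynomial.mapRingHom (Polynomial.mapRingHom (eval a))).comp (Polynomial.mapRingHom (th s))).comp E1).comp A1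
     = ((Polynomial.mapRingHom τ.toRingHom).comp E2).comp A2 := by
    apply MvPolynomial.ringHom_ext
    · intro c
      show Polynomial.map (Polynomial.mapRingHom (eval a)) (Polynomial.map (th s) (finSuccEquiv ℂ (s+1) (aeval (dhg s) (C c)))) =
        Polynomial.map τ.toRingHom (finSuccEquiv ℂ 2 (aeval (slg s a) (C c)))
      rw [aeval_C, aeval_C, algebraMap_eq, algebraMap_eq, fC, fC, Polynomial.map_C, Polynomial.map_C, Polynomial.map_C]
      show _ = Polynomial.C (τ (C c))
      rw [τC, th_C]; simp
    · intro i
      show Polynomial.map (Polynomial.mapRingHom (eval a)) (Polynomial.map (th s) (finSuccEquiv ℂ (s+1) (aeval (dhg s) (X i)))) =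
        Polynomial.map τ.toRingHom (finSuccEquiv ℂ 2 (aeval (slg s a) (X i)))
      rw [aeval_X, aeval_X]
      refine Fin.cases ?_ (fun i => Fin.cases ?_ (fun i => Fin.cases ?_ (fun j => ?_) i) i) i
      · rw [dhg_0, slg_0, fX0, fX0]; simp
      · rw [slg_1, show dhg s (Fin.succ 0) = 1 from rfl, show (X 1 : MvPolynomial (Fin 3) ℂ) = X (Fin.succ 0) from rfl, fXs, Polynomial.map_C]
        show _ = Polynomial.C (τ (X 0))
        simp [τ]
      · rw [slg_2, dhg_ss, fXs, show (X 2 : MvPolynomial (Fin 3) ℂ) = X (Fin.succ 1) from rfl, fXs, Polynomial.map_C, Polynomial.map_C, Polynomial.map_C, th_X0]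
        show _ = Polynomial.C (τ (X 1))
        simp [τ]
      · rw [slg_s, dhg_ss, fXs, show (X 2 : MvPolynomial (Fin 3) ℂ) = X (Fin.succ 1) from rfl, map_mul, fXs, fC, Polynomial.map_mul, Polynomial.map_C, Polynomial.map_C, Polynomial.map_C, Polynomial.map_C, th_Xs]
        show _ = Polynomial.C (τ (C (a j))) * Polynomial.C (τ (X 1))
        rw [τC]
        simp [τ]
  exact congrArg (fun g => g P) this
end DG

namespace DG
open MvPolynomial

lemma toC_aeval {k m : ℕ} (f : MvPolynomial (Fin k) ℤ) (g : Fin k → MvPolynomial (Fin m) ℤ) :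
    toC (aeval g f) = aeval (fun i => toC (g i)) (toC f) := by
  unfold toC
  rw [← AlgHom.coe_toRingHom, ← AlgHom.coe_toRingHom, ← RingHom.comp_apply, ← RingHom.comp_apply]
  congr 1
  apply MvPolynomial.ringHom_ext
  · intro c; simp
  · intro i; simp

lemma eval_aeval' {R : Type*} [CommRing R] {k m : ℕ} (f : MvPolynomial (Fin k) R) (g : Fin k → MvPolynomial (Fin m) R) (x : Fin m → R) :
    eval x (aeval g f) = eval (fun i => eval x (g i)) f := by
  rw [← AlgHom.coe_toRingHom, ← RingHom.comp_apply]
  congr 1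
  apply MvPolynomial.ringHom_ext <;> simp

lemma ZL_toQ {k : ℕ} {f : MvPolynomial (Fin (k+1)) ℤ} {d : ℕ} (h : ZL (toC f) d) : ZL (toQ f) d := by
  refine ⟨?_, fun h0 => h.2 ?_⟩
  · rw [← h.1, toC_eq, td_map]
  · rw [toC_eq, coeff_map, h0, map_zero]

/-- top form under a linear substitution with possible constants -/
lemma hc_aeval {k m : ℕ} (F : MvPolynomial (Fin k) ℂ) (d : ℕ) (hd : F.totalDegree ≤ d)
    (g g' : Fin k → MvPolynomial (Fin m) ℂ) (hg : ∀ i, (g i).totalDegree ≤ 1) (hg' : ∀ i, homogeneousComponent 1 (g i) = g' i) :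
    homogeneousComponent d (aeval g F) = aeval g' (homogeneousComponent d F) := by
  apply MvPolynomial.funext
  intro v
  rw [top_aeval F d hd g hg, eval_aeval']
  simp only [hg']

/-- shear images -/
noncomputable def shg {R : Type*} [CommRing R] {m : ℕ} (j : Fin m) (w : Fin m → ℕ) : Fin m → MvPolynomial (Fin m) R :=
  fun i => X i + C (w i : R) * X j

lemma shg_td {R : Type*} [CommRing R] [Nontrivial R] {m : ℕ} (j : Fin m) (w : Fin m → ℕ) (i : Fin m) : (shg (R := R) j w i).totalDegree ≤ 1 := by
  refine (totalDegree_add _ _).trans (max_le (by simp) ((totalDegree_mul _ _).trans (by rw [totalDegree_C, totalDegree_X])))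

lemma shg_hom {m : ℕ} (j : Fin m) (w : Fin m → ℕ) (i : Fin m) : homogeneousComponent 1 (shg (R := ℂ) j w i) = shg j w i := by
  rw [shg, map_add, hom1_X, hom1_CX]

lemma toC_shg {m : ℕ} (j : Fin m) (w : Fin m → ℕ) (i : Fin m) : toC (shg (R := ℤ) j w i) = shg (R := ℂ) j w i := by
  simp [toC, shg]

lemma sh_irr {m : ℕ} (j : Fin m) (w : Fin m → ℕ) (hw : w j = 0) (F : MvPolynomial (Fin m) ℂ) (h : Irreducible F) :
    Irreducible (aeval (shg (R := ℂ) j w) F) := by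
  let A : MvPolynomial (Fin m) ℂ →ₐ[ℂ] MvPolynomial (Fin m) ℂ := aeval (shg j w)
  let B : MvPolynomial (Fin m) ℂ →ₐ[ℂ] MvPolynomial (Fin m) ℂ := aeval (fun i => X i - C (w i : ℂ) * X j)
  have h1 : A.comp B = AlgHom.id _ _ := by
    apply MvPolynomial.algHom_ext
    intro i
    simp [A, B, shg, hw]
  have h2 : B.comp A = AlgHom.id _ _ := by
    apply MvPolynomial.algHom_ext
    intro i
    simp [A, B, shg, hw]
  exact (MulEquiv.irreducible_iff (AlgEquiv.ofAlgHom A B h1 h2)).2 h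

lemma sh_transfer {m : ℕ} (f : MvPolynomial (Fin m) ℤ) (j : Fin m) (w : Fin m → ℕ) (hw : w j = 0) (W B : ℕ) (hW : ∀ i, w i ≤ W)
    (S : Finset (Fin m → ℤ)) (hS : ∀ x ∈ S, inBox B x) (hf : ∀ x ∈ S, eval x f = 0) :
    ∃ S' : Finset (Fin m → ℤ), S'.card = S.card ∧ (∀ x ∈ S', inBox ((W+1)*B) x) ∧ ∀ x ∈ S', eval x (aeval (shg j w) f) = 0 := by
  classical
  have hback : ∀ x : Fin m → ℤ, (fun i => eval (fun i => x i - w i * x j) (shg (R := ℤ) j w i)) = x := by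
    intro x; ext i; simp [shg, hw]
  refine ⟨S.image (fun x i => x i - w i * x j), Finset.card_image_of_injective _ ?_, ?_, ?_⟩
  · intro x y hxy
    rw [← hback x, ← hback y]
    have : (fun i => x i - w i * x j) = (fun i => y i - w i * y j) := hxy
    rw [this]
  · intro x hx
    obtain ⟨y, hy, rfl⟩ := Finset.mem_image.1 hx
    intro i
    have h1 := hS y hy i
    have h2 := hS y hy j
    have h3 : |(w i : ℤ) * y j| ≤ W * B := by
      rw [abs_mul, Nat.abs_cast]
      exact mul_le_mul (by exact_mod_cast hW i) h2 (abs_nonneg _) (by positivity)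
    have h4 := abs_sub (y i) ((w i : ℤ) * y j)
    push_cast
    show |y i - w i * y j| ≤ _
    linarith
  · intro x hx
    obtain ⟨y, hy, rfl⟩ := Finset.mem_image.1 hx
    rw [eval_aeval', hback, hf y hy]

/-- slice images with constants -/
noncomputable def slz (s : ℕ) (a : Fin s → ℕ) (k : Fin s → ℤ) : Fin (s+3) → MvPolynomial (Fin 3) ℤ := 
  Fin.cons (X 0) (Fin.cons (X 1) (Fin.cons (X 2) (fun j => C (a j : ℤ) * X 2 + C (k j))))

lemma slz_0 (s : ℕ) (a : Fin s → ℕ) (k : Fin s → ℤ) : slz s a k 0 = X 0 := rfl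
lemma slz_1 (s : ℕ) (a : Fin s → ℕ) (k : Fin s → ℤ) : slz s a k (Fin.succ 0) = X 1 := rfl
lemma slz_2 (s : ℕ) (a : Fin s → ℕ) (k : Fin s → ℤ) : slz s a k (Fin.succ (Fin.succ 0)) = X 2 := rfl
lemma slz_s (s : ℕ) (a : Fin s → ℕ) (k : Fin s → ℤ) (j : Fin s) : slz s a k j.succ.succ.succ = C (a j : ℤ) * X 2 + C (k j) := rfl

lemma slz_td (s : ℕ) (a : Fin s → ℕ) (k : Fin s → ℤ) (i : Fin (s+3)) : (toC (slz s a k i)).totalDegree ≤ 1 := by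
  refine Fin.cases ?_ (fun i => Fin.cases ?_ (fun i => Fin.cases ?_ (fun j => ?_) i) i) i
  · rw [slz_0]; simp [toC]
  · rw [slz_1]; simp [toC]
  · rw [slz_2]; simp [toC]
  · have : toC (slz s a k j.succ.succ.succ) = C (a j : ℂ) * X 2 + C (k j : ℂ) := by
      rw [slz_s, toC, map_add, map_mul, map_X, map_C, map_C]; simp
    rw [this]
    exact (totalDegree_add _ _).trans (max_le ((totalDegree_mul _ _).trans (by rw [totalDegree_C, totalDegree_X])) (by rw [totalDegree_C]; omega))

lemma slz_hom (s : ℕ) (a : Fin s → ℕ) (k : Fin s → ℤ) (i : Fin (s+3)) : homogeneousComponent 1 (toC (slz s a k i)) = slg s (fun j => (a j : ℂ)) i := by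
  refine Fin.cases ?_ (fun i => Fin.cases ?_ (fun i => Fin.cases ?_ (fun j => ?_) i) i) i
  · rw [slz_0, slg_0, toC, map_X, hom1_X]
  · rw [slz_1, slg_1, toC, map_X, hom1_X]
  · rw [slz_2, slg_2, toC, map_X, hom1_X]
  · have : toC (slz s a k j.succ.succ.succ) = C (a j : ℂ) * X 2 + C (k j : ℂ) := by
      rw [slz_s, toC, map_add, map_mul, map_X, map_C, map_C]; simp
    rw [this, map_add, hom1_CX, hom1_C, add_zero, slg_s]

/-- Assembly, normalised case -/
lemma norm_case (s : ℕ) : ∃ g, PB g ∧ ∀ (f : MvPolynomial (Fin (s+3)) ℤ) (d : ℕ), 5 ≤ d → ZL (toC f) d →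
    Irreducible (homogeneousComponent d (toC f)) → 
    (∃ ζ : ℂ, ((finSuccEquiv ℂ (s+1) (aeval (dhg s) (homogeneousComponent d (toC f)))).map (eval 0)).eval ζ = 0 ∧ 
      ((finSuccEquiv ℂ (s+1) (aeval (dhg s) (homogeneousComponent d (toC f)))).map (eval 0)).derivative.eval ζ ≠ 0) →
    ∀ B, 1 ≤ B → ∀ S : Finset (Fin (s+3) → ℤ), (∀ x ∈ S, inBox B x) → (∀ x ∈ S, eval x f = 0) → S.card ≤ g d * B^(s+1) := by
  classical
  obtain ⟨g, hg, hS⟩ := thmS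
  refine ⟨fun d => g d * (3*(d*d*(2*d*d)+1))^s, ?_, ?_⟩
  · exact hg.mul (((PB.const 3).mul (((PB.id.mul PB.id).mul (((PB.const 2).mul PB.id).mul PB.id)).add (PB.const 1))).pow s)
  rintro f d hd hz hirr ⟨ζ, h0, h1⟩ B hB S hSB hSf
  obtain ⟨W, hW0, hWd, hW⟩ := bert s d (by omega) (homogeneousComponent d (toC f)) hz.hc (homogeneousComponent_isHomogeneous d _) hirr ζ h0 h1
  obtain ⟨a, ha, haW⟩ := exists_small W hW0 _ hWd
  have hFa := hW _ haW
  set A := d*d*(2*d*d) with hA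
  set T : Finset (Fin s → ℤ) := Fintype.piFinset fun _ => Finset.Icc (-(((A+1)*B : ℕ) : ℤ)) (((A+1)*B : ℕ) : ℤ) with hT
  have hTc : T.card = (2*((A+1)*B)+1)^s := by
    rw [hT, Fintype.card_piFinset]
    simp only [Int.card_Icc, Finset.prod_const, Finset.card_univ, Fintype.card_fin]
    congr 1
    omega
  have hcard := card_le_fiber S (fun x (j : Fin s) => x j.succ.succ.succ - a j * x (Fin.succ (Fin.succ 0))) T (g d * B) ?_ ?_
  · refine hcard.trans ?_
    rw [hTc]
    have : (2*((A+1)*B)+1)^s ≤ (3*(A+1)*B)^s := by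
      apply Nat.pow_le_pow_left
      nlinarith
    calc g d * B * (2*((A+1)*B)+1)^s ≤ g d * B * (3*(A+1)*B)^s := Nat.mul_le_mul_left _ this
      _ = _ := by rw [mul_pow]; ring
  · intro x hx
    rw [hT, Fintype.mem_piFinset]
    intro j
    rw [Finset.mem_Icc, ← abs_le]
    have h1 := hSB x hx j.succ.succ.succ
    have h2 := hSB x hx (Fin.succ (Fin.succ 0))
    have h3 : |(a j : ℤ) * x (Fin.succ (Fin.succ 0))| ≤ A * B := by
      rw [abs_mul, Nat.abs_cast]
      exact mul_le_mul (by exact_mod_cast ha j) h2 (abs_nonneg _) (by positivity)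
    have h4 := abs_sub (x j.succ.succ.succ) ((a j : ℤ) * x (Fin.succ (Fin.succ 0)))
    push_cast
    linarith
  · intro k _
    set fk := aeval (slz s a k) f with hfk
    have htop : homogeneousComponent d (toC fk) = aeval (slg s (fun j => (a j : ℂ))) (homogeneousComponent d (toC f)) := by
      rw [hfk, toC_aeval]
      exact hc_aeval _ d hz.1.le _ _ (slz_td s a k) (slz_hom s a k)
    have hzk : ZL (toC fk) d := by
      have h2 := slg_ZL s d (fun j => (a j : ℂ)) _ hz.hc
      rw [← htop] at h2
      refine ZL.of_le ?_ ?_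
      · rw [hfk, toC_aeval]
        exact (totalDegree_aeval_le _ _ (slz_td s a k)).trans hz.1.le
      · have h3 := h2.eval_ne
        rwa [homogeneousComponent_of_mem ((mem_homogeneousSubmodule _ _).2 (homogeneousComponent_isHomogeneous d (toC fk))), if_pos rfl] at h3
    let π : (Fin (s+3) → ℤ) → Fin 3 → ℤ := fun x => ![x 0, x (Fin.succ 0), x (Fin.succ (Fin.succ 0))]
    set Z := S.filter (fun x : Fin (s+3) → ℤ => (fun (j : Fin s) => x j.succ.succ.succ - a j * x (Fin.succ (Fin.succ 0)) : Fin s → ℤ) = k) with hZ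
    have hrec : ∀ x ∈ Z, (fun i => eval (π x) (slz s a k i)) = x := by
      intro x hx
      have hk := (Finset.mem_filter.1 hx).2
      ext i
      refine Fin.cases ?_ (fun i => Fin.cases ?_ (fun i => Fin.cases ?_ (fun j => ?_) i) i) i
      · rw [slz_0, eval_X]; rfl
      · rw [slz_1, eval_X]; rfl
      · rw [slz_2, eval_X]; rfl
      · rw [slz_s, ← hk]
        simp [π]
    have hinj : Set.InjOn π (Z : Set (Fin (s+3) → ℤ)) := by
      intro x hx y hy hxy
      rw [← hrec x hx, ← hrec y hy, hxy]
    rw [← Finset.card_image_of_injOn hinj]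
    refine hS fk d hd (ZL_toQ hzk) (by rw [htop]; exact hFa) B hB _ ?_ ?_
    · intro w hw
      obtain ⟨x, hx, rfl⟩ := Finset.mem_image.1 hw
      have hb := hSB x (Finset.mem_filter.1 hx).1
      intro i
      fin_cases i
      · exact hb _
      · exact hb _
      · exact hb _
    · intro w hw
      obtain ⟨x, hx, rfl⟩ := Finset.mem_image.1 hw
      rw [hfk, eval_aeval', hrec x hx]
      exact hSf x (Finset.mem_filter.1 hx).1
end DG

namespace DG
open MvPolynomial

lemma sh_top {m : ℕ} (f : MvPolynomial (Fin m) ℤ) (d : ℕ) (hd : (toC f).totalDegree ≤ d) (j : Fin m) (w : Fin m → ℕ) :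
    homogeneousComponent d (toC (aeval (shg j w) f)) = aeval (shg (R := ℂ) j w) (homogeneousComponent d (toC f)) := by
  rw [toC_aeval]
  refine hc_aeval _ d hd _ _ (fun i => ?_) (fun i => ?_)
  · rw [toC_shg]; exact shg_td j w i
  · rw [toC_shg]; exact shg_hom j w i

lemma sh_td {m : ℕ} (f : MvPolynomial (Fin m) ℤ) (d : ℕ) (hd : (toC f).totalDegree ≤ d) (j : Fin m) (w : Fin m → ℕ) :
    (toC (aeval (shg j w) f)).totalDegree ≤ d := by
  rw [toC_aeval]
  refine (totalDegree_aeval_le _ _ (fun i => ?_)).trans hd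
  rw [toC_shg]; exact shg_td j w i

lemma sh_root (s : ℕ) (P : MvPolynomial (Fin (s+3)) ℂ) (c : Fin (s+1) → ℕ) :
    (finSuccEquiv ℂ (s+1) (aeval (dhg s) (aeval (shg (R := ℂ) 1 (Fin.cons 0 (Fin.cons 0 c) : Fin (s+3) → ℕ)) P))).map (eval 0) =
    (finSuccEquiv ℂ (s+1) (aeval (dhg s) P)).map (eval fun i => (c i : ℂ)) := by
  have fX0 : ∀ k, finSuccEquiv ℂ k (X 0) = Polynomial.X := fun k => finSuccEquiv_X_zero
  have fXs : ∀ k (j : Fin k), finSuccEquiv ℂ k (X j.succ) = Polynomial.C (X j) := fun k j => finSuccEquiv_X_succ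
  have fC : ∀ k (c : ℂ), finSuccEquiv ℂ k (C c) = Polynomial.C (C c) := fun k c => by simp [finSuccEquiv_apply]
  let A1 : MvPolynomial (Fin (s+3)) ℂ →+* MvPolynomial (Fin (s+2)) ℂ := (aeval (dhg s) : MvPolynomial (Fin (s+3)) ℂ →ₐ[ℂ] _)
  let A2 : MvPolynomial (Fin (s+3)) ℂ →+* MvPolynomial (Fin (s+3)) ℂ := 
    (aeval (shg (R := ℂ) 1 (Fin.cons 0 (Fin.cons 0 c) : Fin (s+3) → ℕ)) : MvPolynomial (Fin (s+3)) ℂ →ₐ[ℂ] _)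
  let E1 : MvPolynomial (Fin (s+2)) ℂ →+* Polynomial (MvPolynomial (Fin (s+1)) ℂ) := RingHomClass.toRingHom (finSuccEquiv ℂ (s+1))
  have : (((Polynomial.mapRingHom (eval (0 : Fin (s+1) → ℂ))).comp E1).comp A1).comp A2 = 
     ((Polynomial.mapRingHom (eval (fun i => (c i : ℂ)))).comp E1).comp A1 := by
    apply MvPolynomial.ringHom_ext
    · intro e
      show Polynomial.map (eval 0) (finSuccEquiv ℂ (s+1) (aeval (dhg s) (aeval _ (C e)))) = Polynomial.map (eval fun i => (c i : ℂ)) (finSuccEquiv ℂ (s+1) (aeval (dhg s) (C e)))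
      rw [aeval_C, algebraMap_eq, aeval_C, algebraMap_eq, fC, Polynomial.map_C, Polynomial.map_C, eval_C, eval_C]
    · intro i
      show Polynomial.map (eval 0) (finSuccEquiv ℂ (s+1) (aeval (dhg s) (aeval (shg (R := ℂ) 1 (Fin.cons 0 (Fin.cons 0 c) : Fin (s+3) → ℕ)) (X i)))) = Polynomial.map (eval fun i => (c i : ℂ)) (finSuccEquiv ℂ (s+1) (aeval (dhg s) (X i)))
      rw [aeval_X, shg, map_add, map_mul, aeval_X, aeval_X, aeval_C, algebraMap_eq, dhg_1, mul_one]
      refine Fin.cases ?_ (fun i => Fin.cases ?_ (fun j => ?_) i) i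
      · rw [dhg_0, Fin.cons_zero, Nat.cast_zero, C_0, add_zero, fX0]; simp
      · rw [show dhg s (Fin.succ 0) = 1 from rfl, Fin.cons_succ, Fin.cons_zero, Nat.cast_zero, C_0, add_zero]; simp
      · rw [dhg_ss, Fin.cons_succ, Fin.cons_succ, map_add, fXs, fC, Polynomial.map_add, Polynomial.map_C, Polynomial.map_C, Polynomial.map_C, eval_C, eval_X, eval_X]
        simp
  exact congrArg (fun g => g P) this

lemma shg_ZL {k : ℕ} (F : MvPolynomial (Fin (k+1)) ℂ) (d : ℕ) (h : ZL F d) (j : Fin (k+1)) (hj : j ≠ 0) (w : Fin (k+1) → ℕ) :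
    ZL (aeval (shg (R := ℂ) j w) F) d := by
  refine h.aeval' _ (shg_td j w) fun i => ?_
  rw [shg_hom, shg, map_add, map_mul, eval_X, eval_X, Pi.single_eq_of_ne hj, mul_zero, add_zero]

lemma ZL_case (s : ℕ) : ∃ g, PB g ∧ ∀ (f : MvPolynomial (Fin (s+3)) ℤ) (d : ℕ), 5 ≤ d → ZL (toC f) d →
    Irreducible (homogeneousComponent d (toC f)) → 
    ∀ B, 1 ≤ B → ∀ S : Finset (Fin (s+3) → ℤ), (∀ x ∈ S, inBox B x) → (∀ x ∈ S, eval x f = 0) → S.card ≤ g d * B^(s+1) := by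
  obtain ⟨g, hg, hS⟩ := norm_case s
  refine ⟨fun d => g d * (2*d*d+1)^(s+1), ?_, ?_⟩
  · exact hg.mul (((((PB.const 2).mul PB.id).mul PB.id).add (PB.const 1)).pow (s+1))
  intro f d hd hz hirr B hB S hSB hSf
  obtain ⟨c, hc, ζ, h0, h1⟩ := sep s d (by omega) _ hz.hc (homogeneousComponent_isHomogeneous d _) hirr
  set w : Fin (s+3) → ℕ := Fin.cons 0 (Fin.cons 0 c) with hw
  have hw1 : w 1 = 0 := rfl
  have hwb : ∀ i, w i ≤ 2*d*d := by
    intro i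
    refine Fin.cases ?_ (fun i => Fin.cases ?_ (fun j => ?_) i) i
    · exact Nat.zero_le _
    · exact Nat.zero_le _
    · exact hc j
  obtain ⟨S', hS'c, hS'B, hS'f⟩ := sh_transfer f 1 w hw1 (2*d*d) B hwb S hSB hSf
  have htop := sh_top f d hz.1.le 1 w
  rw [← hS'c]
  have := hS (aeval (shg 1 w) f) d hd ?_ ?_ ⟨ζ, ?_, ?_⟩ ((2*d*d+1)*B) (Nat.one_le_iff_ne_zero.2 (by positivity)) S' hS'B hS'f
  · rw [mul_pow, ← mul_assoc] at this; exact this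
  · rw [toC_aeval, show (fun i => toC (shg 1 w i)) = shg (R := ℂ) 1 w from funext fun i => toC_shg 1 w i]
    exact shg_ZL _ d hz 1 (by simp) w
  · rw [htop]; exact sh_irr 1 w hw1 _ hirr
  · rw [htop, hw, sh_root]; exact h0
  · rw [htop, hw, sh_root]; exact h1

lemma gen_case (s : ℕ) : ∃ g, PB g ∧ ∀ (f : MvPolynomial (Fin (s+3)) ℤ) (d : ℕ), 5 ≤ d → (toC f).totalDegree ≤ d →
    Irreducible (homogeneousComponent d (toC f)) → 
    ∀ B, 1 ≤ B → ∀ S : Finset (Fin (s+3) → ℤ), (∀ x ∈ S, inBox B x) → (∀ x ∈ S, eval x f = 0) → S.card ≤ g d * B^(s+1) := by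
  obtain ⟨g, hg, hS⟩ := ZL_case s
  refine ⟨fun d => g d * (d+1)^(s+1), ?_, ?_⟩
  · exact hg.mul ((PB.id.add (PB.const 1)).pow (s+1))
  intro f d hd hz hirr B hB S hSB hSf
  obtain ⟨w0, hw0, hwb, hne⟩ := exists_small_hom (homogeneousComponent d (toC f)) hirr.ne_zero d d (homogeneousComponent_isHomogeneous d _) le_rfl (by omega) 0
  set w : Fin (s+3) → ℕ := fun i => if i = 0 then 0 else w0 i with hw
  have hw1 : w 0 = 0 := rfl
  have hwb' : ∀ i, w i ≤ d := by
    intro i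
    simp only [hw]
    split_ifs
    · omega
    · exact hwb i
  obtain ⟨S', hS'c, hS'B, hS'f⟩ := sh_transfer f 0 w hw1 d B hwb' S hSB hSf
  have htop := sh_top f d hz 0 w
  rw [← hS'c]
  have := hS (aeval (shg 0 w) f) d hd ?_ ?_ ((d+1)*B) (Nat.one_le_iff_ne_zero.2 (by positivity)) S' hS'B hS'f
  · rw [mul_pow, ← mul_assoc] at this; exact this
  · refine ZL.of_le (sh_td f d hz 0 w) ?_
    rw [htop, eval_aeval']
    have e : (fun i => eval (Pi.single 0 1) (shg (R := ℂ) 0 w i)) = fun i => (w0 i : ℂ) := by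
      ext i
      by_cases hi : i = 0
      · subst hi; simp [shg, hw, hw0]
      · simp [shg, hw, hi]
    rw [e]; exact hne
  · rw [htop]; exact sh_irr 0 w hw1 _ hirr

end DG

theorem dimension_growth_affine_deg_ge_five (n : ℕ) (hn : 2 < n) :
    ∃ c e : ℝ, ∀ (f : MvPolynomial (Fin n) ℤ) (d : ℕ),
      d = f.totalDegree → 5 ≤ d →
      Irreducible (MvPolynomial.map (Int.castRingHom ℂ)
        (MvPolynomial.homogeneousComponent d f)) →
      ∀ H : ℝ, 2 ≤ H →
      ∀ S : Set (Fin n → ℤ),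
        S = {x | MvPolynomial.eval x f = 0 ∧ ∀ i, (|x i| : ℝ) ≤ H} →
        S.Finite ∧ (S.ncard : ℝ) ≤ c * (d : ℝ) ^ e * H ^ ((n : ℝ) - 2) := by
  obtain ⟨s, rfl⟩ : ∃ s, n = s + 3 := ⟨n - 3, by omega⟩
  obtain ⟨g, ⟨K, hK⟩, hg⟩ := DG.gen_case s
  refine ⟨(K * 2^K : ℝ), (K : ℝ), ?_⟩
  rintro f d hfd hd hirr H hH S rfl
  have hHn : (0:ℝ) ≤ H := by linarith
  set B := ⌊H⌋₊ with hB
  have hBH : (B : ℝ) ≤ H := Nat.floor_le hHn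
  have hB1 : 1 ≤ B := Nat.le_floor (by push_cast; linarith)
  have hbox : ∀ x ∈ {x : Fin (s+3) → ℤ | MvPolynomial.eval x f = 0 ∧ ∀ i, (|x i| : ℝ) ≤ H}, DG.inBox B x := by
    rintro x ⟨-, hx⟩ i
    have h1 := hx i
    have h2 : (x i).natAbs ≤ B := by
      apply Nat.le_floor
      rw [Nat.cast_natAbs]; push_cast; exact h1
    rw [Int.abs_eq_natAbs]; exact_mod_cast h2
  have hfin : {x : Fin (s+3) → ℤ | MvPolynomial.eval x f = 0 ∧ ∀ i, (|x i| : ℝ) ≤ H}.Finite := by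
    refine (Fintype.piFinset fun _ : Fin (s+3) => Finset.Icc (-(B:ℤ)) B).finite_toSet.subset fun x hx => ?_
    rw [Finset.mem_coe, Fintype.mem_piFinset]
    intro i
    rw [Finset.mem_Icc, ← abs_le]
    exact hbox x hx i
  refine ⟨hfin, ?_⟩
  have htd : (DG.toC f).totalDegree ≤ d := by
    rw [hfd, DG.toC_eq, DG.td_map, DG.totalDegree_toQ]
  have hcard := hg f d hd htd (by rw [← DG.toC_hc]; exact hirr) B hB1 hfin.toFinset
    (fun x hx => hbox x (hfin.mem_toFinset.1 hx)) (fun x hx => (hfin.mem_toFinset.1 hx).1)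
  rw [Set.ncard_eq_toFinset_card _ hfin]
  have h1 : hfin.toFinset.card ≤ K * (2*d)^K * B^(s+1) := by
    refine hcard.trans (Nat.mul_le_mul_right _ ((hK d).trans (Nat.mul_le_mul_left _ ?_)))
    exact Nat.pow_le_pow_left (by omega) _
  have h2 : (hfin.toFinset.card : ℝ) ≤ K * (2*d)^K * B^(s+1) := by exact_mod_cast h1
  have e1 : ((s+3 : ℕ) : ℝ) - 2 = ((s+1 : ℕ) : ℝ) := by push_cast; ring
  rw [e1, Real.rpow_natCast, Real.rpow_natCast]
  refine h2.trans ?_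
  rw [mul_pow, ← mul_assoc]
  gcongr
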